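/- Let n ∈ {2,3,4}, let Ω ⊆ ℝⁿ be a bounded smooth domain which is convex in case n ∈ {3,4}, and let f : ℝ → ℝ be a C∞ function with f(s) ≥ 0 for all s ≥ 0. Let u ∈ L¹(Ω) be a weak solution of −Δu = f(u) in Ω, u = 0 on ∂Ω, with u > 0 a.e. in Ω, and suppose there is a sequence (u_k) of classical semi-stable solutions of the same Dirichlet problem with u_k > 0 in Ω and u_k → u in L¹(Ω). Then u ∈ L∞(Ω), i.e. there is M such that |u(x)| ≤ M for a.e. x ∈ Ω. -/

import Mathlib

open MeasureTheory Filter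

noncomputable section

/-- The Euclidean Laplacian: trace of the Hessian. -/
def lapl {n : ℕ} (u : EuclideanSpace ℝ (Fin n) → ℝ) (x : EuclideanSpace ℝ (Fin n)) : ℝ :=
  ∑ i : Fin n, fderiv ℝ (fun y => fderiv ℝ u y (EuclideanSpace.single i 1)) x
    (EuclideanSpace.single i 1)

/-- Entries of the Hessian matrix. -/
def hess {n : ℕ} (u : EuclideanSpace ℝ (Fin n) → ℝ) (x : EuclideanSpace ℝ (Fin n))
    (i j : Fin n) : ℝ :=
  fderiv ℝ (fun y => fderiv ℝ u y (EuclideanSpace.single j 1)) x (EuclideanSpace.single i 1)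

/-- A bounded smooth domain of ℝⁿ. -/
def IsSmoothBoundedDomain {n : ℕ} (Ω : Set (EuclideanSpace ℝ (Fin n))) : Prop :=
  IsOpen Ω ∧ Bornology.IsBounded Ω ∧ Ω.Nonempty ∧
  ∃ ρ : EuclideanSpace ℝ (Fin n) → ℝ, ContDiff ℝ (⊤ : ℕ∞) ρ ∧
    Ω = {x | ρ x < 0} ∧ frontier Ω = {x | ρ x = 0} ∧
    ∀ x ∈ frontier Ω, gradient ρ x ≠ 0

/-- Classical solution of −Δu = f(u) in Ω, u = 0 on ∂Ω. -/
def IsClassicalSol {n : ℕ} (Ω : Set (EuclideanSpace ℝ (Fin n))) (f : ℝ → ℝ)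
    (u : EuclideanSpace ℝ (Fin n) → ℝ) : Prop :=
  (∃ U, IsOpen U ∧ closure Ω ⊆ U ∧ ContDiffOn ℝ 2 u U) ∧
  (∀ x ∈ Ω, lapl u x + f (u x) = 0) ∧
  (∀ x ∈ frontier Ω, u x = 0)

/-- Semi-stability of a solution u. -/
def IsSemiStable {n : ℕ} (Ω : Set (EuclideanSpace ℝ (Fin n))) (f : ℝ → ℝ)
    (u : EuclideanSpace ℝ (Fin n) → ℝ) : Prop :=
  ∀ ξ : EuclideanSpace ℝ (Fin n) → ℝ, (∃ K : NNReal, LipschitzWith K ξ) →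
    (∀ x ∈ frontier Ω, ξ x = 0) →
    0 ≤ ∫ x in Ω, (‖gradient ξ x‖ ^ 2 - deriv f (u x) * ξ x ^ 2)

/-- Weak solution of −Δu = f(u) in Ω, u = 0 on ∂Ω. -/
def IsWeakSol {n : ℕ} (Ω : Set (EuclideanSpace ℝ (Fin n))) (f : ℝ → ℝ)
    (u : EuclideanSpace ℝ (Fin n) → ℝ) : Prop :=
  IntegrableOn u Ω volume ∧
  IntegrableOn (fun x => f (u x) * Metric.infDist x (frontier Ω)) Ω volume ∧
  ∀ ξ : EuclideanSpace ℝ (Fin n) → ℝ,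
    (∃ U, IsOpen U ∧ closure Ω ⊆ U ∧ ContDiffOn ℝ 2 ξ U) →
    (∀ x ∈ frontier Ω, ξ x = 0) →
    ∫ x in Ω, (u x * lapl ξ x + f (u x) * ξ x) = 0

abbrev Eu (n : ℕ) := EuclideanSpace ℝ (Fin n)

/-- The `i`-th partial derivative. -/
def pd {n : ℕ} (i : Fin n) (u : Eu n → ℝ) (x : Eu n) : ℝ :=
  fderiv ℝ u x (EuclideanSpace.single i 1)

/-- The squared length of the gradient, in coordinates. -/
def gsq {n : ℕ} (u : Eu n → ℝ) (x : Eu n) : ℝ := ∑ i, pd i u x ^ 2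

section Basic

variable {n : ℕ} {u v : Eu n → ℝ} {x : Eu n}

lemma lapl_eq (u : Eu n → ℝ) (x : Eu n) : lapl u x = ∑ i, pd i (pd i u) x := rfl

lemma pd_add (i : Fin n) (hu : DifferentiableAt ℝ u x) (hv : DifferentiableAt ℝ v x) :
    pd i (fun y => u y + v y) x = pd i u x + pd i v x := by
  simp [pd, fderiv_fun_add hu hv]

lemma pd_sub (i : Fin n) (hu : DifferentiableAt ℝ u x) (hv : DifferentiableAt ℝ v x) :
    pd i (fun y => u y - v y) x = pd i u x - pd i v x := by
  simp [pd, fderiv_fun_sub hu hv]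

lemma pd_mul (i : Fin n) (hu : DifferentiableAt ℝ u x) (hv : DifferentiableAt ℝ v x) :
    pd i (fun y => u y * v y) x = pd i u x * v x + u x * pd i v x := by
  simp [pd, fderiv_fun_mul hu hv]; ring

lemma pd_sq (i : Fin n) (hu : DifferentiableAt ℝ u x) :
    pd i (fun y => u y ^ 2) x = 2 * u x * pd i u x := by
  have : (fun y => u y ^ 2) = fun y => u y * u y := by funext y; ring
  rw [this, pd_mul i hu hu]; ring

lemma pd_sum {ι : Type*} (s : Finset ι) (i : Fin n) {g : ι → Eu n → ℝ}
    (hg : ∀ k ∈ s, DifferentiableAt ℝ (g k) x) :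
    pd i (fun y => ∑ k ∈ s, g k y) x = ∑ k ∈ s, pd i (g k) x := by
  simp [pd, fderiv_fun_sum hg]

lemma pd_const (i : Fin n) (c : ℝ) : pd i (fun _ => c) x = 0 := by
  simp [pd]

lemma pd_const_mul (i : Fin n) (c : ℝ) (hu : DifferentiableAt ℝ u x) :
    pd i (fun y => c * u y) x = c * pd i u x := by
  simp [pd, fderiv_const_mul hu]

lemma pd_comp (i : Fin n) {g : ℝ → ℝ} {g' : ℝ} (hg : HasDerivAt g g' (u x))
    (hu : DifferentiableAt ℝ u x) : pd i (fun y => g (u y)) x = g' * pd i u x := by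
  have := (hg.comp_hasFDerivAt x hu.hasFDerivAt).fderiv
  simp only [pd]
  rw [show (fun y => g (u y)) = g ∘ u from rfl, this]; simp

lemma pd_coord (i j : Fin n) : pd i (fun y : Eu n => y j) x = if i = j then 1 else 0 := by
  have : HasFDerivAt (fun y : Eu n => y j) (EuclideanSpace.proj j : Eu n →L[ℝ] ℝ) x :=
    (EuclideanSpace.proj j : Eu n →L[ℝ] ℝ).hasFDerivAt
  simp only [pd, this.fderiv]
  simp [eq_comm]

lemma pd_congr (i : Fin n) (h : u =ᶠ[nhds x] v) : pd i u x = pd i v x := by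
  simp only [pd, h.fderiv_eq]

lemma pd_eventuallyEq (i : Fin n) (h : u =ᶠ[nhds x] v) : pd i u =ᶠ[nhds x] pd i v := by
  filter_upwards [eventually_eventually_nhds.2 h] with y hy using pd_congr i hy

lemma lapl_congr (h : u =ᶠ[nhds x] v) : lapl u x = lapl v x := by
  simp only [lapl_eq]
  exact Finset.sum_congr rfl fun i _ => pd_congr i (pd_eventuallyEq i h)

lemma contDiffAt_pd (i : Fin n) {k m : WithTop ℕ∞} (hu : ContDiffAt ℝ m u x) (h : k + 1 ≤ m) :
    ContDiffAt ℝ k (pd i u) x :=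
  (hu.fderiv_right h).clm_apply contDiffAt_const

lemma contDiff_pd (i : Fin n) {k m : WithTop ℕ∞} (hu : ContDiff ℝ m u) (h : k + 1 ≤ m) :
    ContDiff ℝ k (pd i u) :=
  contDiff_iff_contDiffAt.2 fun _ => contDiffAt_pd i hu.contDiffAt h

lemma contDiff_one_pd (i : Fin n) (hu : ContDiff ℝ 2 u) : ContDiff ℝ 1 (pd i u) :=
  contDiff_pd i hu (by norm_num)

lemma continuous_pd (i : Fin n) (hu : ContDiff ℝ 1 u) : Continuous (pd i u) :=
  (contDiff_pd i (k := 0) hu (by norm_num)).continuous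

lemma hasCompactSupport_pd (i : Fin n) (hu : HasCompactSupport u) :
    HasCompactSupport (pd i u) :=
  hu.fderiv_apply (𝕜 := ℝ) (EuclideanSpace.single i 1)

lemma pd_eq_zero_of_notMem_tsupport (i : Fin n) (hx : x ∉ tsupport u) : pd i u x = 0 := by
  have : u =ᶠ[nhds x] fun _ => 0 := notMem_tsupport_iff_eventuallyEq.1 hx
  rw [pd_congr i this, pd_const]

lemma fderiv_eq_sum (w : Eu n) : fderiv ℝ u x w = ∑ i, w i * pd i u x := by
  have : w = ∑ i, w i • EuclideanSpace.single i (1 : ℝ) := by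
    have := (EuclideanSpace.basisFun (Fin n) ℝ).sum_repr w
    simpa using this.symm
  conv_lhs => rw [this]
  simp [pd]

lemma norm_gradient_sq (u : Eu n → ℝ) (x : Eu n) : ‖gradient u x‖ ^ 2 = gsq u x := by
  rw [EuclideanSpace.norm_sq_eq, gsq]
  refine Finset.sum_congr rfl fun i _ => ?_
  rw [Real.norm_eq_abs, sq_abs]
  congr 1
  have : inner ℝ (gradient u x) (EuclideanSpace.single i (1 : ℝ)) = pd i u x := by
    rw [gradient, InnerProductSpace.toDual_symm_apply, pd]
  rw [← this, EuclideanSpace.inner_single_right]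
  simp

lemma gsq_nonneg (u : Eu n → ℝ) (x : Eu n) : 0 ≤ gsq u x :=
  Finset.sum_nonneg fun _ _ => sq_nonneg _

lemma pd_symm (hu : ContDiffAt ℝ 2 u x) (i j : Fin n) : pd i (pd j u) x = pd j (pd i u) x := by
  have hd : DifferentiableAt ℝ (fderiv ℝ u) x :=
    (hu.fderiv_right (m := 1) (by norm_num)).differentiableAt (by norm_num)
  have key : ∀ a b : Fin n, pd a (pd b u) x
      = fderiv ℝ (fderiv ℝ u) x (EuclideanSpace.single a 1) (EuclideanSpace.single b 1) := by
    intro a b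
    simp only [pd]
    rw [show (pd b u) = fun y => fderiv ℝ u y (EuclideanSpace.single b 1) from rfl,
      fderiv_clm_apply hd (differentiableAt_const _)]
    simp
  rw [key, key]
  exact (hu.isSymmSndFDerivAt (by simp)).eq _ _

lemma integral_pd_eq_zero (i : Fin n) (hu : ContDiff ℝ 1 u) (hc : HasCompactSupport u) :
    ∫ y, pd i u y = 0 := by
  have h1 : Integrable (pd i u) :=
    (continuous_pd i hu).integrable_of_hasCompactSupport (hasCompactSupport_pd i hc)
  have := integral_mul_fderiv_eq_neg_fderiv_mul_of_integrable (μ := (volume : Measure (Eu n)))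
    (f := fun _ => (1 : ℝ)) (g := u) (v := EuclideanSpace.single i 1) (by simp)
    (by simp only [one_mul]; exact h1)
    (by simpa using hu.continuous.integrable_of_hasCompactSupport hc)
    (fun _ _ => by fun_prop) (fun y _ => (hu.differentiable (by norm_num)).differentiableAt)
  simpa [pd] using this

lemma integral_pd_mul_pd_comm (i j : Fin n) (hu : ContDiff ℝ 1 u) (hcu : HasCompactSupport u)
    (hv : ContDiff ℝ 1 v) (hcv : HasCompactSupport v) :
    ∫ y, pd i u y * pd j v y = ∫ y, pd j u y * pd i v y := by
  obtain ⟨Cu, hLu⟩ := hu.lipschitzWith_of_hasCompactSupport hcu (by norm_num)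
  obtain ⟨Cv, hLv⟩ := hv.lipschitzWith_of_hasCompactSupport hcv (by norm_num)
  have hdu : Differentiable ℝ u := hu.differentiable (by norm_num)
  have hdv : Differentiable ℝ v := hv.differentiable (by norm_num)
  set e : Eu n := EuclideanSpace.single i 1 with he
  have hIv : Integrable (pd j v) :=
    (continuous_pd j hv).integrable_of_hasCompactSupport (hasCompactSupport_pd j hcv)
  have hIu : Integrable (pd j u) :=
    (continuous_pd j hu).integrable_of_hasCompactSupport (hasCompactSupport_pd j hcu)
  have T1 := hLu.integral_inv_smul_sub_mul_tendsto_integral_lineDeriv_mul (μ := volume) hIv e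
  have T2 := hLv.integral_inv_smul_sub_mul_tendsto_integral_lineDeriv_mul (μ := volume) hIu (-e)
  have e1 : ∀ y, lineDeriv ℝ u y e = pd i u y := fun y => (hdu y).lineDeriv_eq_fderiv
  have e2 : ∀ y, lineDeriv ℝ v y (-e) = - pd i v y := fun y => by
    rw [(hdv y).lineDeriv_eq_fderiv]; simp [pd, he]
  simp only [e1] at T1
  simp only [e2] at T2
  have T2' := T2.neg
  have hdm : ∀ a : Eu n → ℝ, ∀ ha : Differentiable ℝ a, ∀ w : Eu n, ∀ y,
      pd j (fun z => a (z + w)) y = pd j a (y + w) := by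
    intro a ha w y
    simp only [pd]
    rw [fderiv_comp_add_right]
  have key : ∀ t : ℝ, ∫ y, t⁻¹ • (u (y + t • e) - u y) * pd j v y
      = - ∫ y, t⁻¹ • (v (y + t • (-e)) - v y) * pd j u y := by
    intro t
    have hsh : ContDiff ℝ 1 (fun y => u (y + t • e)) := hu.comp (by fun_prop)
    have hpr : ContDiff ℝ 1 (fun y => t⁻¹ * (u (y + t • e) - u y) * v y) := by fun_prop
    have hz := integral_pd_eq_zero j hpr (hcv.mul_left)
    have hform : ∀ y, pd j (fun y => t⁻¹ * (u (y + t • e) - u y) * v y) y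
        = t⁻¹ * (pd j u (y + t • e) - pd j u y) * v y
          + t⁻¹ * (u (y + t • e) - u y) * pd j v y := by
      intro y
      have hd1 : DifferentiableAt ℝ (fun y => u (y + t • e)) y :=
        (hsh.differentiable (by norm_num)) y
      rw [pd_mul j (by fun_prop) (by fun_prop), pd_const_mul j _ (by fun_prop),
        pd_sub j hd1 (by fun_prop), hdm u hdu]
    simp only [hform] at hz
    have hcpj := hasCompactSupport_pd j hcv
    have cpu := continuous_pd j hu
    have cpv := continuous_pd j hv
    have cu := hu.continuous
    have cv := hv.continuous
    have I1 : Integrable (fun y => t⁻¹ * (pd j u (y + t • e) - pd j u y) * v y) :=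
      Continuous.integrable_of_hasCompactSupport (by fun_prop) hcv.mul_left
    have I2 : Integrable (fun y => t⁻¹ * (u (y + t • e) - u y) * pd j v y) :=
      Continuous.integrable_of_hasCompactSupport (by fun_prop) hcpj.mul_left
    rw [integral_add I1 I2] at hz
    have hA : ∫ y, t⁻¹ * (pd j u (y + t • e) - pd j u y) * v y
        = ∫ y, t⁻¹ * (v (y + t • (-e)) - v y) * pd j u y := by
      have J1 : Integrable (fun y => t⁻¹ * (pd j u (y + t • e) * v y)) :=
        Continuous.integrable_of_hasCompactSupport (by fun_prop) (hcv.mul_left).mul_left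
      have J2 : Integrable (fun y => t⁻¹ * (pd j u y * v y)) :=
        Continuous.integrable_of_hasCompactSupport (by fun_prop) (hcv.mul_left).mul_left
      have J3 : Integrable (fun y => t⁻¹ * (pd j u y * v (y + t • (-e)))) :=
        Continuous.integrable_of_hasCompactSupport (by fun_prop)
          ((hasCompactSupport_pd j hcu).mul_right).mul_left
      have a1 : (fun y => t⁻¹ * (pd j u (y + t • e) - pd j u y) * v y)
          = fun y => t⁻¹ * (pd j u (y + t • e) * v y) - t⁻¹ * (pd j u y * v y) := by
        funext y; ring
      have a2 : (fun y => t⁻¹ * (v (y + t • (-e)) - v y) * pd j u y)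
          = fun y => t⁻¹ * (pd j u y * v (y + t • (-e))) - t⁻¹ * (pd j u y * v y) := by
        funext y; ring
      rw [a1, a2, integral_sub J1 J2, integral_sub J3 J2]
      congr 1
      rw [← integral_add_right_eq_self (fun y => t⁻¹ * (pd j u y * v (y + t • (-e)))) (t • e)]
      simp
    simp only [smul_eq_mul]
    linarith
  have T1' : Tendsto (fun t : ℝ => ∫ y, t⁻¹ • (u (y + t • e) - u y) * pd j v y)
      (nhdsWithin 0 (Set.Ioi 0)) (nhds (- ∫ y, - pd i v y * pd j u y)) := by
    simp only [key]; exact T2'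
  rw [tendsto_nhds_unique T1 T1', ← integral_neg]
  congr 1; funext y; ring

end Basic

lemma trace_contraction_sq_le {n : ℕ} (hn : 2 ≤ n) (A : Fin n → Fin n → ℝ)
    (p X : Fin n → ℝ) {ε : ℝ} (hε : 0 < ε) :
    ((∑ i, X i * p i) * (∑ j, A j j) - ∑ i, ∑ j, A i j * (p i * X j)) ^ 2 ≤
      (n - 1) * (∑ i, X i ^ 2) * (∑ i, p i ^ 2) *
        (∑ i, ∑ j, A i j ^ 2 - ∑ i, (∑ j, A i j * p j) ^ 2 / (∑ j, p j ^ 2 + ε)) := by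
  set N := ∑ i, p i ^ 2 with hN
  set a := ∑ i, X i * p i with ha
  set Q := ∑ i, X i ^ 2 with hQ
  have hN0 : 0 ≤ N := Finset.sum_nonneg fun _ _ => sq_nonneg _
  have hQ0 : 0 ≤ Q := Finset.sum_nonneg fun _ _ => sq_nonneg _
  have hn' : (2 : ℝ) ≤ n := by exact_mod_cast hn
  rcases hN0.eq_or_lt with h0 | hpos
  · have hp : ∀ i, p i = 0 := by
      intro i
      have := (Finset.sum_eq_zero_iff_of_nonneg (s := Finset.univ)
        (f := fun i => p i ^ 2) (fun _ _ => sq_nonneg _)).1 h0.symm i (Finset.mem_univ _)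
      simpa using this
    have : a = 0 := by simp [ha, hp]
    rw [← h0, this]; simp [hp]
  set w : Fin n → ℝ := fun i => ∑ j, A i j * p j with hw
  set M : Fin n → Fin n → ℝ := fun i j => (if i = j then a else 0) - p i * X j with hM
  set B : Fin n → Fin n → ℝ := fun i j => A i j - w i * p j / N with hB
  have hMp : ∀ i, ∑ j, M i j * p j = 0 := by
    intro i
    have e : ∑ j, M i j * p j = (∑ j, (if i = j then a else 0) * p j) - p i * a := by
      rw [ha, Finset.mul_sum, ← Finset.sum_sub_distrib]
      exact Finset.sum_congr rfl fun j _ => by simp only [hM]; ring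
    rw [e]; simp; ring
  have hLHS : a * (∑ j, A j j) - ∑ i, ∑ j, A i j * (p i * X j) = ∑ i, ∑ j, B i j * M i j := by
    have e1 : ∑ i, ∑ j, B i j * M i j
        = ∑ i, (∑ j, A i j * M i j - w i / N * ∑ j, M i j * p j) := by
      refine Finset.sum_congr rfl fun i _ => ?_
      rw [Finset.mul_sum, ← Finset.sum_sub_distrib]
      exact Finset.sum_congr rfl fun j _ => by simp only [hB]; ring
    rw [e1]
    simp only [hMp, mul_zero, sub_zero]
    have e2 : ∀ i, ∑ j, A i j * M i j = a * A i i - ∑ j, A i j * (p i * X j) := by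
      intro i
      have : ∀ j, A i j * M i j = (if i = j then A i j * a else 0) - A i j * (p i * X j) := by
        intro j; simp only [hM]; split_ifs <;> ring
      simp only [this, Finset.sum_sub_distrib]
      simp; ring
    simp only [e2, Finset.sum_sub_distrib, Finset.mul_sum]
  have hCS : (∑ i, ∑ j, B i j * M i j) ^ 2 ≤ (∑ i, ∑ j, B i j ^ 2) * ∑ i, ∑ j, M i j ^ 2 := by
    have := Finset.sum_mul_sq_le_sq_mul_sq (Finset.univ : Finset (Fin n × Fin n))
      (fun q => B q.1 q.2) (fun q => M q.1 q.2)
    simpa only [Fintype.sum_prod_type] using this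
  have hBsq : ∑ i, ∑ j, B i j ^ 2 = ∑ i, ∑ j, A i j ^ 2 - ∑ i, w i ^ 2 / N := by
    rw [← Finset.sum_sub_distrib]
    refine Finset.sum_congr rfl fun i _ => ?_
    have : ∀ j, B i j ^ 2
        = A i j ^ 2 - 2 * w i / N * (A i j * p j) + w i ^ 2 / N ^ 2 * p j ^ 2 := by
      intro j; simp only [hB]; ring
    simp only [this, Finset.sum_add_distrib, Finset.sum_sub_distrib, ← Finset.mul_sum]
    rw [← hN]
    change _ - 2 * w i / N * w i + _ = _
    field_simp; ring
  have hMsq : ∑ i, ∑ j, M i j ^ 2 = (n - 2) * a ^ 2 + N * Q := by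
    have : ∀ i j, M i j ^ 2
        = (if i = j then a ^ 2 else 0) - 2 * (if i = j then a * (X j * p i) else 0)
          + p i ^ 2 * X j ^ 2 := by
      intro i j; simp only [hM]; split_ifs <;> ring
    simp only [this, Finset.sum_add_distrib, Finset.sum_sub_distrib, ← Finset.mul_sum,
      ← Finset.sum_mul]
    simp only [Finset.sum_ite_eq, Finset.mem_univ, if_true, ← Finset.mul_sum]
    rw [← hN, ← hQ, ← ha]
    simp; ring
  have ha2 : a ^ 2 ≤ Q * N := Finset.sum_mul_sq_le_sq_mul_sq _ _ _
  have hM2 : ∑ i, ∑ j, M i j ^ 2 ≤ (n - 1) * Q * N := by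
    rw [hMsq]; nlinarith
  have hB0 : 0 ≤ ∑ i, ∑ j, B i j ^ 2 :=
    Finset.sum_nonneg fun _ _ => Finset.sum_nonneg fun _ _ => sq_nonneg _
  have hmono : ∑ i, ∑ j, B i j ^ 2
      ≤ ∑ i, ∑ j, A i j ^ 2 - ∑ i, w i ^ 2 / (N + ε) := by
    rw [hBsq]
    gcongr with i
    linarith
  rw [hLHS]
  calc _ ≤ _ := hCS
    _ ≤ (∑ i, ∑ j, B i j ^ 2) * ((n - 1) * Q * N) := by gcongr
    _ = ((n - 1) * Q * N) * (∑ i, ∑ j, B i j ^ 2) := by ring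
    _ ≤ _ := by
      apply mul_le_mul_of_nonneg_left hmono
      have : (0 : ℝ) ≤ n - 1 := by linarith
      positivity

/-- A regularised version of `|D²u|² - |∇|∇u||²`. -/
def hessDefect {n : ℕ} (ε : ℝ) (u : Eu n → ℝ) (x : Eu n) : ℝ :=
  ∑ i, ∑ j, pd i (pd j u) x ^ 2 -
    ∑ i, (∑ j, pd i (pd j u) x * pd j u x) ^ 2 / (∑ j, pd j u x ^ 2 + ε)

section

variable {n : ℕ} {u : Eu n → ℝ}

lemma continuous_pd_pd (hu : ContDiff ℝ 2 u) (i j : Fin n) : Continuous (pd i (pd j u)) :=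
  continuous_pd i (contDiff_one_pd j hu)

lemma contDiff_gsq (hu : ContDiff ℝ 2 u) : ContDiff ℝ 1 (gsq u) := by
  unfold gsq
  exact ContDiff.sum fun i _ => (contDiff_one_pd i hu).pow 2

lemma continuous_gsq (hu : ContDiff ℝ 1 u) : Continuous (gsq u) := by
  unfold gsq
  exact continuous_finsetSum _ fun i _ => (continuous_pd i hu).pow 2

lemma continuous_lapl (hu : ContDiff ℝ 2 u) : Continuous (lapl u) := by
  change Continuous fun x => ∑ i, pd i (pd i u) x
  exact continuous_finsetSum _ fun i _ => continuous_pd_pd hu i i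

lemma continuous_hessDefect (hu : ContDiff ℝ 2 u) {ε : ℝ} (hε : 0 < ε) :
    Continuous (hessDefect ε u) := by
  unfold hessDefect
  have h2 := continuous_pd_pd hu
  have h1 : ∀ j, Continuous (pd j u) := fun j => continuous_pd j (hu.of_le (by norm_num))
  have hne : ∀ x, ∑ j, pd j u x ^ 2 + ε ≠ 0 := fun x => by
    have := gsq_nonneg u x
    unfold gsq at this
    positivity
  refine Continuous.sub (by fun_prop) (continuous_finsetSum _ fun i _ => ?_)
  exact Continuous.div (by fun_prop) (by fun_prop) hne

/-- Pohozaev-type identity for a compactly supported vector field `X`. -/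
lemma integral_pohozaev (hu : ContDiff ℝ 2 u) (X : Fin n → Eu n → ℝ)
    (hX : ∀ i, ContDiff ℝ 1 (X i)) (hXc : ∀ i, HasCompactSupport (X i)) :
    ∫ x, (gsq u x * ∑ j, pd j (X j) x - ∑ i, ∑ j, pd j (X i) x * (pd i u x * pd j u x)) =
      ∫ x, ((∑ i, X i x * pd i u x) * lapl u x
        - ∑ i, ∑ j, pd i (pd j u) x * (pd i u x * X j x)) := by
  have cX := fun i => (hX i).continuous
  have cX' := fun i j => continuous_pd i (hX j)
  have c1 : ∀ j, Continuous (pd j u) := fun j => continuous_pd j (hu.of_le (by norm_num))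
  have c2 := continuous_pd_pd hu
  have cg := continuous_gsq (hu.of_le (by norm_num : (1 : WithTop ℕ∞) ≤ 2))
  have cl := continuous_lapl hu
  have hcs : ∀ i j, HasCompactSupport (pd i (X j)) := fun i j => hasCompactSupport_pd i (hXc j)
  set W : Fin n → Eu n → ℝ := fun j x =>
    X j x * gsq u x - (∑ i, X i x * pd i u x) * pd j u x with hW
  have hs : ContDiff ℝ 1 (fun x => ∑ i, X i x * pd i u x) :=
    ContDiff.sum fun i _ => (hX i).mul (contDiff_one_pd i hu)
  have hW1 : ∀ j, ContDiff ℝ 1 (W j) := fun j =>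
    ((hX j).mul (contDiff_gsq hu)).sub (hs.mul (contDiff_one_pd j hu))
  have hsum : HasCompactSupport (fun x => ∑ i, X i x * pd i u x) := by
    have : (fun x => ∑ i, X i x * pd i u x) = ∑ i, (fun x => X i x * pd i u x) := by
      funext x; simp
    rw [this]
    refine Finset.sum_induction _ (fun g : Eu n → ℝ => HasCompactSupport g)
      (fun a b ha hb => ha.add hb) HasCompactSupport.zero fun i _ => (hXc i).mul_right
  have hWc : ∀ j, HasCompactSupport (W j) := fun j =>
    ((hXc j).mul_right).sub (hsum.mul_right)
  have hz : ∀ j, ∫ x, pd j (W j) x = 0 := fun j => integral_pd_eq_zero j (hW1 j) (hWc j)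
  have hzs : ∫ x, ∑ j, pd j (W j) x = 0 := by
    rw [integral_finsetSum _ fun j _ => (continuous_pd j
      (hW1 j)).integrable_of_hasCompactSupport (hasCompactSupport_pd j (hWc j))]
    simp [hz]
  have hI1 : Integrable (fun x => gsq u x * ∑ j, pd j (X j) x
      - ∑ i, ∑ j, pd j (X i) x * (pd i u x * pd j u x)) := by
    refine Integrable.sub ?_ ?_
    · simp only [Finset.mul_sum]
      exact integrable_finsetSum _ fun j _ => Continuous.integrable_of_hasCompactSupport
        (by fun_prop) (hcs j j).mul_left
    · exact integrable_finsetSum _ fun i _ => integrable_finsetSum _ fun j _ =>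
        Continuous.integrable_of_hasCompactSupport (by fun_prop) (hcs j i).mul_right
  have hI2 : Integrable (fun x => (∑ i, X i x * pd i u x) * lapl u x
        - ∑ i, ∑ j, pd i (pd j u) x * (pd i u x * X j x)) := by
    refine Integrable.sub ?_ ?_
    · exact Continuous.integrable_of_hasCompactSupport (by fun_prop) hsum.mul_right
    · exact integrable_finsetSum _ fun i _ => integrable_finsetSum _ fun j _ =>
        Continuous.integrable_of_hasCompactSupport (by fun_prop) ((hXc j).mul_left).mul_left
  rw [← sub_eq_zero, ← integral_sub hI1 hI2, ← hzs]
  congr 1; funext x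
  have dX := fun i => ((hX i).differentiable (by norm_num)) x
  have dp := fun i => ((contDiff_one_pd i hu).differentiable (by norm_num)) x
  have dg : DifferentiableAt ℝ (gsq u) x := ((contDiff_gsq hu).differentiable (by norm_num)) x
  have ds : DifferentiableAt ℝ (fun x => ∑ i, X i x * pd i u x) x :=
    (hs.differentiable (by norm_num)) x
  have hpg : ∀ j, pd j (gsq u) x = ∑ i, 2 * pd i u x * pd i (pd j u) x := by
    intro j
    unfold gsq
    rw [pd_sum _ j fun i _ => (dp i).fun_pow 2]
    refine Finset.sum_congr rfl fun i _ => ?_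
    rw [pd_sq j (dp i), pd_symm hu.contDiffAt]
  have hps : ∀ j, pd j (fun x => ∑ i, X i x * pd i u x) x
      = ∑ i, (pd j (X i) x * pd i u x + X i x * pd i (pd j u) x) := by
    intro j
    rw [pd_sum _ j fun i _ => (dX i).fun_mul (dp i)]
    refine Finset.sum_congr rfl fun i _ => ?_
    rw [pd_mul j (dX i) (dp i), pd_symm hu.contDiffAt]
  have hpW : ∀ j, pd j (W j) x = gsq u x * pd j (X j) x
      + (∑ i, pd i (pd j u) x * (pd i u x * X j x)) * 2
      - (∑ i, pd j (X i) x * (pd i u x * pd j u x))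
      - (∑ i, pd i (pd j u) x * (pd j u x * X i x))
      - (∑ i, X i x * pd i u x) * pd j (pd j u) x := by
    intro j
    rw [hW]
    simp only
    rw [pd_sub j ((dX j).fun_mul dg) (ds.fun_mul (dp j)), pd_mul j (dX j) dg, pd_mul j ds (dp j), hpg,
      hps]
    simp only [Finset.sum_add_distrib, add_mul, Finset.mul_sum, Finset.sum_mul]
    have e1 : ∑ i, X j x * (2 * pd i u x * pd i (pd j u) x)
      = ∑ i, pd i (pd j u) x * (pd i u x * X j x) * 2 :=
      Finset.sum_congr rfl fun i _ => by ring
    have e2 : ∑ i, pd j (X i) x * pd i u x * pd j u x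
      = ∑ i, pd j (X i) x * (pd i u x * pd j u x) :=
      Finset.sum_congr rfl fun i _ => by ring
    have e3 : ∑ i, X i x * pd i (pd j u) x * pd j u x
      = ∑ i, pd i (pd j u) x * (pd j u x * X i x) :=
      Finset.sum_congr rfl fun i _ => by ring
    rw [e1, e2, e3]; ring
  simp only [hpW, Finset.sum_sub_distrib, Finset.sum_add_distrib, ← Finset.mul_sum,
    ← Finset.sum_mul]
  rw [← lapl_eq]
  have s1 : ∑ j, ∑ i, pd i (pd j u) x * (pd i u x * X j x)
      = ∑ i, ∑ j, pd i (pd j u) x * (pd i u x * X j x) := Finset.sum_comm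
  have s2 : ∑ j, ∑ i, pd j (X i) x * (pd i u x * pd j u x)
      = ∑ i, ∑ j, pd j (X i) x * (pd i u x * pd j u x) := Finset.sum_comm
  have s3 : ∑ j, ∑ i, pd i (pd j u) x * (pd j u x * X i x)
      = ∑ i, ∑ j, pd i (pd j u) x * (pd i u x * X j x) :=
    Finset.sum_congr rfl fun j _ => Finset.sum_congr rfl fun i _ => by
      rw [pd_symm hu.contDiffAt]
  rw [s1, s2, s3]; ring

end

section

variable {n : ℕ} {u : Eu n → ℝ} {Ω : Set (Eu n)} {f : ℝ → ℝ}

lemma hasCompactSupport_finset_sum {α ι : Type*} [TopologicalSpace α] (s : Finset ι)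
    {g : ι → α → ℝ} (hg : ∀ i ∈ s, HasCompactSupport (g i)) :
    HasCompactSupport (fun x => ∑ i ∈ s, g i x) := by
  have : (fun x => ∑ i ∈ s, g i x) = ∑ i ∈ s, g i := by
    funext x; simp
  rw [this]
  exact Finset.sum_induction _ (fun g : α → ℝ => HasCompactSupport g)
      (fun a b ha hb => ha.add hb) HasCompactSupport.zero hg

/-- The linearised equation satisfied weakly by the gradient of a solution, tested against
`η² ∇u`. -/
lemma integral_linearized (hu : ContDiff ℝ 2 u) (huc : HasCompactSupport u)
    (hf : ContDiff ℝ 1 f) (hsol : ∀ x ∈ Ω, lapl u x + f (u x) = 0)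
    {η : Eu n → ℝ} (hη : ContDiff ℝ 1 η) (hηc : HasCompactSupport η) (hηΩ : tsupport η ⊆ Ω) :
    ∫ x, ((∑ i, ∑ j, pd j (pd i u) x * pd j (fun y => pd i u y * η y ^ 2) x)
      - deriv f (u x) * gsq u x * η x ^ 2) = 0 := by
  have hu1 : ContDiff ℝ 1 u := hu.of_le (by norm_num)
  have du : Differentiable ℝ u := hu1.differentiable (by norm_num)
  have hp := fun i => contDiff_one_pd i hu
  have hpc := fun i => hasCompactSupport_pd i huc
  have hη2c : HasCompactSupport (fun y => η y ^ 2) := by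
    simp only [pow_two]; exact hηc.mul_right
  set φ : Fin n → Eu n → ℝ := fun i y => pd i u y * η y ^ 2 with hφ
  have hφ1 : ∀ i, ContDiff ℝ 1 (φ i) := fun i => (hp i).mul (hη.pow 2)
  have hφc : ∀ i, HasCompactSupport (φ i) := fun i => hη2c.mul_left
  have cφ' := fun i j => continuous_pd i (hφ1 j)
  have hφ'c := fun i j => hasCompactSupport_pd i (hφc j)
  have cφ := fun i => (hφ1 i).continuous
  have c2 := continuous_pd_pd hu
  have cl := continuous_lapl hu
  have cu := hu.continuous
  have cp := fun i => (hp i).continuous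
  have cg := continuous_gsq hu1
  have cf' : Continuous (deriv f) := hf.continuous_deriv (by norm_num)
  have cf : Continuous f := hf.continuous
  have cη := hη.continuous
  have hφΩ : ∀ i x, x ∉ Ω → φ i x = 0 := fun i x hx => by
    have : η x = 0 := image_eq_zero_of_notMem_tsupport fun h => hx (hηΩ h)
    simp [hφ, this]
  have hφ'Ω : ∀ i j x, x ∉ Ω → pd i (φ j) x = 0 := fun i j x hx => by
    have h0 : η =ᶠ[nhds x] fun _ => 0 :=
      notMem_tsupport_iff_eventuallyEq.1 fun h => hx (hηΩ h)
    have : φ j =ᶠ[nhds x] fun _ => 0 := by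
      filter_upwards [h0] with y hy
      simp [hφ, hy]
    rw [pd_congr i this, pd_const]
  have K1 : ∀ i j, Integrable (fun x => pd j (pd i u) x * pd j (φ i) x) := fun i j =>
    Continuous.integrable_of_hasCompactSupport (by fun_prop) (hφ'c j i).mul_left
  have K2 : ∀ i, Integrable (fun x => lapl u x * pd i (φ i) x) := fun i =>
    Continuous.integrable_of_hasCompactSupport (by fun_prop) (hφ'c i i).mul_left
  have K3 : ∀ i j, Integrable (fun x => pd j (pd j u) x * pd i (φ i) x) := fun i j =>
    Continuous.integrable_of_hasCompactSupport (by fun_prop) (hφ'c i i).mul_left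
  have K4 : ∀ i, Integrable
      (fun x => deriv f (u x) * pd i u x * φ i x + f (u x) * pd i (φ i) x) := fun i =>
    Integrable.add
      (Continuous.integrable_of_hasCompactSupport (by fun_prop) (hφc i).mul_left)
      (Continuous.integrable_of_hasCompactSupport (by fun_prop) (hφ'c i i).mul_left)
  have hA : ∫ x, ∑ i, ∑ j, pd j (pd i u) x * pd j (φ i) x
      = ∫ x, ∑ i, lapl u x * pd i (φ i) x := by
    rw [integral_finsetSum _ fun i _ => integrable_finsetSum _ fun j _ => K1 i j,
      integral_finsetSum _ fun i _ => K2 i]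
    refine Finset.sum_congr rfl fun i _ => ?_
    simp only [lapl_eq, Finset.sum_mul]
    rw [integral_finsetSum _ fun j _ => K1 i j, integral_finsetSum _ fun j _ => K3 i j]
    refine Finset.sum_congr rfl fun j _ => ?_
    have : ∀ x, pd j (pd i u) x = pd i (pd j u) x := fun x => pd_symm hu.contDiffAt j i
    simp only [this]
    exact integral_pd_mul_pd_comm i j (hp j) (hpc j) (hφ1 i) (hφc i)
  have hB : ∫ x, ∑ i, lapl u x * pd i (φ i) x
      = ∫ x, deriv f (u x) * gsq u x * η x ^ 2 := by
    have hB0 : ∀ i, ∫ x, (deriv f (u x) * pd i u x * φ i x + f (u x) * pd i (φ i) x) = 0 := by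
      intro i
      have hfu : ContDiff ℝ 1 (fun x => f (u x)) := hf.comp hu1
      have := integral_pd_eq_zero i (hfu.mul (hφ1 i)) (hφc i).mul_left
      rw [← this]
      congr 1; funext x
      rw [pd_mul i (hfu.differentiable (by norm_num) x) ((hφ1 i).differentiable (by norm_num) x)]
      rw [pd_comp i ((hf.differentiable (by norm_num)) (u x)).hasDerivAt (du x)]
    have hBs : ∫ x, ∑ i, (deriv f (u x) * pd i u x * φ i x + f (u x) * pd i (φ i) x) = 0 := by
      rw [integral_finsetSum _ fun i _ => K4 i]
      simp [hB0]
    have hi1 : Integrable (fun x => ∑ i, lapl u x * pd i (φ i) x) :=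
      integrable_finsetSum _ fun i _ => K2 i
    have hi2 : Integrable (fun x => deriv f (u x) * gsq u x * η x ^ 2) :=
      Continuous.integrable_of_hasCompactSupport (by fun_prop) hη2c.mul_left
    rw [← sub_eq_zero, ← integral_sub hi1 hi2, ← neg_eq_zero, ← integral_neg, ← hBs]
    congr 1; funext x
    simp only [Finset.sum_add_distrib]
    have e1 : ∑ i, deriv f (u x) * pd i u x * φ i x = deriv f (u x) * gsq u x * η x ^ 2 := by
      simp only [hφ, gsq, Finset.mul_sum, Finset.sum_mul]
      exact Finset.sum_congr rfl fun i _ => by ring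
    have e2 : ∑ i, f (u x) * pd i (φ i) x = - ∑ i, lapl u x * pd i (φ i) x := by
      rw [← Finset.sum_neg_distrib]
      refine Finset.sum_congr rfl fun i _ => ?_
      by_cases hx : x ∈ Ω
      · have := hsol x hx
        rw [show f (u x) = - lapl u x by linarith]; ring
      · rw [hφ'Ω i i x hx]; ring
    rw [e1, e2]; ring
  rw [integral_sub, hA, hB, sub_self]
  · exact integrable_finsetSum _ fun i _ => integrable_finsetSum _ fun j _ => K1 i j
  · exact Continuous.integrable_of_hasCompactSupport (by fun_prop) hη2c.mul_left

/-- The Sternberg–Zumbrun inequality, in regularised form. -/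
lemma integral_hessDefect_le (hΩ : IsOpen Ω) (hu : ContDiff ℝ 2 u) (huc : HasCompactSupport u)
    (hf : ContDiff ℝ 1 f) (hsol : ∀ x ∈ Ω, lapl u x + f (u x) = 0) (hst : IsSemiStable Ω f u)
    {η : Eu n → ℝ} (hη : ContDiff ℝ 1 η) (hηc : HasCompactSupport η) (hηΩ : tsupport η ⊆ Ω)
    {ε : ℝ} (hε : 0 < ε) :
    ∫ x, hessDefect ε u x * η x ^ 2 ≤
      (∫ x, (gsq u x + ε) * gsq η x) - ε * ∫ x, deriv f (u x) * η x ^ 2 := by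
  have hu1 : ContDiff ℝ 1 u := hu.of_le (by norm_num)
  have hη2c : HasCompactSupport (fun y => η y ^ 2) := by
    simp only [pow_two]; exact hηc.mul_right
  have hηc' := fun i => hasCompactSupport_pd i hηc
  have hgc : HasCompactSupport (gsq η) :=
    hasCompactSupport_finset_sum _ fun i _ => by
      simp only [pow_two]; exact (hηc' i).mul_right
  have hpos : ∀ x, 0 < gsq u x + ε := fun x => by have := gsq_nonneg u x; linarith
  have cg := continuous_gsq hu1
  have cgη := continuous_gsq hη
  have cu := hu.continuous
  have cη := hη.continuous
  have cη' := fun i => continuous_pd i hη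
  have c2 := continuous_pd_pd hu
  have c1 := fun i => continuous_pd i hu1
  have cf' : Continuous (deriv f) := hf.continuous_deriv (by norm_num)
  have cH := continuous_hessDefect hu hε
  set c : Eu n → ℝ := fun x => Real.sqrt (gsq u x + ε) with hc
  have hcsq : ∀ x, c x ^ 2 = gsq u x + ε := fun x => Real.sq_sqrt (hpos x).le
  have hcpos : ∀ x, 0 < c x := fun x => Real.sqrt_pos.2 (hpos x)
  have hc1 : ContDiff ℝ 1 c :=
    ((contDiff_gsq hu).add contDiff_const).sqrt fun x => (hpos x).ne'
  have hξ1 : ContDiff ℝ 1 (fun x => c x * η x) := hc1.mul hη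
  have hξc : HasCompactSupport (fun x => c x * η x) := hηc.mul_left
  have hη0 : ∀ x, x ∉ Ω → η x = 0 := fun x hx =>
    image_eq_zero_of_notMem_tsupport fun h => hx (hηΩ h)
  have hstab := hst (fun x => c x * η x) (hξ1.lipschitzWith_of_hasCompactSupport hξc (by norm_num))
    (fun x hx => by
      rw [hη0 x (fun h => by rw [hΩ.frontier_eq] at hx; exact hx.2 h), mul_zero])
  rw [setIntegral_eq_integral_of_forall_compl_eq_zero] at hstab
  swap
  · intro x hx
    have h0 : (fun x => c x * η x) =ᶠ[nhds x] fun _ => 0 := by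
      filter_upwards [notMem_tsupport_iff_eventuallyEq.1 fun h => hx (hηΩ h)] with y hy
      simp [hy]
    rw [norm_gradient_sq, hη0 x hx]
    simp [gsq, pd_congr _ h0, pd_const]
  have hlin := integral_linearized hu huc hf hsol hη hηc hηΩ
  have dη : Differentiable ℝ η := hη.differentiable (by norm_num)
  have dc : Differentiable ℝ c := hc1.differentiable (by norm_num)
  have dp := fun i => (contDiff_one_pd i hu).differentiable (by norm_num)
  have hpc : ∀ i x, c x * pd i c x = ∑ j, pd i (pd j u) x * pd j u x := by
    intro i x
    have h1 : pd i (fun y => c y ^ 2) x = 2 * c x * pd i c x := pd_sq i (dc x)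
    have h2 : pd i (fun y => c y ^ 2) x = ∑ j, 2 * pd j u x * pd i (pd j u) x := by
      simp only [hcsq]
      rw [pd_add i ((contDiff_gsq hu).differentiable (by norm_num) x) (by fun_prop), pd_const,
        add_zero]
      unfold gsq
      rw [pd_sum _ i fun j _ => (dp j x).fun_pow 2]
      exact Finset.sum_congr rfl fun j _ => pd_sq i (dp j x)
    have h3 : ∑ j, 2 * pd j u x * pd i (pd j u) x = 2 * ∑ j, pd i (pd j u) x * pd j u x := by
      rw [Finset.mul_sum]; exact Finset.sum_congr rfl fun j _ => by ring
    linarith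
  have hpoint : ∀ x, ‖gradient (fun x => c x * η x) x‖ ^ 2 - deriv f (u x) * (c x * η x) ^ 2
      = ((∑ i, ∑ j, pd j (pd i u) x * pd j (fun y => pd i u y * η y ^ 2) x)
          - deriv f (u x) * gsq u x * η x ^ 2)
        + (- (hessDefect ε u x * η x ^ 2) + (gsq u x + ε) * gsq η x
          - ε * (deriv f (u x) * η x ^ 2)) := by
    intro x
    have hg : gsq (fun x => c x * η x) x
        = η x ^ 2 * (∑ i, pd i c x ^ 2) + 2 * η x * (∑ i, (c x * pd i c x) * pd i η x)
          + c x ^ 2 * gsq η x := by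
      simp only [gsq, Finset.mul_sum, ← Finset.sum_add_distrib]
      refine Finset.sum_congr rfl fun i _ => ?_
      rw [pd_mul i (dc x) (dη x)]; ring
    have hci : ∀ i, pd i c x ^ 2
        = (∑ j, pd i (pd j u) x * pd j u x) ^ 2 / (∑ j, pd j u x ^ 2 + ε) := by
      intro i
      change _ = _ / (gsq u x + ε)
      rw [eq_div_iff (hpos x).ne', ← hpc, mul_pow]
      rw [← hcsq]; ring
    have hφ : ∑ i, ∑ j, pd j (pd i u) x * pd j (fun y => pd i u y * η y ^ 2) x
        = η x ^ 2 * (∑ i, ∑ j, pd i (pd j u) x ^ 2)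
          + 2 * η x * (∑ i, (c x * pd i c x) * pd i η x) := by
      simp only [hpc]
      rw [Finset.sum_comm]
      simp only [Finset.mul_sum, Finset.sum_mul, ← Finset.sum_add_distrib]
      refine Finset.sum_congr rfl fun i _ => Finset.sum_congr rfl fun j _ => ?_
      rw [pd_mul i (dp j x) ((dη x).fun_pow 2), pd_sq i (dη x)]; ring
    rw [norm_gradient_sq, hg, hφ, mul_pow, hcsq, hessDefect]
    simp only [hci]
    ring
  simp only [hpoint] at hstab
  have hdp : ∀ i, ContDiff ℝ 1 (fun y => pd i u y * η y ^ 2) := fun i =>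
    (contDiff_one_pd i hu).mul (hη.pow 2)
  have cdp := fun i j => continuous_pd j (hdp i)
  have J0 : Integrable (fun x => (∑ i, ∑ j, pd j (pd i u) x *
      pd j (fun y => pd i u y * η y ^ 2) x) - deriv f (u x) * gsq u x * η x ^ 2) := by
    refine Integrable.sub ?_ ?_
    · exact integrable_finsetSum _ fun i _ => integrable_finsetSum _ fun j _ =>
        Continuous.integrable_of_hasCompactSupport (by fun_prop)
          (hasCompactSupport_pd j (hη2c.mul_left)).mul_left
    · exact Continuous.integrable_of_hasCompactSupport (by fun_prop) hη2c.mul_left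
  have J1 : Integrable (fun x => hessDefect ε u x * η x ^ 2) :=
    Continuous.integrable_of_hasCompactSupport (by fun_prop) hη2c.mul_left
  have J2 : Integrable (fun x => (gsq u x + ε) * gsq η x) :=
    Continuous.integrable_of_hasCompactSupport (by fun_prop) hgc.mul_left
  have J3 : Integrable (fun x => deriv f (u x) * η x ^ 2) :=
    Continuous.integrable_of_hasCompactSupport (by fun_prop) hη2c.mul_left
  have J1' : Integrable (fun x => -(hessDefect ε u x * η x ^ 2)) := J1.neg
  have J12 : Integrable (fun x => - (hessDefect ε u x * η x ^ 2) + (gsq u x + ε) * gsq η x) :=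
    J1'.add J2
  have J123 : Integrable (fun x => - (hessDefect ε u x * η x ^ 2) + (gsq u x + ε) * gsq η x
      - ε * (deriv f (u x) * η x ^ 2)) := J12.sub (J3.const_mul ε)
  rw [integral_add J0 J123, hlin, zero_add, integral_sub J12 (J3.const_mul ε),
    integral_add J1' J2, integral_neg, integral_const_mul] at hstab
  linarith

end

section

variable {n : ℕ} {u : Eu n → ℝ} {Ω : Set (Eu n)} {f : ℝ → ℝ}

/-- The divergence theorem for compactly supported fields. -/
lemma integral_divergence_eq_zero {X : Fin n → Eu n → ℝ} (hX : ∀ i, ContDiff ℝ 1 (X i))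
    (hXc : ∀ i, HasCompactSupport (X i)) : ∫ x, ∑ i, pd i (X i) x = 0 := by
  rw [integral_finsetSum _ fun i _ => (continuous_pd i (hX i)).integrable_of_hasCompactSupport
    (hasCompactSupport_pd i (hXc i))]
  simp [fun i => integral_pd_eq_zero i (hX i) (hXc i)]

lemma hasCompactSupport_gsq (hu : HasCompactSupport u) : HasCompactSupport (gsq u) :=
  hasCompactSupport_finset_sum _ fun i _ => by
    simp only [pow_two]; exact (hasCompactSupport_pd i hu).mul_right

lemma hasCompactSupport_sq (hu : HasCompactSupport u) : HasCompactSupport (fun x => u x ^ 2) := by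
  simp only [pow_two]; exact hu.mul_right

/-- The Caccioppoli inequality. -/
lemma integral_sq_mul_gsq_le (hu : ContDiff ℝ 2 u)
    (hsol : ∀ x ∈ Ω, lapl u x + f (u x) = 0) {χ : Eu n → ℝ} (hχ : ContDiff ℝ 1 χ)
    (hχc : HasCompactSupport χ) (hχΩ : tsupport χ ⊆ Ω) {M F : ℝ}
    (hM : ∀ x ∈ tsupport χ, |u x| ≤ M) (hF : ∀ x ∈ tsupport χ, |f (u x)| ≤ F) :
    ∫ x, χ x ^ 2 * gsq u x ≤ 2 * M * F * (∫ x, χ x ^ 2) + 4 * M ^ 2 * ∫ x, gsq χ x := by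
  have hu1 : ContDiff ℝ 1 u := hu.of_le (by norm_num)
  have hX : ∀ i, ContDiff ℝ 1 (fun x => pd i u x * (u x * χ x ^ 2)) := fun i =>
    (contDiff_one_pd i hu).mul (hu1.mul (hχ.pow 2))
  have hXc : ∀ i, HasCompactSupport (fun x => pd i u x * (u x * χ x ^ 2)) := fun i =>
    ((hasCompactSupport_sq hχc).mul_left).mul_left
  have h0 := integral_divergence_eq_zero hX hXc
  have cu := hu.continuous
  have cχ := hχ.continuous
  have cg := continuous_gsq hu1
  have cgχ := continuous_gsq hχ
  have I1 : Integrable (fun x => χ x ^ 2 * gsq u x) :=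
    Continuous.integrable_of_hasCompactSupport (by fun_prop) (hasCompactSupport_sq hχc).mul_right
  have I2 : Integrable (fun x => χ x ^ 2) :=
    Continuous.integrable_of_hasCompactSupport (by fun_prop) (hasCompactSupport_sq hχc)
  have I3 : Integrable (fun x => gsq χ x) :=
    Continuous.integrable_of_hasCompactSupport (by fun_prop) (hasCompactSupport_gsq hχc)
  have I4 : Integrable (fun x => ∑ i, pd i (fun x => pd i u x * (u x * χ x ^ 2)) x) :=
    integrable_finsetSum _ fun i _ => (continuous_pd i (hX i)).integrable_of_hasCompactSupport
      (hasCompactSupport_pd i (hXc i))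
  have key : ∀ x, 1 / 2 * (χ x ^ 2 * gsq u x) ≤
      ∑ i, pd i (fun x => pd i u x * (u x * χ x ^ 2)) x + (M * F * χ x ^ 2
        + 2 * M ^ 2 * gsq χ x) := by
    intro x
    have du := hu1.differentiable (by norm_num) x
    have dχ := hχ.differentiable (by norm_num) x
    have e : ∑ i, pd i (fun x => pd i u x * (u x * χ x ^ 2)) x
        = lapl u x * (u x * χ x ^ 2) + χ x ^ 2 * gsq u x
          + ∑ i, 2 * u x * (χ x * pd i u x) * pd i χ x := by
      rw [lapl_eq, gsq, Finset.sum_mul, Finset.mul_sum, ← Finset.sum_add_distrib,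
        ← Finset.sum_add_distrib]
      refine Finset.sum_congr rfl fun i _ => ?_
      rw [pd_mul i ((contDiff_one_pd i hu).differentiable (by norm_num) x)
        (du.fun_mul (dχ.fun_pow 2)), pd_mul i du (dχ.fun_pow 2), pd_sq i dχ]
      ring
    by_cases hx : x ∈ tsupport χ
    · have hs : lapl u x * (u x * χ x ^ 2) ≥ - (M * F * χ x ^ 2) := by
        have h1 := hsol x (hχΩ hx)
        have h2 := hM x hx
        have h3 := hF x hx
        have h4 : |f (u x) * u x| ≤ F * M := by
          rw [abs_mul]; exact mul_le_mul h3 h2 (abs_nonneg _) ((abs_nonneg _).trans h3)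
        have h5 := (abs_le.1 h4).2
        rw [show lapl u x = - f (u x) by linarith]
        nlinarith [sq_nonneg (χ x)]
      have hc : ∑ i, 2 * u x * (χ x * pd i u x) * pd i χ x ≥
          -(1 / 2 * (χ x ^ 2 * gsq u x) + 2 * M ^ 2 * gsq χ x) := by
        have hu2 : u x ^ 2 ≤ M ^ 2 := by
          rw [← sq_abs]; exact pow_le_pow_left₀ (abs_nonneg _) (hM x hx) 2
        rw [gsq, gsq, Finset.mul_sum, Finset.mul_sum, Finset.mul_sum, ← Finset.sum_add_distrib,
          ← Finset.sum_neg_distrib]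
        refine Finset.sum_le_sum fun i _ => ?_
        have := mul_le_mul_of_nonneg_right hu2 (sq_nonneg (pd i χ x))
        nlinarith [sq_nonneg (χ x * pd i u x + 2 * u x * pd i χ x)]
      rw [e]; linarith
    · have h1 : χ x = 0 := image_eq_zero_of_notMem_tsupport hx
      rw [e, h1]
      have : gsq χ x = 0 := by
        simp [gsq, pd_eq_zero_of_notMem_tsupport _ hx]
      simp [this]
  have I5 : Integrable (fun x => M * F * χ x ^ 2 + 2 * M ^ 2 * gsq χ x) :=
    (I2.const_mul (M * F)).add (I3.const_mul (2 * M ^ 2))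
  have := integral_mono (I1.const_mul (1 / 2)) (I4.add I5) key
  simp only [Pi.add_apply] at this
  rw [integral_const_mul, integral_add I4 I5, h0, zero_add,
    integral_add (I2.const_mul (M * F)) (I3.const_mul (2 * M ^ 2)),
    integral_const_mul, integral_const_mul] at this
  linarith

/-- Regularised squared distance to `y`. -/
def qreg (e : ℝ) (y x : Eu n) : ℝ := ∑ i, (x i - y i) ^ 2 + e ^ 2

variable {e : ℝ} {y : Eu n}

lemma sum_sq_eq_norm_sub_sq (y x : Eu n) : ∑ i, (x i - y i) ^ 2 = ‖x - y‖ ^ 2 := by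
  rw [EuclideanSpace.norm_sq_eq]
  simp

lemma qreg_pos (he : 0 < e) (x : Eu n) : 0 < qreg e y x := by
  have : 0 ≤ ∑ i, (x i - y i) ^ 2 := Finset.sum_nonneg fun _ _ => sq_nonneg _
  unfold qreg; positivity

lemma contDiff_qreg : ContDiff ℝ 2 (qreg e y) := by
  unfold qreg; fun_prop

lemma pd_sub_coord (i j : Fin n) (x : Eu n) :
    pd i (fun x : Eu n => x j - y j) x = if i = j then 1 else 0 := by
  rw [pd_sub i (by fun_prop) (by fun_prop), pd_coord, pd_const, sub_zero]

lemma pd_qreg (i : Fin n) (x : Eu n) : pd i (qreg e y) x = 2 * (x i - y i) := by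
  unfold qreg
  rw [pd_add i (by fun_prop) (by fun_prop), pd_const, add_zero, pd_sum _ i (by fun_prop)]
  rw [Finset.sum_eq_single i]
  · rw [pd_sq i (by fun_prop), pd_sub_coord]; simp
  · intro j _ hj
    rw [pd_sq i (by fun_prop), pd_sub_coord]; simp [Ne.symm hj]
  · simp

lemma contDiff_qreg_rpow (he : 0 < e) (a : ℝ) : ContDiff ℝ 2 (fun x => qreg e y x ^ a) :=
  contDiff_qreg.rpow_const_of_ne fun x => (qreg_pos he x).ne'

lemma pd_qreg_rpow (he : 0 < e) (a : ℝ) (i : Fin n) (x : Eu n) :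
    pd i (fun x => qreg e y x ^ a) x = 2 * a * (x i - y i) * qreg e y x ^ (a - 1) := by
  rw [pd_comp i (g := fun t => t ^ a) (Real.hasDerivAt_rpow_const (Or.inl (qreg_pos he x).ne'))
    (contDiff_qreg.differentiable (by norm_num) x), pd_qreg]
  ring

lemma hessDefect_nonneg {ε : ℝ} (hε : 0 < ε) (x : Eu n) : 0 ≤ hessDefect ε u x := by
  unfold hessDefect
  rw [← Finset.sum_sub_distrib]
  refine Finset.sum_nonneg fun i _ => sub_nonneg.2 ?_
  have hp : 0 ≤ ∑ j, pd j u x ^ 2 := Finset.sum_nonneg fun _ _ => sq_nonneg _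
  have hA : 0 ≤ ∑ j, pd i (pd j u) x ^ 2 := Finset.sum_nonneg fun _ _ => sq_nonneg _
  rw [div_le_iff₀ (by linarith)]
  have := Finset.sum_mul_sq_le_sq_mul_sq Finset.univ (fun j => pd i (pd j u) x) (fun j => pd j u x)
  nlinarith [mul_nonneg hA hε.le]

end

section

variable {n : ℕ} {u : Eu n → ℝ} {Ω : Set (Eu n)} {f : ℝ → ℝ} {e : ℝ} {y : Eu n}

set_option maxHeartbeats 1000000 in
/-- A Hardy-type inequality: the weighted Dirichlet integral is controlled by the weighted
Hessian defect and by the Dirichlet integral in the region where the cut-off varies. -/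
lemma hardy_inequality (hn : 2 ≤ n) (hu : ContDiff ℝ 2 u) {ζ χ : Eu n → ℝ}
    (hζ : ContDiff ℝ 1 ζ) (hζc : HasCompactSupport ζ) (hζ0 : ∀ x, 0 ≤ ζ x) (hζ1 : ∀ x, ζ x ≤ 1)
    (hχ : Continuous χ) (hχc : HasCompactSupport χ) {β E ε : ℝ} (hβ : 0 ≤ β) (he : 0 < e)
    (hE0 : 0 ≤ E)
    (hE : ∀ x, (qreg e y x ^ (-β)) ^ 2 * (∑ i, (x i - y i) ^ 2) * gsq ζ x ≤ (E * χ x ^ 2) ^ 2)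
    (hε : 0 < ε) :
    (n - 1 - 2 * β - 1 / 5) * ∫ x, qreg e y x ^ (-β) * gsq u x * ζ x ^ 2 ≤
      5 / 4 * (n - 1) * (∫ x, qreg e y x ^ (1 - β) * hessDefect ε u x * ζ x ^ 2)
        + 4 * E * ∫ x, χ x ^ 2 * gsq u x := by
  have hu1 : ContDiff ℝ 1 u := hu.of_le (by norm_num)
  have hn' : (2 : ℝ) ≤ n := by exact_mod_cast hn
  have hw := fun a : ℝ => (contDiff_qreg_rpow (y := y) he a).of_le (m := 1) (by norm_num)
  have cw := fun a => (hw a).continuous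
  have hζ2 : ContDiff ℝ 1 (fun x => ζ x ^ 2) := hζ.pow 2
  have hζ2c := hasCompactSupport_sq hζc
  set X : Fin n → Eu n → ℝ := fun i x => (x i - y i) * (qreg e y x ^ (-β) * ζ x ^ 2) with hXdef
  have hX : ∀ i, ContDiff ℝ 1 (X i) := fun i =>
    (show ContDiff ℝ 1 (fun x : Eu n => x i - y i) by fun_prop).mul ((hw _).mul hζ2)
  have hXc : ∀ i, HasCompactSupport (X i) := fun i => (hζ2c.mul_left).mul_left
  have hP := integral_pohozaev hu X hX hXc
  have cX := fun i => (hX i).continuous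
  have cX' := fun i j => continuous_pd i (hX j)
  have c1 : ∀ j, Continuous (pd j u) := fun j => continuous_pd j hu1
  have c2 := continuous_pd_pd hu
  have cg := continuous_gsq hu1
  have cl := continuous_lapl hu
  have cζ := hζ.continuous
  have cH := continuous_hessDefect hu hε
  have hX'c := fun i j => hasCompactSupport_pd i (hXc j)
  have IL : Integrable (fun x => gsq u x * ∑ j, pd j (X j) x
      - ∑ i, ∑ j, pd j (X i) x * (pd i u x * pd j u x)) := by
    refine Continuous.integrable_of_hasCompactSupport (by fun_prop) (HasCompactSupport.sub ?_ ?_)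
    · exact (hasCompactSupport_finset_sum _ fun i _ => hX'c i i).mul_left
    · exact hasCompactSupport_finset_sum _ fun i _ => hasCompactSupport_finset_sum _ fun j _ =>
        (hX'c j i).mul_right
  have IR : Integrable (fun x => (∑ i, X i x * pd i u x) * lapl u x
        - ∑ i, ∑ j, pd i (pd j u) x * (pd i u x * X j x)) := by
    refine Continuous.integrable_of_hasCompactSupport (by fun_prop) (HasCompactSupport.sub ?_ ?_)
    · exact (hasCompactSupport_finset_sum _ fun i _ => (hXc i).mul_right).mul_right
    · exact hasCompactSupport_finset_sum _ fun i _ => hasCompactSupport_finset_sum _ fun j _ =>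
        ((hXc j).mul_left).mul_left
  have IA : Integrable (fun x => qreg e y x ^ (-β) * gsq u x * ζ x ^ 2) :=
    Continuous.integrable_of_hasCompactSupport (by fun_prop) hζ2c.mul_left
  have IB : Integrable (fun x => qreg e y x ^ (1 - β) * hessDefect ε u x * ζ x ^ 2) :=
    Continuous.integrable_of_hasCompactSupport (by fun_prop) hζ2c.mul_left
  have IG : Integrable (fun x => χ x ^ 2 * gsq u x) :=
    Continuous.integrable_of_hasCompactSupport (by fun_prop) (hasCompactSupport_sq hχc).mul_right
  have key : ∀ x, (n - 1 - 2 * β - 1 / 5) * (qreg e y x ^ (-β) * gsq u x * ζ x ^ 2) ≤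
      5 / 4 * (n - 1) * (qreg e y x ^ (1 - β) * hessDefect ε u x * ζ x ^ 2)
        + 4 * E * (χ x ^ 2 * gsq u x)
      + ((gsq u x * ∑ j, pd j (X j) x - ∑ i, ∑ j, pd j (X i) x * (pd i u x * pd j u x))
        - ((∑ i, X i x * pd i u x) * lapl u x
        - ∑ i, ∑ j, pd i (pd j u) x * (pd i u x * X j x))) := by
    intro x
    have hQ := qreg_pos (y := y) he x
    have dζ := hζ.differentiable (by norm_num) x
    have dw := fun a => (hw a).differentiable (by norm_num) x
    set Q := qreg e y x with hQd
    set w := Q ^ (-β) with hwd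
    set w' := Q ^ (-β - 1) with hwd'
    have hww : w = Q * w' := by
      rw [hwd, hwd', Real.rpow_sub hQ, Real.rpow_one]; field_simp
    have hw0 : 0 < w := Real.rpow_pos_of_pos hQ _
    have hw'0 : 0 < w' := Real.rpow_pos_of_pos hQ _
    set S := ∑ i, (x i - y i) ^ 2 with hS
    have hS0 : 0 ≤ S := Finset.sum_nonneg fun _ _ => sq_nonneg _
    have hSQ : S ≤ Q := by rw [hQd, qreg]; nlinarith [sq_nonneg e]
    set a := ∑ i, (x i - y i) * pd i u x with ha
    set b := ∑ i, pd i ζ x * pd i u x with hb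
    set c := ∑ i, (x i - y i) * pd i ζ x with hc
    set N := gsq u x with hN
    have hN0 : 0 ≤ N := gsq_nonneg u x
    set D := hessDefect ε u x with hD
    have hD0 : 0 ≤ D := hessDefect_nonneg hε x
    have hac : a ^ 2 ≤ S * N := Finset.sum_mul_sq_le_sq_mul_sq _ _ _
    have hbc : b ^ 2 ≤ gsq ζ x * N := Finset.sum_mul_sq_le_sq_mul_sq _ _ _
    have hcc : c ^ 2 ≤ S * gsq ζ x := Finset.sum_mul_sq_le_sq_mul_sq _ _ _
    have hdX : ∀ i j, pd j (X i) x = (if j = i then 1 else 0) * (w * ζ x ^ 2)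
        + (x i - y i) * (-2 * β * (x j - y j) * w' * ζ x ^ 2 + w * (2 * ζ x * pd j ζ x)) := by
      intro i j
      rw [hXdef]
      simp only
      rw [pd_mul j (by fun_prop) ((dw _).fun_mul (dζ.fun_pow 2)), pd_sub_coord,
        pd_mul j (dw _) (dζ.fun_pow 2), pd_sq j dζ, pd_qreg_rpow he]
      ring
    have hdiv : ∑ j, pd j (X j) x = n * (w * ζ x ^ 2) - 2 * β * S * w' * ζ x ^ 2
        + 2 * w * ζ x * c := by
      simp only [hdX, if_true, one_mul, Finset.sum_add_distrib, Finset.sum_const, Finset.card_univ,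
        Fintype.card_fin, nsmul_eq_mul, hS, hc, Finset.mul_sum, Finset.sum_mul]
      rw [sub_add, ← Finset.sum_sub_distrib, sub_eq_add_neg, ← Finset.sum_neg_distrib]
      congr 1
      exact Finset.sum_congr rfl fun j _ => by ring
    have hquad : ∑ i, ∑ j, pd j (X i) x * (pd i u x * pd j u x)
        = w * ζ x ^ 2 * N - 2 * β * w' * ζ x ^ 2 * a ^ 2 + 2 * w * ζ x * (a * b) := by
      have e1 : ∑ i, ∑ j, (if j = i then (1 : ℝ) else 0) * (w * ζ x ^ 2) * (pd i u x * pd j u x)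
          = w * ζ x ^ 2 * N := by
        simp only [ite_mul, one_mul, zero_mul, Finset.sum_ite_eq', Finset.mem_univ, if_true, hN,
          gsq, Finset.mul_sum]
        exact Finset.sum_congr rfl fun j _ => by ring
      have e2 : a ^ 2 = ∑ i, ∑ j, ((x i - y i) * pd i u x) * ((x j - y j) * pd j u x) := by
        rw [pow_two, ha, Finset.sum_mul_sum]
      have e3 : a * b = ∑ i, ∑ j, ((x i - y i) * pd i u x) * (pd j ζ x * pd j u x) := by
        rw [ha, hb, Finset.sum_mul_sum]
      rw [← e1, e2, e3]
      simp only [hdX, Finset.mul_sum, ← Finset.sum_add_distrib, ← Finset.sum_sub_distrib]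
      exact Finset.sum_congr rfl fun i _ => Finset.sum_congr rfl fun j _ => by ring
    have hR : ((∑ i, X i x * pd i u x) * lapl u x
        - ∑ i, ∑ j, pd i (pd j u) x * (pd i u x * X j x)) ^ 2 ≤
        (n - 1) * (S * (w * ζ x ^ 2) ^ 2) * N * D := by
      have := trace_contraction_sq_le hn (fun i j => pd i (pd j u) x) (fun i => pd i u x)
        (fun i => X i x) hε
      have hXS : ∑ i, X i x ^ 2 = S * (w * ζ x ^ 2) ^ 2 := by
        rw [hS, Finset.sum_mul]
        exact Finset.sum_congr rfl fun j _ => by rw [hXdef]; ring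
      rw [hXS] at this
      exact this
    set R := (∑ i, X i x * pd i u x) * lapl u x
        - ∑ i, ∑ j, pd i (pd j u) x * (pd i u x * X j x)
    have hwQ : Q ^ (1 - β) = Q * w := by
      rw [hwd, show 1 - β = 1 + -β by ring, Real.rpow_add hQ, Real.rpow_one]
    have hζx0 := hζ0 x
    have hζx1 := hζ1 x
    have hR2 : R ≤ 1 / 5 * (w * N * ζ x ^ 2) + 5 / 4 * (n - 1) * (Q * w * D * ζ x ^ 2) := by
      set A := w * N * ζ x ^ 2
      set B := (n - 1) * (Q * w * D * ζ x ^ 2)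
      have hA0 : 0 ≤ A := by positivity
      have hB0 : 0 ≤ B := mul_nonneg (by linarith) (by positivity)
      have h1 : R ^ 2 ≤ A * B := by
        refine hR.trans ?_
        have : (n - 1) * (S * (w * ζ x ^ 2) ^ 2) * N * D = S * ((n - 1) * (w * ζ x ^ 2) ^ 2 * N * D) := by
          ring
        rw [this]
        have h2 : A * B = Q * ((n - 1) * (w * ζ x ^ 2) ^ 2 * N * D) := by ring
        rw [h2]
        exact mul_le_mul_of_nonneg_right hSQ
          (mul_nonneg (mul_nonneg (mul_nonneg (by linarith) (sq_nonneg _)) hN0) hD0)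
      have h3 : R ≤ 1 / 5 * A + 5 / 4 * B := by
        refine (le_abs_self _).trans (abs_le_of_sq_le_sq ?_ (by positivity))
        nlinarith [sq_nonneg (1 / 5 * A - 5 / 4 * B)]
      linarith
    have hwc : -(w * c) ≤ E * χ x ^ 2 := by
      refine (neg_le_abs _).trans (abs_le_of_sq_le_sq ?_ (by positivity))
      refine le_trans ?_ (hE x)
      rw [mul_pow, mul_assoc]
      exact mul_le_mul_of_nonneg_left hcc (sq_nonneg _)
    have hwab : w * (a * b) ≤ E * χ x ^ 2 * N := by
      refine (le_abs_self _).trans (abs_le_of_sq_le_sq ?_ (by positivity))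
      have h1 : a ^ 2 * b ^ 2 ≤ S * N * (gsq ζ x * N) :=
        mul_le_mul hac hbc (sq_nonneg _) (by positivity)
      have h2 := mul_le_mul_of_nonneg_right (hE x) (sq_nonneg N)
      calc (w * (a * b)) ^ 2 = w ^ 2 * (a ^ 2 * b ^ 2) := by ring
        _ ≤ w ^ 2 * (S * N * (gsq ζ x * N)) := mul_le_mul_of_nonneg_left h1 (sq_nonneg _)
        _ = w ^ 2 * S * gsq ζ x * N ^ 2 := by ring
        _ ≤ _ := h2
        _ = _ := by ring
    rw [hdiv, hquad, hwQ]
    have h5 : 0 ≤ 2 * β * ζ x ^ 2 * (w * N - S * w' * N + w' * a ^ 2) := by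
      refine mul_nonneg (by positivity) ?_
      have : w' * S * N ≤ w' * Q * N := by gcongr
      rw [hww]; linarith [mul_nonneg hw'0.le (sq_nonneg a)]
    have h6 : 0 ≤ E * χ x ^ 2 * N := by positivity
    have h7 : 0 ≤ ζ x * (E * χ x ^ 2 * N + w * c * N) :=
      mul_nonneg hζx0 (by linarith [mul_le_mul_of_nonneg_right hwc hN0])
    have h8 : 0 ≤ ζ x * (E * χ x ^ 2 * N - w * (a * b)) := mul_nonneg hζx0 (by linarith)
    have h9 : ζ x * (E * χ x ^ 2 * N) ≤ E * χ x ^ 2 * N :=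
      mul_le_of_le_one_left h6 hζx1
    linarith
  have := integral_mono (IA.const_mul (n - 1 - 2 * β - 1 / 5))
    (((IB.const_mul (5 / 4 * (n - 1))).add (IG.const_mul (4 * E))).add (IL.sub IR)) key
  simp only [Pi.add_apply, Pi.sub_apply] at this
  rw [integral_const_mul] at this
  refine this.trans (le_of_eq ?_)
  have IBG : Integrable (fun x => 5 / 4 * (n - 1) * (qreg e y x ^ (1 - β) * hessDefect ε u x * ζ x ^ 2)
        + 4 * E * (χ x ^ 2 * gsq u x)) := (IB.const_mul _).add (IG.const_mul _)
  have ILR : Integrable (fun x =>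
      (gsq u x * ∑ j, pd j (X j) x - ∑ i, ∑ j, pd j (X i) x * (pd i u x * pd j u x))
        - ((∑ i, X i x * pd i u x) * lapl u x
        - ∑ i, ∑ j, pd i (pd j u) x * (pd i u x * X j x))) := IL.sub IR
  rw [integral_add IBG ILR, integral_sub IL IR, hP, sub_self, add_zero,
    integral_add (IB.const_mul _) (IG.const_mul _), integral_const_mul, integral_const_mul]

end

section

variable {n : ℕ} {u : Eu n → ℝ} {Ω : Set (Eu n)} {f : ℝ → ℝ} {e : ℝ} {y : Eu n}

lemma gsq_eq_zero_of_notMem_tsupport {x : Eu n} (hx : x ∉ tsupport u) : gsq u x = 0 := by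
  simp [gsq, pd_eq_zero_of_notMem_tsupport _ hx]

/-- Bound of the weighted Hessian defect by stability, with test function `ζ`. -/
lemma integral_weighted_hessDefect_le (hΩ : IsOpen Ω) (hu : ContDiff ℝ 2 u)
    (huc : HasCompactSupport u) (hf : ContDiff ℝ 1 f) (hsol : ∀ x ∈ Ω, lapl u x + f (u x) = 0)
    (hst : IsSemiStable Ω f u) {ζ χ : Eu n → ℝ} (hζ : ContDiff ℝ 1 ζ) (hζc : HasCompactSupport ζ)
    (hζΩ : tsupport ζ ⊆ Ω) (hχ : Continuous χ) (hχc : HasCompactSupport χ) {β q Z : ℝ}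
    (he : 0 < e) (hβ : β ≤ 1) (hq : ∀ x ∈ tsupport ζ, qreg e y x ≤ q) (hq0 : 0 ≤ q)
    (hZ : ∀ x, gsq ζ x ≤ Z * χ x ^ 2) :
    ∃ T, ∀ ε, 0 < ε → ∫ x, qreg e y x ^ (1 - β) * hessDefect ε u x * ζ x ^ 2 ≤
      q ^ (1 - β) * Z * (∫ x, χ x ^ 2 * gsq u x) + ε * T := by
  have hu1 : ContDiff ℝ 1 u := hu.of_le (by norm_num)
  have cw := fun a => (contDiff_qreg_rpow (y := y) he a).continuous
  have hζ2c := hasCompactSupport_sq hζc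
  have cg := continuous_gsq hu1
  have cgζ := continuous_gsq hζ
  have cζ := hζ.continuous
  refine ⟨q ^ (1 - β) * ((∫ x, gsq ζ x) - ∫ x, deriv f (u x) * ζ x ^ 2), fun ε hε => ?_⟩
  have cH := continuous_hessDefect hu hε
  have hqp : 0 ≤ q ^ (1 - β) := Real.rpow_nonneg hq0 _
  have I1 : Integrable (fun x => qreg e y x ^ (1 - β) * hessDefect ε u x * ζ x ^ 2) :=
    Continuous.integrable_of_hasCompactSupport (by fun_prop) hζ2c.mul_left
  have I2 : Integrable (fun x => hessDefect ε u x * ζ x ^ 2) :=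
    Continuous.integrable_of_hasCompactSupport (by fun_prop) hζ2c.mul_left
  have I3 : Integrable (fun x => (gsq u x + ε) * gsq ζ x) :=
    Continuous.integrable_of_hasCompactSupport (by fun_prop) (hasCompactSupport_gsq hζc).mul_left
  have I4 : Integrable (fun x => χ x ^ 2 * gsq u x) :=
    Continuous.integrable_of_hasCompactSupport (by fun_prop) (hasCompactSupport_sq hχc).mul_right
  have I5 : Integrable (fun x => gsq ζ x) :=
    Continuous.integrable_of_hasCompactSupport (by fun_prop) (hasCompactSupport_gsq hζc)
  have h1 : ∫ x, qreg e y x ^ (1 - β) * hessDefect ε u x * ζ x ^ 2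
      ≤ ∫ x, q ^ (1 - β) * (hessDefect ε u x * ζ x ^ 2) := by
    refine integral_mono I1 (I2.const_mul _) fun x => ?_
    simp only
    rw [mul_assoc]
    by_cases hx : x ∈ tsupport ζ
    · exact mul_le_mul_of_nonneg_right
        (Real.rpow_le_rpow (qreg_pos he x).le (hq x hx) (by linarith))
        (mul_nonneg (hessDefect_nonneg hε x) (sq_nonneg _))
    · simp [image_eq_zero_of_notMem_tsupport hx]
  have h2 := integral_hessDefect_le hΩ hu huc hf hsol hst hζ hζc hζΩ hε
  have h3 : ∫ x, (gsq u x + ε) * gsq ζ x ≤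
      ∫ x, (Z * (χ x ^ 2 * gsq u x) + ε * gsq ζ x) := by
    refine integral_mono I3 ((I4.const_mul _).add (I5.const_mul _)) fun x => ?_
    have := mul_le_mul_of_nonneg_right (hZ x) (gsq_nonneg u x)
    simp only
    linarith
  rw [integral_add (I4.const_mul _) (I5.const_mul _), integral_const_mul, integral_const_mul] at h3
  rw [integral_const_mul] at h1
  have h4 := mul_le_mul_of_nonneg_left (h2.trans (sub_le_sub_right h3 _)) hqp
  linarith

/-- Bound of the weighted Hessian defect by stability, with a singular test function. -/
lemma integral_weighted_hessDefect_le' (hΩ : IsOpen Ω) (hu : ContDiff ℝ 2 u)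
    (huc : HasCompactSupport u) (hf : ContDiff ℝ 1 f) (hsol : ∀ x ∈ Ω, lapl u x + f (u x) = 0)
    (hst : IsSemiStable Ω f u) {ζ χ : Eu n → ℝ} (hζ : ContDiff ℝ 1 ζ) (hζc : HasCompactSupport ζ)
    (hζΩ : tsupport ζ ⊆ Ω) (hχ : Continuous χ) (hχc : HasCompactSupport χ) {β Z : ℝ}
    (he : 0 < e) (hZ : ∀ x, qreg e y x ^ (1 - β) * gsq ζ x ≤ Z * χ x ^ 2) :
    ∃ T, ∀ ε, 0 < ε → ∫ x, qreg e y x ^ (1 - β) * hessDefect ε u x * ζ x ^ 2 ≤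
      2 * (1 - β) ^ 2 * (∫ x, qreg e y x ^ (-β) * gsq u x * ζ x ^ 2) +
      2 * Z * (∫ x, χ x ^ 2 * gsq u x) + ε * T := by
  have hu1 : ContDiff ℝ 1 u := hu.of_le (by norm_num)
  have hw := fun a : ℝ => (contDiff_qreg_rpow (y := y) he a).of_le (m := 1) (by norm_num)
  have cw := fun a => (hw a).continuous
  have hζ2c := hasCompactSupport_sq hζc
  have cg := continuous_gsq hu1
  have cζ := hζ.continuous
  set η : Eu n → ℝ := fun x => qreg e y x ^ ((1 - β) / 2) * ζ x with hηd
  have hη : ContDiff ℝ 1 η := (hw _).mul hζ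
  have hηc : HasCompactSupport η := hζc.mul_left
  have hηs : tsupport η ⊆ Ω := by
    have : tsupport η ⊆ tsupport ζ := closure_mono (Function.support_mul_subset_right _ _)
    exact this.trans hζΩ
  have cgη := continuous_gsq hη
  refine ⟨((∫ x, gsq η x) - ∫ x, deriv f (u x) * η x ^ 2), fun ε hε => ?_⟩
  have h2 := integral_hessDefect_le hΩ hu huc hf hsol hst hη hηc hηs hε
  have I3 : Integrable (fun x => (gsq u x + ε) * gsq η x) :=
    Continuous.integrable_of_hasCompactSupport (by fun_prop) (hasCompactSupport_gsq hηc).mul_left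
  have I4 : Integrable (fun x => χ x ^ 2 * gsq u x) :=
    Continuous.integrable_of_hasCompactSupport (by fun_prop) (hasCompactSupport_sq hχc).mul_right
  have I5 : Integrable (fun x => gsq η x) :=
    Continuous.integrable_of_hasCompactSupport (by fun_prop) (hasCompactSupport_gsq hηc)
  have I6 : Integrable (fun x => qreg e y x ^ (-β) * gsq u x * ζ x ^ 2) :=
    Continuous.integrable_of_hasCompactSupport (by fun_prop) hζ2c.mul_left
  have I7 : Integrable (fun x => 2 * (1 - β) ^ 2 * (qreg e y x ^ (-β) * gsq u x * ζ x ^ 2)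
        + 2 * Z * (χ x ^ 2 * gsq u x)) := (I6.const_mul _).add (I4.const_mul _)
  have e1 : ∀ x, hessDefect ε u x * η x ^ 2
      = qreg e y x ^ (1 - β) * hessDefect ε u x * ζ x ^ 2 := by
    intro x
    have hQ := qreg_pos (y := y) he x
    rw [hηd]
    simp only
    rw [mul_pow, ← Real.rpow_natCast (_ ^ _), ← Real.rpow_mul hQ.le]
    rw [show (1 - β) / 2 * ((2 : ℕ) : ℝ) = 1 - β by push_cast; ring]
    ring
  simp only [e1] at h2
  have key : ∀ x, gsq η x ≤ 2 * (1 - β) ^ 2 * (qreg e y x ^ (-β) * ζ x ^ 2)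
      + 2 * (Z * χ x ^ 2) := by
    intro x
    have hQ := qreg_pos (y := y) he x
    have hS : ∑ i, (x i - y i) ^ 2 ≤ qreg e y x := by rw [qreg]; nlinarith [sq_nonneg e]
    have dζ := hζ.differentiable (by norm_num) x
    have dw := fun a => (hw a).differentiable (by norm_num) x
    have h1 : gsq η x ≤ 2 * (1 - β) ^ 2 * ((qreg e y x ^ ((1 - β) / 2 - 1)) ^ 2 * ζ x ^ 2)
        * (∑ i, (x i - y i) ^ 2) + 2 * (qreg e y x ^ ((1 - β) / 2)) ^ 2 * gsq ζ x := by
      rw [gsq, gsq, Finset.mul_sum, Finset.mul_sum, ← Finset.sum_add_distrib]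
      refine Finset.sum_le_sum fun i _ => ?_
      rw [hηd, pd_mul i (dw _) dζ, pd_qreg_rpow he]
      nlinarith [sq_nonneg (2 * ((1 - β) / 2) * (x i - y i) * qreg e y x ^ ((1 - β) / 2 - 1) * ζ x
        - qreg e y x ^ ((1 - β) / 2) * pd i ζ x)]
    have p1 : (qreg e y x ^ ((1 - β) / 2)) ^ 2 = qreg e y x ^ (1 - β) := by
      rw [← Real.rpow_natCast (_ ^ _), ← Real.rpow_mul hQ.le]
      congr 1; push_cast; ring
    have p2 : (qreg e y x ^ ((1 - β) / 2 - 1)) ^ 2 * qreg e y x = qreg e y x ^ (-β) := by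
      rw [← Real.rpow_natCast (_ ^ _), ← Real.rpow_mul hQ.le]
      nth_rw 2 [← Real.rpow_one (qreg e y x)]
      rw [← Real.rpow_add hQ]
      congr 1; push_cast; ring
    rw [p1, mul_assoc 2 (_ ^ _) (gsq _ _)] at h1
    refine h1.trans (add_le_add ?_ ?_)
    · rw [← p2]
      have : 0 ≤ 2 * (1 - β) ^ 2 * ((qreg e y x ^ ((1 - β) / 2 - 1)) ^ 2 * ζ x ^ 2) := by positivity
      have := mul_le_mul_of_nonneg_left hS this
      linarith
    · exact mul_le_mul_of_nonneg_left (hZ x) (by norm_num)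
  have h3 : ∫ x, (gsq u x + ε) * gsq η x ≤
      ∫ x, ((2 * (1 - β) ^ 2 * (qreg e y x ^ (-β) * gsq u x * ζ x ^ 2)
        + 2 * Z * (χ x ^ 2 * gsq u x)) + ε * gsq η x) := by
    refine integral_mono I3 (I7.add (I5.const_mul _)) fun x => ?_
    have := mul_le_mul_of_nonneg_right (key x) (gsq_nonneg u x)
    simp only
    linarith
  rw [integral_add I7 (I5.const_mul _), integral_add (I6.const_mul _) (I4.const_mul _),
    integral_const_mul, integral_const_mul, integral_const_mul] at h3
  linarith

end

section

variable {n : ℕ} {u : Eu n → ℝ} {Ω : Set (Eu n)} {f : ℝ → ℝ} {e : ℝ} {y : Eu n}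

/-- A regularised representation formula, estimated by a weighted Dirichlet integral. -/
lemma le_weighted_dirichlet {w : Eu n → ℝ} (hw : ContDiff ℝ 1 w) (hwc : HasCompactSupport w)
    (hw0 : ∀ x, 0 ≤ w x) (he : 0 < e) {m : ℝ}
    (hm : ∀ x ∈ Metric.ball y e, m ≤ w x)
    {S : Set (Eu n)} (hSm : MeasurableSet S) (hSb : Bornology.IsBounded S) (hS : tsupport w ⊆ S)
    (β : ℝ) :
    m * (n * 2 ^ (-(n : ℝ) / 2 - 1) * volume.real (Metric.ball (0 : Eu n) 1)) ≤
      1 / 2 * (∫ x, qreg e y x ^ (-β) * gsq w x) +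
      1 / 2 * ∫ x in S, qreg e y x ^ (β - (n - 1)) := by
  set a : ℝ := -(n : ℝ) / 2 with ha
  have hQ := fun x => qreg_pos (y := y) he x
  have hQr := fun a : ℝ => (contDiff_qreg_rpow (y := y) he a).of_le (m := 1) (by norm_num)
  have cQ := fun a => (hQr a).continuous
  have cw := hw.continuous
  have cg := continuous_gsq hw
  have c1 := fun i => continuous_pd i hw
  have hX : ∀ i, ContDiff ℝ 1 (fun x => w x * ((x i - y i) * qreg e y x ^ a)) := fun i =>
    hw.mul ((show ContDiff ℝ 1 (fun x : Eu n => x i - y i) by fun_prop).mul (hQr a))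
  have hXc : ∀ i, HasCompactSupport (fun x => w x * ((x i - y i) * qreg e y x ^ a)) := fun i =>
    hwc.mul_right
  have h0 := integral_divergence_eq_zero hX hXc
  have hdiv : ∀ x, ∑ i, pd i (fun x => w x * ((x i - y i) * qreg e y x ^ a)) x
      = (∑ i, pd i w x * (x i - y i)) * qreg e y x ^ a
        + w x * (n * e ^ 2 * qreg e y x ^ (a - 1)) := by
    intro x
    have hd : ∀ i, pd i (fun x => w x * ((x i - y i) * qreg e y x ^ a)) x
        = (pd i w x * (x i - y i)) * qreg e y x ^ a
          + w x * (qreg e y x ^ a + 2 * a * qreg e y x ^ (a - 1) * (x i - y i) ^ 2) := by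
      intro i
      have dw := hw.differentiable (by norm_num) x
      have dq := fun a => (hQr a).differentiable (by norm_num) x
      have dx : DifferentiableAt ℝ (fun x : Eu n => x i - y i) x := by fun_prop
      rw [pd_mul i dw (dx.fun_mul (dq a)), pd_mul i dx (dq a), pd_sub_coord, pd_qreg_rpow he]
      simp only [if_true]
      ring
    simp only [hd, Finset.sum_add_distrib, ← Finset.mul_sum, Finset.sum_const, Finset.card_univ,
      Fintype.card_fin, nsmul_eq_mul, Finset.sum_mul]
    congr 2
    have hQa : qreg e y x ^ a = qreg e y x * qreg e y x ^ (a - 1) := by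
      have := (hQ x).ne'
      rw [Real.rpow_sub (hQ x), Real.rpow_one]; field_simp
    have hS : ∑ i, (x i - y i) ^ 2 = qreg e y x - e ^ 2 := by rw [qreg]; ring
    rw [hS, hQa, ha]; ring
  simp only [hdiv] at h0
  have I1 : Integrable (fun x => (∑ i, pd i w x * (x i - y i)) * qreg e y x ^ a) :=
    Continuous.integrable_of_hasCompactSupport (by fun_prop)
      (hasCompactSupport_finset_sum _ fun i _ => (hasCompactSupport_pd i hwc).mul_right).mul_right
  have I2 : Integrable (fun x => w x * (n * e ^ 2 * qreg e y x ^ (a - 1))) :=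
    Continuous.integrable_of_hasCompactSupport (by fun_prop) hwc.mul_right
  have I3 : Integrable (fun x => qreg e y x ^ (-β) * gsq w x) :=
    Continuous.integrable_of_hasCompactSupport (by fun_prop) (hasCompactSupport_gsq hwc).mul_left
  have I4 : IntegrableOn (fun x => qreg e y x ^ (β - (n - 1))) S :=
    ((cQ _).continuousOn.integrableOn_compact hSb.isCompact_closure).mono_set subset_closure
  rw [integral_add I1 I2] at h0
  have hup : - ∫ x, (∑ i, pd i w x * (x i - y i)) * qreg e y x ^ a ≤
      1 / 2 * (∫ x, qreg e y x ^ (-β) * gsq w x) +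
      1 / 2 * ∫ x in S, qreg e y x ^ (β - (n - 1)) := by
    rw [← integral_neg, ← integral_indicator hSm, ← integral_const_mul, ← integral_const_mul,
      ← integral_add (I3.const_mul _) ((I4.integrable_indicator hSm).const_mul _)]
    refine integral_mono I1.neg ((I3.const_mul _).add ((I4.integrable_indicator hSm).const_mul _))
      fun x => ?_
    simp only
    by_cases hx : x ∈ tsupport w
    · rw [Set.indicator_of_mem (hS hx)]
      have hCS : (∑ i, pd i w x * (x i - y i)) ^ 2 ≤ gsq w x * qreg e y x := by
        refine (Finset.sum_mul_sq_le_sq_mul_sq _ _ _).trans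
          (mul_le_mul_of_nonneg_left ?_ (gsq_nonneg _ _))
        rw [qreg]; nlinarith [sq_nonneg e]
      set t := ∑ i, pd i w x * (x i - y i)
      set A := qreg e y x ^ (-β) * gsq w x
      set B := qreg e y x ^ (β - (n - 1))
      have hA : 0 ≤ A := mul_nonneg (Real.rpow_nonneg (hQ x).le _) (gsq_nonneg _ _)
      have hB : 0 ≤ B := Real.rpow_nonneg (hQ x).le _
      have hAB : (t * qreg e y x ^ a) ^ 2 ≤ A * B := by
        have e1 : (qreg e y x ^ a) ^ 2 = qreg e y x ^ (-(n : ℝ)) := by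
          rw [← Real.rpow_natCast (_ ^ _), ← Real.rpow_mul (hQ x).le, ha]
          congr 1; push_cast; ring
        have e2 : A * B = gsq w x * (qreg e y x * qreg e y x ^ (-(n : ℝ))) := by
          have : qreg e y x * qreg e y x ^ (-(n : ℝ)) = qreg e y x ^ (-β) * B := by
            nth_rw 1 [← Real.rpow_one (qreg e y x)]
            rw [← Real.rpow_add (hQ x), ← Real.rpow_add (hQ x)]
            congr 1; ring
          rw [this]; ring
        rw [mul_pow, e1, e2, ← mul_assoc]
        exact mul_le_mul_of_nonneg_right hCS (Real.rpow_nonneg (hQ x).le _)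
      refine (neg_le_abs _).trans (abs_le_of_sq_le_sq ?_ (by positivity))
      nlinarith [sq_nonneg (A - B)]
    · have h1 : ∀ i, pd i w x = 0 := fun i => pd_eq_zero_of_notMem_tsupport i hx
      rw [gsq_eq_zero_of_notMem_tsupport hx]
      simp only [h1, zero_mul, Finset.sum_const_zero, neg_zero, mul_zero, zero_add]
      exact mul_nonneg (by norm_num)
        (Set.indicator_nonneg (fun x _ => Real.rpow_nonneg (hQ x).le _) x)
  refine le_trans ?_ hup
  have h0' : - ∫ x, (∑ i, pd i w x * (x i - y i)) * qreg e y x ^ a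
      = ∫ x, w x * (n * e ^ 2 * qreg e y x ^ (a - 1)) := by linarith
  rw [h0']
  have hnn : ∀ x, 0 ≤ w x * (n * e ^ 2 * qreg e y x ^ (a - 1)) := fun x =>
    mul_nonneg (hw0 x) (mul_nonneg (by positivity) (Real.rpow_nonneg (hQ x).le _))
  refine le_trans ?_ (setIntegral_le_integral (s := Metric.ball y e) I2
    (Eventually.of_forall hnn))
  have hlow : ∀ x ∈ Metric.ball y e, m * (n * e ^ 2 * (2 * e ^ 2) ^ (a - 1)) ≤
      w x * (n * e ^ 2 * qreg e y x ^ (a - 1)) := by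
    intro x hx
    have h1 : qreg e y x ≤ 2 * e ^ 2 := by
      rw [qreg, sum_sq_eq_norm_sub_sq]
      rw [Metric.mem_ball, dist_eq_norm] at hx
      nlinarith [norm_nonneg (x - y)]
    have h2 : (2 * e ^ 2) ^ (a - 1) ≤ qreg e y x ^ (a - 1) :=
      Real.rpow_le_rpow_of_nonpos (hQ x) h1 (by
        have : (0 : ℝ) ≤ n := Nat.cast_nonneg n
        rw [ha]; linarith)
    have h3 := Real.rpow_nonneg (hQ x).le (a - 1)
    have := hm x hx
    have := hw0 x
    gcongr
  have hfin : volume (Metric.ball y e) ≠ ⊤ := measure_ball_lt_top.ne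
  have := setIntegral_mono_on (integrableOn_const (C := m * (n * e ^ 2 * (2 * e ^ 2) ^ (a - 1)))
    hfin) I2.integrableOn measurableSet_ball hlow
  refine le_trans (le_of_eq ?_) this
  rw [setIntegral_const, smul_eq_mul, measureReal_def, measureReal_def,
    Measure.addHaar_ball_of_pos _ _ he, ENNReal.toReal_mul, ENNReal.toReal_ofReal (by positivity),
    finrank_euclideanSpace_fin, Real.mul_rpow (by norm_num) (by positivity)]
  have : (e ^ 2 : ℝ) ^ (a - 1) * e ^ 2 * e ^ n = 1 := by
    rw [← Real.rpow_natCast e 2, ← Real.rpow_mul he.le, ← Real.rpow_natCast e n,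
      ← Real.rpow_add he, ← Real.rpow_add he, ha]
    rw [show ((2 : ℕ) : ℝ) * (-(n : ℝ) / 2 - 1) + (2 : ℕ) + n = 0 by push_cast; ring,
      Real.rpow_zero]
  linear_combination (-m * n * 2 ^ (a - 1) * (volume (Metric.ball (0 : Eu n) 1)).toReal) * this

end

section

variable {n : ℕ} {u : Eu n → ℝ} {Ω : Set (Eu n)} {f : ℝ → ℝ} {e : ℝ} {y : Eu n}

lemma setIntegral_qreg_rpow_le (hn : 2 ≤ n) {R : ℝ} (he : 0 < e) :
    ∫ x in Metric.ball y R, qreg e y x ^ (-(n : ℝ) / 2 + 1 / 10) ≤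
      ∫ x in Metric.ball (0 : Eu n) R, ‖x‖ ^ (-(n - 1 / 5 : ℝ)) := by
  have hn' : (2 : ℝ) ≤ n := by exact_mod_cast hn
  have hInt : IntegrableOn (fun x : Eu n => ‖x‖ ^ (-(n - 1 / 5 : ℝ))) (Metric.ball 0 R) := by
    refine integrableOn_ball_of_norm_le_rpow (C := 1) (α := n - 1 / 5) ?_ ?_ ?_ ?_
    · rw [finrank_euclideanSpace_fin]; omega
    · rw [finrank_euclideanSpace_fin]; linarith
    · refine Eventually.of_forall fun x => ?_
      rw [Real.norm_of_nonneg (Real.rpow_nonneg (norm_nonneg _) _), one_mul]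
    · exact (measurable_norm.pow_const _).aestronglyMeasurable
  have h1 : ∫ x in Metric.ball y R, qreg e y x ^ (-(n : ℝ) / 2 + 1 / 10)
      = ∫ x in Metric.ball (0 : Eu n) R, qreg e 0 x ^ (-(n : ℝ) / 2 + 1 / 10) := by
    rw [← integral_indicator measurableSet_ball, ← integral_indicator measurableSet_ball]
    refine Eq.trans ?_ (integral_sub_right_eq_self _ y)
    congr 1
    funext x
    simp only [Set.indicator, mem_ball_iff_norm, sub_zero, qreg]
    simp
  rw [h1]
  have cq : Continuous (fun x : Eu n => qreg e 0 x ^ (-(n : ℝ) / 2 + 1 / 10)) :=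
    (contDiff_qreg_rpow he _).continuous
  refine setIntegral_mono_on_ae ?_ hInt measurableSet_ball ?_
  · exact (cq.continuousOn.integrableOn_compact (isCompact_closedBall 0 R)).mono_set
      Metric.ball_subset_closedBall
  · have : Nonempty (Fin n) := ⟨⟨0, by omega⟩⟩
    have : Nontrivial (Eu n) := inferInstance
    have h0 : ∀ᵐ x : Eu n, x ≠ 0 := by
      simp [ae_iff, measure_singleton]
    filter_upwards [h0] with x hx _
    have hx' : 0 < ‖x‖ := norm_pos_iff.2 hx
    have h2 : ‖x‖ ^ 2 ≤ qreg e 0 x := by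
      rw [qreg, sum_sq_eq_norm_sub_sq, sub_zero]; nlinarith [sq_nonneg e]
    refine (Real.rpow_le_rpow_of_nonpos (by positivity) h2 (by linarith)).trans (le_of_eq ?_)
    rw [← Real.rpow_natCast, ← Real.rpow_mul hx'.le]
    congr 1; push_cast; ring

set_option maxHeartbeats 2000000 in
/-- Interior bound: constants depend only on the geometry of the cut-offs. -/
lemma exists_interior_bound (hn : n ∈ ({2, 3, 4} : Set ℕ)) {d R Z M G : ℝ} (hd : 0 < d)
    (hR : 0 < R) (hZ0 : 0 ≤ Z) (hG0 : 0 ≤ G) :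
    ∃ C : ℝ, ∀ (Ω : Set (Eu n)) (f : ℝ → ℝ) (u ζ χ : Eu n → ℝ) (y : Eu n), IsOpen Ω →
      ContDiff ℝ 2 u → HasCompactSupport u → ContDiff ℝ 1 f →
      (∀ x ∈ Ω, lapl u x + f (u x) = 0) → IsSemiStable Ω f u → (∀ x ∈ Ω, 0 ≤ u x) →
      ContDiff ℝ 1 ζ → HasCompactSupport ζ → tsupport ζ ⊆ Ω → (∀ x, 0 ≤ ζ x) → (∀ x, ζ x ≤ 1) →
      ζ y = 1 → tsupport ζ ⊆ Metric.ball y R → (∀ x, gsq ζ x ≤ Z) →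
      Continuous χ → HasCompactSupport χ → (∀ x, gsq ζ x ≠ 0 → χ x = 1) →
      (∀ x, gsq ζ x ≠ 0 → d ≤ ‖x - y‖) → (∀ x, gsq ζ x ≠ 0 → u x ≤ M) →
      ∫ x, χ x ^ 2 * gsq u x ≤ G → u y ≤ C := by
  have hn2 : 2 ≤ n := by rcases hn with rfl | rfl | rfl <;> norm_num
  have hn2' : (2 : ℝ) ≤ n := by exact_mod_cast hn2
  have hn4 : (n : ℝ) ≤ 4 := by rcases hn with rfl | rfl | rfl <;> norm_num
  set β : ℝ := (n - 2) / 2 + 1 / 10 with hβ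
  have hβ0 : 0 ≤ β := by linarith
  set W : ℝ := (d ^ 2) ^ (-β) with hW
  have hW0 : 0 ≤ W := Real.rpow_nonneg (by positivity) _
  set E : ℝ := W * R * Real.sqrt Z with hEd
  have hE0 : 0 ≤ E := by positivity
  set A : ℝ := (R ^ 2 + 1) ^ (1 - β) * Z + 2 * ((d ^ 2) ^ (1 - β) * Z) with hA
  have hA0 : 0 ≤ A := by
    have := Real.rpow_nonneg (show 0 ≤ R ^ 2 + 1 by positivity) (1 - β)
    have := Real.rpow_nonneg (show 0 ≤ d ^ 2 by positivity) (1 - β)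
    positivity
  set I₀ : ℝ := (15 / 4 * A + 4 * E) * G / (525 / 1000) with hI₀
  set B : ℝ := I₀ + W * M ^ 2 * Z * volume.real (Metric.ball (0 : Eu n) R)
    + 1 / 2 * ∫ x in Metric.ball (0 : Eu n) R, ‖x‖ ^ (-(n - 1 / 5 : ℝ)) with hB
  set c : ℝ := n * 2 ^ (-(n : ℝ) / 2 - 1) * volume.real (Metric.ball (0 : Eu n) 1) with hc
  have hc0 : 0 < c := by
    have : 0 < volume.real (Metric.ball (0 : Eu n) 1) :=
      ENNReal.toReal_pos (Metric.measure_ball_pos _ _ one_pos).ne' measure_ball_lt_top.ne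
    have : (0 : ℝ) < 2 ^ (-(n : ℝ) / 2 - 1) := by positivity
    positivity
  have hB0 : 0 ≤ B := by
    have : 0 ≤ ∫ x in Metric.ball (0 : Eu n) R, ‖x‖ ^ (-(n - 1 / 5 : ℝ)) :=
      integral_nonneg fun x => Real.rpow_nonneg (norm_nonneg _) _
    have : 0 ≤ I₀ := by positivity
    have : 0 ≤ volume.real (Metric.ball (0 : Eu n) R) := measureReal_nonneg
    positivity
  refine ⟨B / c, fun Ω f u ζ χ y hΩ hu huc hf hsol hst hu0 hζ hζc hζΩ hζ0 hζ1 hζy hζR hζZ hχ hχc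
    hχ1 hdist huM hG => ?_⟩
  have hu1 : ContDiff ℝ 1 u := hu.of_le (by norm_num)
  have hgt : ∀ x, gsq ζ x ≠ 0 → x ∈ tsupport ζ := fun x hx => by
    by_contra h; exact hx (gsq_eq_zero_of_notMem_tsupport h)
  have hQd : ∀ e : ℝ, ∀ x, gsq ζ x ≠ 0 → d ^ 2 ≤ qreg e y x := fun e x hx => by
    rw [qreg, sum_sq_eq_norm_sub_sq]
    nlinarith [hdist x hx, sq_nonneg e]
  have hQW : ∀ e : ℝ, ∀ x, gsq ζ x ≠ 0 → qreg e y x ^ (-β) ≤ W := fun e x hx =>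
    Real.rpow_le_rpow_of_nonpos (by positivity) (hQd e x hx) (by linarith)
  have hζZχ : ∀ x, gsq ζ x ≤ Z * χ x ^ 2 := fun x => by
    by_cases hx : gsq ζ x = 0
    · rw [hx]; positivity
    · rw [hχ1 x hx]; simpa using hζZ x
  have hI : ∀ e, 0 < e → e ≤ 1 → ∫ x, qreg e y x ^ (-β) * gsq u x * ζ x ^ 2 ≤ I₀ := by
    intro e he he1
    set I := ∫ x, qreg e y x ^ (-β) * gsq u x * ζ x ^ 2
    have hI0 : 0 ≤ I := integral_nonneg fun x =>
      mul_nonneg (mul_nonneg (Real.rpow_nonneg (qreg_pos he x).le _) (gsq_nonneg _ _)) (sq_nonneg _)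
    set G' := ∫ x, χ x ^ 2 * gsq u x
    have hG'0 : 0 ≤ G' := integral_nonneg fun x => mul_nonneg (sq_nonneg _) (gsq_nonneg _ _)
    have hE : ∀ x, (qreg e y x ^ (-β)) ^ 2 * (∑ i, (x i - y i) ^ 2) * gsq ζ x
        ≤ (E * χ x ^ 2) ^ 2 := by
      intro x
      by_cases hx : gsq ζ x = 0
      · rw [hx, mul_zero]; positivity
      · rw [hχ1 x hx, one_pow, mul_one, hEd, mul_pow, mul_pow, Real.sq_sqrt hZ0]
        have h1 := hQW e x hx
        have h2 : ∑ i, (x i - y i) ^ 2 ≤ R ^ 2 := by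
          rw [sum_sq_eq_norm_sub_sq]
          have := hζR (hgt x hx)
          rw [Metric.mem_ball, dist_eq_norm] at this
          exact pow_le_pow_left₀ (norm_nonneg _) this.le 2
        have h3 := hζZ x
        have h4 := Real.rpow_nonneg (qreg_pos (y := y) he x).le (-β)
        have h5 := gsq_nonneg ζ x
        gcongr
    have hJ : ∃ T, ∀ ε, 0 < ε → ∫ x, qreg e y x ^ (1 - β) * hessDefect ε u x * ζ x ^ 2 ≤
        1 / 50 * I + A * G' + ε * T := by
      have hr1 := Real.rpow_nonneg (show 0 ≤ R ^ 2 + 1 by positivity) (1 - β)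
      have hr2 := Real.rpow_nonneg (show 0 ≤ d ^ 2 by positivity) (1 - β)
      by_cases hn3 : n = 4
      · have hβ4 : β = 11 / 10 := by rw [hβ, hn3]; norm_num
        obtain ⟨T, hT⟩ := integral_weighted_hessDefect_le' (y := y) (e := e) (β := β)
          (Z := (d ^ 2) ^ (1 - β) * Z) hΩ hu huc hf hsol hst hζ hζc hζΩ hχ hχc he (fun x => by
          by_cases hx : gsq ζ x = 0
          · rw [hx, mul_zero]; positivity
          · rw [hχ1 x hx, one_pow, mul_one]
            exact mul_le_mul (Real.rpow_le_rpow_of_nonpos (by positivity) (hQd e x hx)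
              (by rw [hβ4]; norm_num)) (hζZ x) (gsq_nonneg _ _) hr2)
        refine ⟨T, fun ε hε => (hT ε hε).trans ?_⟩
        have e1 : 2 * (1 - β) ^ 2 = 1 / 50 := by rw [hβ4]; norm_num
        rw [e1]
        have : 2 * ((d ^ 2) ^ (1 - β) * Z) * G' ≤ A * G' :=
          mul_le_mul_of_nonneg_right (by rw [hA]; linarith [mul_nonneg hr1 hZ0]) hG'0
        linarith
      · have hβ1 : β ≤ 1 := by
          rw [hβ]
          rcases hn with rfl | rfl | rfl
          · norm_num
          · norm_num
          · exact absurd rfl hn3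
        obtain ⟨T, hT⟩ := integral_weighted_hessDefect_le (y := y) (e := e) (β := β)
          (q := R ^ 2 + 1) hΩ hu huc hf hsol hst hζ hζc hζΩ hχ hχc he hβ1 (fun x hx => by
            rw [qreg, sum_sq_eq_norm_sub_sq]
            have := hζR hx
            rw [Metric.mem_ball, dist_eq_norm] at this
            nlinarith [norm_nonneg (x - y)]) (by positivity) hζZχ
        refine ⟨T, fun ε hε => (hT ε hε).trans ?_⟩
        have : (R ^ 2 + 1) ^ (1 - β) * Z * G' ≤ A * G' :=
          mul_le_mul_of_nonneg_right (by rw [hA]; linarith [mul_nonneg hr2 hZ0]) hG'0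
        linarith
    obtain ⟨T, hT⟩ := hJ
    have hfin : ∀ ε, 0 < ε → 525 / 1000 * I ≤ (15 / 4 * A + 4 * E) * G + ε * (15 / 4 * |T|) := by
      intro ε hε
      have h1 := hardy_inequality hn2 hu hζ hζc hζ0 hζ1 hχ hχc hβ0 he hE0 hE hε
      have h2 := hT ε hε
      set J := ∫ x, qreg e y x ^ (1 - β) * hessDefect ε u x * ζ x ^ 2
      have hJ0 : 0 ≤ J := integral_nonneg fun x => mul_nonneg
        (mul_nonneg (Real.rpow_nonneg (qreg_pos he x).le _) (hessDefect_nonneg hε x)) (sq_nonneg _)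
      have h3 : (n - 1 - 2 * β - 1 / 5 : ℝ) = 3 / 5 := by rw [hβ]; ring
      rw [h3] at h1
      have h4 : 5 / 4 * (n - 1) * J ≤ 15 / 4 * J :=
        mul_le_mul_of_nonneg_right (by linarith) hJ0
      have h5 : ε * T ≤ ε * |T| := mul_le_mul_of_nonneg_left (le_abs_self T) hε.le
      have h6 : A * G' ≤ A * G := mul_le_mul_of_nonneg_left hG hA0
      have h7 : E * G' ≤ E * G := mul_le_mul_of_nonneg_left hG hE0
      linarith
    rw [hI₀, le_div_iff₀ (by norm_num), mul_comm]
    refine le_of_forall_pos_le_add fun δ hδ => ?_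
    refine (hfin (δ / (15 / 4 * |T| + 1)) (by positivity)).trans ?_
    have : δ / (15 / 4 * |T| + 1) * (15 / 4 * |T|) ≤ δ := by
      rw [div_mul_eq_mul_div, div_le_iff₀ (by positivity)]
      nlinarith [abs_nonneg T]
    linarith
  set w : Eu n → ℝ := fun x => u x * ζ x with hwd
  have hw : ContDiff ℝ 1 w := hu1.mul hζ
  have hwc : HasCompactSupport w := hζc.mul_left
  have hws : tsupport w ⊆ tsupport ζ := closure_mono (Function.support_mul_subset_right _ _)
  have hw0 : ∀ x, 0 ≤ w x := fun x => by
    by_cases hx : x ∈ tsupport ζ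
    · exact mul_nonneg (hu0 x (hζΩ hx)) (hζ0 x)
    · simp [hwd, image_eq_zero_of_notMem_tsupport hx]
  have hmain : ∀ m, 0 ≤ m → m < u y → m * c ≤ B := by
    intro m hm0 hm
    have hy : m < w y := by simpa [hwd, hζy] using hm
    obtain ⟨e₀, he₀, hball⟩ := Metric.eventually_nhds_iff_ball.1
      (hw.continuous.continuousAt.eventually (lt_mem_nhds hy))
    set e := min e₀ 1
    have he : 0 < e := lt_min he₀ one_pos
    have h1 := le_weighted_dirichlet hw hwc hw0 he (m := m)
      (fun x hx => (hball x (Metric.ball_subset_ball (min_le_left _ _) hx)).le)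
      measurableSet_ball Metric.isBounded_ball (hws.trans hζR) β
    have h2 : ∫ x in Metric.ball y R, qreg e y x ^ (β - (n - 1)) ≤ _ :=
      (le_of_eq (by congr 2; funext x; congr 1; rw [hβ]; ring)).trans
        (setIntegral_qreg_rpow_le (y := y) (R := R) hn2 he)
    have cQ := (contDiff_qreg_rpow (y := y) he (-β)).continuous
    have cg := continuous_gsq hu1
    have cζ := hζ.continuous
    have cgw := continuous_gsq hw
    have J1 : Integrable (fun x => qreg e y x ^ (-β) * gsq u x * ζ x ^ 2) :=
      Continuous.integrable_of_hasCompactSupport (by fun_prop) (hasCompactSupport_sq hζc).mul_left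
    have J2 : Integrable ((Metric.ball y R).indicator fun _ => 2 * (W * M ^ 2 * Z)) :=
      (integrable_indicator_iff measurableSet_ball).2
        (integrableOn_const (μ := volume) (measure_ball_lt_top (x := y) (r := R)).ne)
    have J3 : Integrable (fun x => qreg e y x ^ (-β) * gsq w x) :=
      Continuous.integrable_of_hasCompactSupport (by fun_prop) (hasCompactSupport_gsq hwc).mul_left
    have h3 : ∫ x, qreg e y x ^ (-β) * gsq w x ≤
        ∫ x, (2 * (qreg e y x ^ (-β) * gsq u x * ζ x ^ 2)
          + (Metric.ball y R).indicator (fun _ => 2 * (W * M ^ 2 * Z)) x) := by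
      refine integral_mono J3 ((J1.const_mul 2).add J2) fun x => ?_
      simp only
      have hq := Real.rpow_nonneg (qreg_pos (y := y) he x).le (-β)
      have hgw : gsq w x ≤ 2 * (gsq u x * ζ x ^ 2) + 2 * (u x ^ 2 * gsq ζ x) := by
        simp only [gsq, Finset.mul_sum, Finset.sum_mul, ← Finset.sum_add_distrib]
        refine Finset.sum_le_sum fun i _ => ?_
        rw [hwd, pd_mul i (hu1.differentiable (by norm_num) x) (hζ.differentiable (by norm_num) x)]
        nlinarith [sq_nonneg (pd i u x * ζ x - u x * pd i ζ x)]
      have h4 := mul_le_mul_of_nonneg_left hgw hq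
      have h5 : qreg e y x ^ (-β) * (u x ^ 2 * gsq ζ x) ≤
          (Metric.ball y R).indicator (fun _ => W * M ^ 2 * Z) x := by
        by_cases hx : gsq ζ x = 0
        · rw [hx, mul_zero, mul_zero]
          exact Set.indicator_nonneg (fun _ _ => by positivity) x
        · rw [Set.indicator_of_mem (hζR (hgt x hx)), mul_assoc]
          have a1 := hQW e x hx
          have a2 : u x ^ 2 ≤ M ^ 2 := pow_le_pow_left₀ (hu0 x (hζΩ (hgt x hx))) (huM x hx) 2
          have a3 := hζZ x
          have a4 := gsq_nonneg ζ x
          gcongr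
      have h6 : (Metric.ball y R).indicator (fun _ => 2 * (W * M ^ 2 * Z)) x
          = 2 * (Metric.ball y R).indicator (fun _ => W * M ^ 2 * Z) x := by
        simp only [Set.indicator]; split_ifs <;> ring
      rw [h6]; linarith
    rw [integral_add (J1.const_mul 2) J2, integral_const_mul, integral_indicator measurableSet_ball,
      setIntegral_const, smul_eq_mul] at h3
    have hv : volume.real (Metric.ball y R) = volume.real (Metric.ball (0 : Eu n) R) := by
      rw [measureReal_def, measureReal_def, Measure.addHaar_ball_center]
    rw [hv] at h3
    have h7 := hI e he (min_le_right _ _)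
    rw [hB]
    linarith
  rw [le_div_iff₀ hc0]
  by_contra hcon
  push Not at hcon
  have huy : B / c < u y := by rwa [div_lt_iff₀ hc0]
  obtain ⟨m, hm1, hm2⟩ := exists_between huy
  have := hmain m ((div_nonneg hB0 hc0.le).trans hm1.le) hm2
  rw [div_lt_iff₀ hc0] at hm1
  linarith

end

section

variable {n : ℕ}

lemma hasDerivAt_max_zero_pow (k : ℕ) (t : ℝ) :
    HasDerivAt (fun s : ℝ => max s 0 ^ (k + 2)) ((k + 2 : ℕ) * max t 0 ^ (k + 1)) t := by
  rcases lt_trichotomy t 0 with ht | rfl | ht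
  · have : (fun s : ℝ => max s 0 ^ (k + 2)) =ᶠ[nhds t] fun _ => 0 := by
      filter_upwards [Iio_mem_nhds ht] with s hs
      rw [max_eq_right (le_of_lt hs), zero_pow (by omega)]
    rw [max_eq_right ht.le, zero_pow (by omega), mul_zero]
    exact (hasDerivAt_const t (0 : ℝ)).congr_of_eventuallyEq this
  · rw [max_self, zero_pow (by omega), mul_zero, hasDerivAt_iff_isLittleO_nhds_zero]
    simp only [zero_add, max_self, smul_zero, sub_zero]
    rw [zero_pow (by omega)]
    simp only [sub_zero]
    have h1 : (fun h : ℝ => max h 0 ^ (k + 2)) =O[nhds 0] fun h : ℝ => h ^ (k + 2) := by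
      refine Asymptotics.IsBigO.of_bound 1 (Eventually.of_forall fun h => ?_)
      rw [one_mul, Real.norm_eq_abs, Real.norm_eq_abs, abs_pow, abs_pow]
      refine pow_le_pow_left₀ (abs_nonneg _) ?_ _
      rw [abs_of_nonneg (le_max_right _ _)]
      exact max_le (le_abs_self _) (abs_nonneg _)
    refine h1.trans_isLittleO ?_
    exact Asymptotics.isLittleO_pow_id (by omega)
  · have : (fun s : ℝ => max s 0 ^ (k + 2)) =ᶠ[nhds t] fun s => s ^ (k + 2) := by
      filter_upwards [Ioi_mem_nhds ht] with s hs
      rw [max_eq_left (le_of_lt hs)]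
    rw [max_eq_left ht.le]
    exact (hasDerivAt_pow (k + 2) t).congr_of_eventuallyEq this

lemma contDiff_one_max_zero_pow (k : ℕ) : ContDiff ℝ 1 fun s : ℝ => max s 0 ^ (k + 2) := by
  rw [contDiff_one_iff_deriv]
  refine ⟨fun t => (hasDerivAt_max_zero_pow k t).differentiableAt, ?_⟩
  rw [funext fun t => (hasDerivAt_max_zero_pow k t).deriv]
  fun_prop

lemma contDiff_two_max_zero_pow (k : ℕ) : ContDiff ℝ 2 fun s : ℝ => max s 0 ^ (k + 3) := by
  rw [show (2 : WithTop ℕ∞) = 1 + 1 by norm_num, contDiff_succ_iff_deriv]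
  refine ⟨fun t => (hasDerivAt_max_zero_pow (k + 1) t).differentiableAt, by simp, ?_⟩
  have e : deriv (fun s : ℝ => max s 0 ^ (k + 3)) = _ :=
    funext fun t => (hasDerivAt_max_zero_pow (k + 1) t).deriv
  rw [e]
  exact contDiff_const.mul (contDiff_one_max_zero_pow k)

/-- The Laplacian of a composition. -/
lemma lapl_comp {g : ℝ → ℝ} (hg : ContDiff ℝ 2 g) {w : Eu n → ℝ} {x : Eu n}
    (hw : ContDiffAt ℝ 2 w x) :
    lapl (fun y => g (w y)) x = deriv (deriv g) (w x) * gsq w x + deriv g (w x) * lapl w x := by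
  have hg1 : ContDiff ℝ 1 (deriv g) := by
    rw [show (2 : WithTop ℕ∞) = 1 + 1 by norm_num, contDiff_succ_iff_deriv] at hg
    exact hg.2.2
  have hd : ∀ᶠ y in nhds x, DifferentiableAt ℝ w y := by
    filter_upwards [hw.eventually (by simp)] with y hy using hy.differentiableAt (by norm_num)
  rw [lapl_eq, lapl_eq, gsq, Finset.mul_sum, Finset.mul_sum, ← Finset.sum_add_distrib]
  refine Finset.sum_congr rfl fun i _ => ?_
  have h1 : pd i (fun y => g (w y)) =ᶠ[nhds x] fun y => deriv g (w y) * pd i w y := by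
    filter_upwards [hd] with y hy
    exact pd_comp i ((hg.differentiable (by norm_num)) (w y)).hasDerivAt hy
  have hdx := hd.self_of_nhds
  have hgx := (hg1.differentiable (by norm_num)) (w x)
  rw [pd_congr i h1, pd_mul i (u := fun y => deriv g (w y)) (hgx.comp x hdx)
    ((contDiffAt_pd i (k := 1) hw (by norm_num)).differentiableAt (by norm_num)),
    pd_comp i hgx.hasDerivAt hdx]
  ring

/-- A smooth bump with compact support. -/
lemma hasCompactSupport_max_pow (k : ℕ) :
    HasCompactSupport fun z : Eu n => max (1 - qreg 0 0 z) 0 ^ (k + 2) := by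
  refine HasCompactSupport.of_support_subset_isCompact (isCompact_closedBall (0 : Eu n) 1) ?_
  intro z hz
  rw [Function.mem_support] at hz
  by_contra h
  apply hz
  rw [mem_closedBall_zero_iff, not_le] at h
  rw [max_eq_right, zero_pow (by omega)]
  rw [qreg, sum_sq_eq_norm_sub_sq, sub_zero]
  nlinarith

lemma pd_comp_affine (i : Fin n) {V : Eu n → ℝ} (x₀ : Eu n) (r : ℝ) (z : Eu n)
    (hV : Differentiable ℝ V) :
    pd i (fun z => V (x₀ + r • z)) z = r * pd i V (x₀ + r • z) := by
  have h : HasFDerivAt (fun z : Eu n => x₀ + r • z) (r • ContinuousLinearMap.id ℝ (Eu n)) z :=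
    ((hasFDerivAt_id z).const_smul r).const_add x₀
  have := ((hV (x₀ + r • z)).hasFDerivAt.comp z h).fderiv
  simp only [pd]
  rw [show (fun z => V (x₀ + r • z)) = V ∘ fun z => x₀ + r • z from rfl, this]
  simp

/-- A weighted mean value inequality. -/
lemma mul_integral_le_of_neg_le_lapl {V : Eu n → ℝ} (hV : ContDiff ℝ 2 V) {K : ℝ}
    (hK : ∀ x, -K ≤ lapl V x) (x₀ : Eu n) {r : ℝ} (hr : 0 ≤ r) :
    V x₀ * ∫ z : Eu n, max (1 - qreg 0 0 z) 0 ^ 2 ≤ (∫ z, V (x₀ + r • z) * max (1 - qreg 0 0 z) 0 ^ 2)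
      + K * (∫ z : Eu n, max (1 - qreg 0 0 z) 0 ^ 3) * r ^ 2 / 12 := by
  set η : Eu n → ℝ := fun z => max (1 - qreg 0 0 z) 0 ^ 2 with hη
  set θ : Eu n → ℝ := fun z => max (1 - qreg 0 0 z) 0 ^ 3 with hθ
  have hηc : HasCompactSupport η := hasCompactSupport_max_pow 0
  have hθc : HasCompactSupport θ := hasCompactSupport_max_pow 1
  have hq : ContDiff ℝ 1 fun z : Eu n => 1 - qreg 0 0 z :=
    contDiff_const.sub (contDiff_qreg.of_le (by norm_num))
  have hη1 : ContDiff ℝ 1 η := (contDiff_one_max_zero_pow 0).comp hq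
  have hθ1 : ContDiff ℝ 1 θ := (contDiff_one_max_zero_pow 1).comp hq
  have hV1 : ContDiff ℝ 1 V := hV.of_le (by norm_num)
  have cV := hV.continuous
  have cη := hη1.continuous
  have cθ := hθ1.continuous
  have cL := continuous_lapl hV
  have hθ0 : ∀ z, 0 ≤ θ z := fun z => by positivity
  have hpθ : ∀ i (z : Eu n), pd i θ z = -6 * (z i * η z) := by
    intro i z
    have hd := (hasDerivAt_max_zero_pow 1 (1 - qreg 0 0 z))
    rw [hθ, pd_comp i (g := fun s => max s 0 ^ 3) hd (hq.differentiable (by norm_num) z),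
      pd_sub i (differentiableAt_const _) (contDiff_qreg.differentiable (by norm_num) z
        : DifferentiableAt ℝ (fun z : Eu n => qreg 0 0 z) z), pd_const, pd_qreg]
    simp [hη]; ring
  set A : ℝ → ℝ := fun s => ∫ z, V (x₀ + s • z) * η z with hA
  set B : ℝ → ℝ := fun s => ∫ z, (∑ i, z i * pd i V (x₀ + s • z)) * η z with hB
  have cB : Continuous fun p : ℝ × Eu n => (∑ i, p.2 i * pd i V (x₀ + p.1 • p.2)) * η p.2 := by
    have : ∀ i, Continuous (pd i V) := fun i => continuous_pd i hV1
    fun_prop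
  have hder : ∀ s, HasDerivAt A (B s) s := by
    intro s
    obtain ⟨C, hC⟩ := ((isCompact_closedBall s 1).prod hηc).exists_bound_of_continuousOn
      (f := fun p : ℝ × Eu n => (∑ i, p.2 i * pd i V (x₀ + p.1 • p.2)) * η p.2) cB.continuousOn
    have hInt : ∀ t : ℝ, Integrable fun z => V (x₀ + t • z) * η z := fun t =>
      Continuous.integrable_of_hasCompactSupport (by fun_prop) hηc.mul_left
    refine (hasDerivAt_integral_of_dominated_loc_of_deriv_le
      (F := fun s z => V (x₀ + s • z) * η z)
      (F' := fun s z => (∑ i, z i * pd i V (x₀ + s • z)) * η z)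
      (bound := fun z => (tsupport η).indicator (fun _ => C) z)
      (Metric.closedBall_mem_nhds s one_pos) (Eventually.of_forall fun t =>
        (hInt t).aestronglyMeasurable) (hInt s) ?_ ?_ ?_ ?_).2
    · exact (cB.comp (Continuous.prodMk_right s)).aestronglyMeasurable
    · refine Eventually.of_forall fun z t ht => ?_
      by_cases hz : z ∈ tsupport η
      · rw [Set.indicator_of_mem hz]; exact hC (t, z) ⟨ht, hz⟩
      · rw [Set.indicator_of_notMem hz, image_eq_zero_of_notMem_tsupport hz]; simp
    · rw [integrable_indicator_iff (isClosed_tsupport η).measurableSet]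
      exact integrableOn_const (μ := volume) hηc.measure_lt_top.ne
    · refine Eventually.of_forall fun z t _ => ?_
      have h1 : HasDerivAt (fun t : ℝ => x₀ + t • z) z t := by
        simpa using ((hasDerivAt_id t).smul_const z).const_add x₀
      have h2 := ((hV1.differentiable (by norm_num)) (x₀ + t • z)).hasFDerivAt.comp_hasDerivAt t h1
      rw [fderiv_eq_sum] at h2
      exact h2.mul_const _
  have hBs : ∀ s, 0 ≤ s → -(K * (∫ z, θ z) / 6 * s) ≤ B s := by
    intro s hs
    have hW1 : ∀ i, ContDiff ℝ 1 fun z => pd i V (x₀ + s • z) := fun i =>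
      (contDiff_one_pd i hV).comp (contDiff_const.add (contDiff_id.const_smul s))
    have hX : ∀ i, ContDiff ℝ 1 (fun z => pd i V (x₀ + s • z) * θ z) := fun i => (hW1 i).mul hθ1
    have h0 := integral_divergence_eq_zero hX fun i => hθc.mul_left
    have e : ∀ z, ∑ i, pd i (fun z => pd i V (x₀ + s • z) * θ z) z
        = s * (lapl V (x₀ + s • z) * θ z)
          - 6 * ((∑ i, z i * pd i V (x₀ + s • z)) * η z) := by
      intro z
      rw [lapl_eq, Finset.sum_mul, Finset.sum_mul, Finset.mul_sum, Finset.mul_sum,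
        ← Finset.sum_sub_distrib]
      refine Finset.sum_congr rfl fun i _ => ?_
      rw [pd_mul i ((hW1 i).differentiable (by norm_num) z) (hθ1.differentiable (by norm_num) z),
        hpθ, pd_comp_affine i x₀ s z ((contDiff_one_pd i hV).differentiable (by norm_num))]
      ring
    have I1 : Integrable fun z => s * (lapl V (x₀ + s • z) * θ z) :=
      (Continuous.integrable_of_hasCompactSupport (by fun_prop) hθc.mul_left).const_mul s
    have I2 : Integrable fun z => 6 * ((∑ i, z i * pd i V (x₀ + s • z)) * η z) :=
      (Continuous.integrable_of_hasCompactSupport (cB.comp (Continuous.prodMk_right s))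
        hηc.mul_left).const_mul 6
    simp only [e] at h0
    rw [integral_sub I1 I2, integral_const_mul, integral_const_mul] at h0
    have h3 : -K * ∫ z, θ z ≤ ∫ z, lapl V (x₀ + s • z) * θ z := by
      rw [← integral_const_mul]
      refine integral_mono ((cθ.integrable_of_hasCompactSupport hθc).const_mul _)
        (Continuous.integrable_of_hasCompactSupport (by fun_prop) hθc.mul_left) fun z => ?_
      exact mul_le_mul_of_nonneg_right (hK _) (hθ0 z)
    have h4 := mul_le_mul_of_nonneg_left h3 hs
    have h5 : B s = s * (∫ z, lapl V (x₀ + s • z) * θ z) / 6 := by rw [hB]; linarith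
    rw [h5]; linarith
  set D : ℝ → ℝ := fun s => A s + K * (∫ z, θ z) * s ^ 2 / 12 with hD
  have hDd : ∀ s, HasDerivAt D (B s + K * (∫ z, θ z) / 6 * s) s := by
    intro s
    have := (hder s).add (((hasDerivAt_pow 2 s).const_mul (K * (∫ z, θ z))).div_const 12)
    refine this.congr_deriv ?_
    norm_num; ring
  have hmono : MonotoneOn D (Set.Ici 0) := by
    refine monotoneOn_of_deriv_nonneg (convex_Ici 0)
      (fun s _ => (hDd s).continuousAt.continuousWithinAt)
      (fun s _ => (hDd s).differentiableAt.differentiableWithinAt) fun s hs => ?_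
    rw [interior_Ici] at hs
    rw [(hDd s).deriv]
    linarith [hBs s (le_of_lt hs)]
  have := hmono (Set.mem_Ici.2 le_rfl) (Set.mem_Ici.2 hr) hr
  simp only [hD, hA, zero_smul, add_zero] at this
  rw [integral_const_mul] at this
  simpa using this

end

section

variable {n : ℕ}

/-- The maximum principle on sets where the negative part has small support. -/
lemma exists_max_principle_of_small_measure {L : ℝ} (hL : 0 ≤ L) :
    ∃ τ : ℝ, 0 < τ ∧ ∀ (S : Set (Eu n)) (w : Eu n → ℝ), IsOpen S → Bornology.IsBounded S →
      ContinuousOn w (closure S) → (∀ x ∈ S, ContDiffAt ℝ 2 w x) →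
      (∀ x ∈ S, lapl w x ≤ L * |w x|) → (∀ x ∈ frontier S, 0 ≤ w x) →
      volume {x | x ∈ S ∧ w x < 0} ≤ ENNReal.ofReal τ → ∀ x ∈ S, 0 ≤ w x := by
  set E : ℝ := ∫ z : Eu n, max (1 - qreg 0 0 z) 0 ^ 2 with hE
  set T : ℝ := ∫ z : Eu n, max (1 - qreg 0 0 z) 0 ^ 3 with hT
  have cq : Continuous fun z : Eu n => qreg 0 0 z :=
    contDiff_qreg.continuous
  have cη : Continuous fun z : Eu n => max (1 - qreg 0 0 z) 0 ^ 2 := by fun_prop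
  have hηle : ∀ z : Eu n, max (1 - qreg 0 0 z) 0 ^ 2 ≤ 1 := by
    intro z
    have : 0 ≤ qreg 0 0 z := by rw [qreg]; positivity
    exact pow_le_one₀ (le_max_right _ _) (max_le (by linarith) zero_le_one)
  have hE0 : 0 < E := by
    refine cη.integral_pos_of_hasCompactSupport_nonneg_nonzero (hasCompactSupport_max_pow 0)
      (fun z => by positivity) (x := 0) ?_
    simp [qreg]
  have hT0 : 0 ≤ T := integral_nonneg fun z => by positivity
  set r : ℝ := Real.sqrt (E / (L * T + 1)) with hr
  have hLT : 0 ≤ L * T := mul_nonneg hL hT0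
  have hr0 : 0 < r := Real.sqrt_pos.2 (by positivity)
  have hr2 : L * T * r ^ 2 ≤ E := by
    rw [hr, Real.sq_sqrt (by positivity), mul_div_assoc', div_le_iff₀ (by linarith)]
    nlinarith
  refine ⟨r ^ n * E / 4, by positivity, fun S w hS hSb hwc hw hLw hfr hvol => ?_⟩
  have key : ∀ ε > 0, ∀ x ∈ S, -(2 * ε) ≤ w x := by
    intro ε hε
    classical
    set V : Eu n → ℝ := fun x => if x ∈ S then max (-w x - ε) 0 ^ 3 else 0 with hVdef
    have hV0 : ∀ x, 0 ≤ V x := fun x => by simp only [hVdef]; split_ifs <;> positivity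
    have hVS : ∀ x ∈ S, V =ᶠ[nhds x] fun y => max (-w y - ε) 0 ^ 3 := by
      intro x hx
      filter_upwards [hS.mem_nhds hx] with y hy
      simp [hVdef, hy]
    have hVo : ∀ x ∉ S, V =ᶠ[nhds x] fun _ => 0 := by
      intro x hx
      by_cases hxc : x ∈ closure S
      · have hxf : x ∈ frontier S := ⟨hxc, by rwa [hS.interior_eq]⟩
        have h1 : ∀ᶠ y in nhdsWithin x (closure S), -ε < w y :=
          (hwc x hxc).eventually (lt_mem_nhds (by linarith [hfr x hxf]))
        filter_upwards [eventually_nhdsWithin_iff.1 h1] with y hy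
        by_cases hyS : y ∈ S
        · have := hy (subset_closure hyS)
          simp only [hVdef, hyS, if_true]
          rw [max_eq_right (by linarith)]; norm_num
        · simp [hVdef, hyS]
      · filter_upwards [isClosed_closure.isOpen_compl.mem_nhds hxc] with y hy
        have : y ∉ S := fun h => hy (subset_closure h)
        simp [hVdef, this]
    have hw' : ∀ x ∈ S, ContDiffAt ℝ 2 (fun y => -w y - ε) x := fun x hx =>
      (hw x hx).neg.sub contDiffAt_const
    have hVC : ContDiff ℝ 2 V := by
      rw [contDiff_iff_contDiffAt]
      intro x
      by_cases hx : x ∈ S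
      · exact ((contDiff_two_max_zero_pow 0).contDiffAt.comp x (hw' x hx)).congr_of_eventuallyEq
          (hVS x hx)
      · exact contDiffAt_const.congr_of_eventuallyEq (hVo x hx)
    have hVc : HasCompactSupport V := by
      refine HasCompactSupport.of_support_subset_isCompact hSb.isCompact_closure fun x hx => ?_
      by_contra h
      have : x ∉ S := fun h' => h (subset_closure h')
      exact hx (by simp [hVdef, this])
    obtain ⟨x₀, hx₀⟩ := hVC.continuous.exists_forall_ge_of_hasCompactSupport hVc
    by_cases hx₀' : x₀ ∈ S ∧ 0 < -w x₀ - ε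
    · obtain ⟨hx₀S, hm⟩ := hx₀'
      set m := -w x₀ - ε with hmdef
      have hVx₀ : V x₀ = m ^ 3 := by
        simp only [hVdef, hx₀S, if_true, ← hmdef]; rw [max_eq_left hm.le]
      have hle : ∀ x ∈ S, max (-w x - ε) 0 ≤ m := by
        intro x hx
        have := hx₀ x
        rw [hVx₀] at this
        simp only [hVdef, hx, if_true] at this
        exact (pow_le_pow_iff_left₀ (le_max_right _ _) hm.le (by norm_num)).1 this
      have hlap : ∀ x, -(3 * L * m ^ 2 * (m + ε)) ≤ lapl V x := by
        intro x
        by_cases hx : x ∈ S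
        · rw [lapl_congr (hVS x hx), lapl_comp (contDiff_two_max_zero_pow 0) (hw' x hx)]
          have e1 : deriv (fun s : ℝ => max s 0 ^ 3) = fun s => 3 * max s 0 ^ 2 := by
            funext t; simpa using (hasDerivAt_max_zero_pow 1 t).deriv
          have e2 : deriv (fun s : ℝ => 3 * max s 0 ^ 2) = fun s => 3 * (2 * max s 0) := by
            funext t; simpa using ((hasDerivAt_max_zero_pow 0 t).const_mul 3).deriv
          simp only [zero_add]
          rw [e1, e2]
          have e3 : lapl (fun y => -w y - ε) x = -lapl w x := by
            have hd : ∀ᶠ y in nhds x, DifferentiableAt ℝ w y := by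
              filter_upwards [(hw x hx).eventually (by simp)] with y hy
                using hy.differentiableAt (by norm_num)
            rw [lapl_eq, lapl_eq, ← Finset.sum_neg_distrib]
            refine Finset.sum_congr rfl fun i _ => ?_
            have : pd i (fun y => -w y - ε) =ᶠ[nhds x] fun y => (-1) * pd i w y := by
              filter_upwards [hd] with y hy
              rw [pd_sub i (u := fun y => -w y) hy.fun_neg (differentiableAt_const _), pd_const]
              have := pd_const_mul i (-1) hy
              simp only [neg_mul, one_mul] at this
              rw [this]; ring
            rw [pd_congr i this, pd_const_mul i (-1)
              ((contDiffAt_pd i (k := 1) (hw x hx) (by norm_num)).differentiableAt (by norm_num))]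
            ring
          rw [e3]
          have h1 : 0 ≤ 3 * (2 * max (-w x - ε) 0) * gsq (fun y => -w y - ε) x :=
            mul_nonneg (by positivity) (gsq_nonneg _ _)
          have h2 : 3 * max (-w x - ε) 0 ^ 2 * lapl w x ≤ 3 * L * m ^ 2 * (m + ε) := by
            rcases le_or_gt (-w x - ε) 0 with hneg | hpos
            · rw [max_eq_right hneg]
              have : 0 ≤ 3 * L * m ^ 2 * (m + ε) := by positivity
              linarith
            · have h3 := hle x hx
              rw [max_eq_left hpos.le] at h3 ⊢
              have h4 : |w x| ≤ m + ε := by rw [abs_of_neg (by linarith)]; linarith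
              have h5 : lapl w x ≤ L * (m + ε) :=
                (hLw x hx).trans (mul_le_mul_of_nonneg_left h4 hL)
              have h6 : (-w x - ε) ^ 2 ≤ m ^ 2 := pow_le_pow_left₀ hpos.le h3 2
              calc 3 * (-w x - ε) ^ 2 * lapl w x ≤ 3 * (-w x - ε) ^ 2 * (L * (m + ε)) :=
                    mul_le_mul_of_nonneg_left h5 (by positivity)
                _ ≤ 3 * m ^ 2 * (L * (m + ε)) :=
                    mul_le_mul_of_nonneg_right (by linarith) (by positivity)
                _ = _ := by ring
          linarith
        · rw [lapl_congr (hVo x hx), lapl_eq]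
          have : 0 ≤ 3 * L * m ^ 2 * (m + ε) := by positivity
          have e : ∀ i, pd i (pd i fun _ : Eu n => (0 : ℝ)) x = 0 := fun i => by
            rw [show pd i (fun _ : Eu n => (0 : ℝ)) = fun _ => 0 from funext fun y => pd_const i 0,
              pd_const]
          simp only [e, Finset.sum_const_zero]; linarith
      have hmv := mul_integral_le_of_neg_le_lapl hVC hlap x₀ hr0.le
      rw [← hE, ← hT, hVx₀] at hmv
      have hInt : ∫ z, V (x₀ + r • z) * max (1 - qreg 0 0 z) 0 ^ 2 ≤ m ^ 3 * (E / 4) := by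
        have hVi : Integrable V := hVC.continuous.integrable_of_hasCompactSupport hVc
        have hVi2 : Integrable fun z => V (x₀ + r • z) :=
          (hVi.comp_add_left x₀).comp_smul hr0.ne'
        have s1 : ∫ z, V (x₀ + r • z) * max (1 - qreg 0 0 z) 0 ^ 2 ≤ ∫ z, V (x₀ + r • z) := by
          refine integral_mono_of_nonneg (Eventually.of_forall fun z =>
            mul_nonneg (hV0 _) (by positivity)) hVi2 (Eventually.of_forall fun z => ?_)
          exact mul_le_of_le_one_right (hV0 _) (hηle z)
        have s2 : ∫ z, V (x₀ + r • z) = (r ^ n)⁻¹ * ∫ z, V z := by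
          rw [Measure.integral_comp_smul volume (fun z => V (x₀ + z)) r,
            integral_add_left_eq_self V x₀, abs_of_pos (by positivity), smul_eq_mul]
          simp
        have s3 : ∫ z, V z ≤ m ^ 3 * (r ^ n * E / 4) := by
          have hB : MeasurableSet {x | V x ≠ 0} :=
            (isOpen_ne_fun hVC.continuous continuous_const).measurableSet
          have hsub : {x | V x ≠ 0} ⊆ {x | x ∈ S ∧ w x < 0} := by
            intro x hx
            by_cases hxS : x ∈ S
            · refine ⟨hxS, ?_⟩
              by_contra hneg
              apply hx
              simp only [hVdef, hxS, if_true]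
              rw [max_eq_right (by linarith)]; norm_num
            · exact absurd (by simp [hVdef, hxS]) hx
          have hv : volume {x | V x ≠ 0} ≤ ENNReal.ofReal (r ^ n * E / 4) :=
            (measure_mono hsub).trans hvol
          have hvf : volume {x | V x ≠ 0} ≠ ⊤ := (hv.trans_lt ENNReal.ofReal_lt_top).ne
          rw [← setIntegral_eq_integral_of_forall_compl_eq_zero (s := {x | V x ≠ 0})
            fun x hx => by simpa using hx]
          calc ∫ x in {x | V x ≠ 0}, V x ≤ ∫ x in {x | V x ≠ 0}, m ^ 3 := by
                refine setIntegral_mono_on hVi.integrableOn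
                  (integrableOn_const (μ := volume) hvf) hB fun x _ => ?_
                rw [← hVx₀]; exact hx₀ x
            _ = m ^ 3 * (volume {x | V x ≠ 0}).toReal := by
                rw [setIntegral_const, smul_eq_mul, mul_comm]; rfl
            _ ≤ _ := by
                refine mul_le_mul_of_nonneg_left ?_ (by positivity)
                exact ENNReal.toReal_le_of_le_ofReal (by positivity) hv
        calc _ ≤ _ := s1
          _ = _ := s2
          _ ≤ (r ^ n)⁻¹ * (m ^ 3 * (r ^ n * E / 4)) :=
              mul_le_mul_of_nonneg_left s3 (by positivity)
          _ = _ := by field_simp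
      have hm2 : m ^ 3 * E ≤ m ^ 3 * (E / 4) + m ^ 2 * (m + ε) * (E / 4) := by
        have := mul_le_mul_of_nonneg_left hr2 (by positivity : 0 ≤ m ^ 2 * (m + ε))
        linarith
      have hm3 : m ≤ ε / 2 := by
        have h : 0 < m ^ 2 * E := by positivity
        by_contra hlt
        push Not at hlt
        have := mul_lt_mul_of_pos_left hlt h
        linarith
      intro x hx
      have := hle x hx
      linarith [le_max_left (-w x - ε) 0]
    · intro x hx
      have h0 : V x₀ = 0 := by
        by_cases h : x₀ ∈ S
        · have : -w x₀ - ε ≤ 0 := by by_contra h'; exact hx₀' ⟨h, by linarith⟩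
          simp only [hVdef, h, if_true]; rw [max_eq_right this]; norm_num
        · simp [hVdef, h]
      have h1 := hx₀ x
      rw [h0] at h1
      simp only [hVdef, hx, if_true] at h1
      by_contra hlt
      have : 0 < -w x - ε := by linarith
      rw [max_eq_left this.le] at h1
      have := pow_pos this 3
      linarith
  intro x hx
  by_contra hlt
  push Not at hlt
  have := key (-w x / 4) (by linarith) x hx
  linarith

end

section

variable {n : ℕ} {u v w : Eu n → ℝ} {x : Eu n}

lemma eventually_differentiableAt (hu : ContDiffAt ℝ 2 u x) :
    ∀ᶠ y in nhds x, DifferentiableAt ℝ u y := by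
  filter_upwards [hu.eventually (by simp)] with y hy using hy.differentiableAt (by norm_num)

lemma differentiableAt_pd (i : Fin n) (hu : ContDiffAt ℝ 2 u x) : DifferentiableAt ℝ (pd i u) x :=
  (contDiffAt_pd i (k := 1) hu (by norm_num)).differentiableAt (by norm_num)

lemma lapl_sub (hu : ContDiffAt ℝ 2 u x) (hv : ContDiffAt ℝ 2 v x) :
    lapl (fun y => u y - v y) x = lapl u x - lapl v x := by
  simp only [lapl_eq]
  rw [← Finset.sum_sub_distrib]
  refine Finset.sum_congr rfl fun i _ => ?_
  have : pd i (fun y => u y - v y) =ᶠ[nhds x] fun y => pd i u y - pd i v y := by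
    filter_upwards [eventually_differentiableAt hu, eventually_differentiableAt hv] with y h1 h2
      using pd_sub i h1 h2
  rw [pd_congr i this, pd_sub i (differentiableAt_pd i hu) (differentiableAt_pd i hv)]

lemma lapl_const_mul (c : ℝ) (hu : ContDiffAt ℝ 2 u x) :
    lapl (fun y => c * u y) x = c * lapl u x := by
  simp only [lapl_eq]
  rw [Finset.mul_sum]
  refine Finset.sum_congr rfl fun i _ => ?_
  have : pd i (fun y => c * u y) =ᶠ[nhds x] fun y => c * pd i u y := by
    filter_upwards [eventually_differentiableAt hu] with y h1 using pd_const_mul i c h1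
  rw [pd_congr i this, pd_const_mul i c (differentiableAt_pd i hu)]

lemma deriv_line (i : Fin n) (t : ℝ)
    (hu : DifferentiableAt ℝ u (x + t • EuclideanSpace.single i (1 : ℝ))) :
    deriv (fun t : ℝ => u (x + t • EuclideanSpace.single i (1 : ℝ))) t
      = pd i u (x + t • EuclideanSpace.single i (1 : ℝ)) := by
  have h1 : HasDerivAt (fun t : ℝ => x + t • EuclideanSpace.single i (1 : ℝ))
      (EuclideanSpace.single i (1 : ℝ)) t := by
    simpa using ((hasDerivAt_id t).smul_const (EuclideanSpace.single i (1 : ℝ))).const_add x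
  exact (hu.hasFDerivAt.comp_hasDerivAt t h1).deriv

lemma lapl_nonneg_of_isLocalMin (hu : ContDiffAt ℝ 2 u x) (hmin : IsLocalMin u x) :
    0 ≤ lapl u x := by
  rw [lapl_eq]
  refine Finset.sum_nonneg fun i _ => ?_
  set e : Eu n := EuclideanSpace.single i (1 : ℝ) with he
  set φ : ℝ → ℝ := fun t => u (x + t • e) with hφ
  have c0 : ContinuousAt (fun t : ℝ => x + t • e) 0 := by fun_prop
  have e0 : x + (0 : ℝ) • e = x := by simp
  have ht : Tendsto (fun t : ℝ => x + t • e) (nhds 0) (nhds x) := by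
    have := c0.tendsto; rwa [e0] at this
  have hd : deriv φ =ᶠ[nhds 0] fun t => pd i u (x + t • e) := by
    filter_upwards [ht.eventually (eventually_differentiableAt hu)] with t hy
      using deriv_line i t hy
  have hdd : deriv (deriv φ) 0 = pd i (pd i u) x := by
    rw [hd.deriv_eq]
    have h := differentiableAt_pd i hu
    rw [← e0] at h
    rw [deriv_line i 0 h, ← he, e0]
  rw [← hdd]
  by_contra hneg
  push Not at hneg
  have hm : IsLocalMin φ 0 := by
    have h := ht.eventually hmin
    simpa [IsLocalMin, IsMinFilter, hφ] using h
  have hM : IsLocalMax φ 0 := by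
    refine isLocalMax_of_deriv_deriv_neg hneg hm.deriv_eq_zero ?_
    have := hu.continuousAt
    rw [← e0] at this
    exact ContinuousAt.comp (f := fun t : ℝ => x + t • e) this c0
  have hc : φ =ᶠ[nhds 0] fun _ => φ 0 := by
    filter_upwards [hm, hM] with t h1 h2 using le_antisymm h2 h1
  have h1 : deriv φ =ᶠ[nhds 0] fun _ => 0 := by
    filter_upwards [eventually_eventually_nhds.2 hc] with t h
    have : φ =ᶠ[nhds t] fun _ => φ 0 := h
    rw [this.deriv_eq, deriv_const]
  rw [h1.deriv_eq, deriv_const] at hneg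
  exact lt_irrefl _ hneg

/-- Hopf's lemma in contrapositive form. -/
lemma false_of_touching_ball {L : ℝ} (hL : 0 < L) {x₁ y : Eu n} {r : ℝ} (hr : 0 < r)
    (hry : 2 * r ≤ ‖x₁ - y‖)
    (hw : ∀ x ∈ Metric.closedBall x₁ r, ContDiffAt ℝ 2 w x)
    (hw0 : ∀ x ∈ Metric.closedBall x₁ r, 0 ≤ w x)
    (hLw : ∀ x ∈ Metric.closedBall x₁ r, lapl w x ≤ L * w x) (h1 : w x₁ = 0)
    (hpos : ∀ x ∈ Metric.closedBall x₁ r, ‖x - y‖ ≤ ‖x₁ - y‖ → x ≠ x₁ → 0 < w x) : False := by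
  set R := ‖x₁ - y‖ with hR
  have hR0 : 0 < R := by linarith
  set α : ℝ := (2 * n + L) / R ^ 2 + 1 with hα
  have hα1 : 1 ≤ α := by rw [hα]; linarith [show 0 ≤ (2 * n + L) / R ^ 2 by positivity]
  have hαR : 2 * n + L ≤ α * R ^ 2 := by
    rw [hα, add_mul, div_mul_cancel₀ _ (by positivity)]; nlinarith
  set q : Eu n → ℝ := qreg 0 y with hq
  have hqx : ∀ x, q x = ‖x - y‖ ^ 2 := fun x => by
    rw [hq, qreg, sum_sq_eq_norm_sub_sq]; ring
  have hqC : ContDiff ℝ 2 q := contDiff_qreg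
  set g : ℝ → ℝ := fun t => Real.exp (-α * t) - Real.exp (-α * R ^ 2) with hg
  have hgC : ContDiff ℝ 2 g := by fun_prop
  have hg1 : deriv g = fun t => -α * Real.exp (-α * t) := by
    funext t
    have h := (((hasDerivAt_id t).const_mul (-α)).exp).sub_const (Real.exp (-α * R ^ 2))
    simp only [id, mul_one] at h
    rw [hg, h.deriv]; ring
  have hg2 : deriv (deriv g) = fun t => α ^ 2 * Real.exp (-α * t) := by
    funext t
    rw [hg1]
    have h := (((hasDerivAt_id t).const_mul (-α)).exp).const_mul (-α)
    simp only [id, mul_one] at h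
    rw [h.deriv]; ring
  set v : Eu n → ℝ := fun x => g (q x) with hv
  have hvC : ContDiff ℝ 2 v := hgC.comp hqC
  have hpdq : ∀ i, pd i q = fun x => 2 * (x i - y i) := fun i => funext fun x => pd_qreg i x
  have hlq : ∀ x, lapl q x = 2 * n := by
    intro x
    rw [lapl_eq]
    have : ∀ i, pd i (pd i q) x = 2 := fun i => by
      rw [hpdq, pd_const_mul i 2 (by fun_prop), pd_sub_coord]; simp
    simp [this, mul_comm]
  have hgq : ∀ x, gsq q x = 4 * ‖x - y‖ ^ 2 := by
    intro x
    rw [gsq, ← sum_sq_eq_norm_sub_sq, Finset.mul_sum]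
    refine Finset.sum_congr rfl fun i _ => ?_
    rw [hpdq]; ring
  have hvL : ∀ x ∈ Metric.closedBall x₁ r, L * v x ≤ lapl v x := by
    intro x hx
    rw [hv, lapl_comp hgC hqC.contDiffAt, hlq, hgq, hg2, hg1]
    simp only [hg]
    set E := Real.exp (-α * q x)
    have hE : 0 < E := Real.exp_pos _
    have hE2 : 0 < Real.exp (-α * R ^ 2) := Real.exp_pos _
    have hn : R / 2 ≤ ‖x - y‖ := by
      rw [mem_closedBall_iff_norm] at hx
      have := norm_add_le (x₁ - x) (x - y)
      rw [sub_add_sub_cancel, norm_sub_rev x₁ x] at this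
      linarith
    have hn2 : R ^ 2 ≤ 4 * ‖x - y‖ ^ 2 := by
      have := pow_le_pow_left₀ (by positivity) hn 2
      linarith
    have h3 : L ≤ α ^ 2 * (4 * ‖x - y‖ ^ 2) - 2 * n * α := by
      have a1 : α ^ 2 * R ^ 2 ≤ α ^ 2 * (4 * ‖x - y‖ ^ 2) :=
        mul_le_mul_of_nonneg_left hn2 (by positivity)
      have a2 : α * (2 * n + L) ≤ α * (α * R ^ 2) := mul_le_mul_of_nonneg_left hαR (by linarith)
      have a3 : L ≤ α * L := le_mul_of_one_le_left hL.le hα1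
      linarith
    have h4 := mul_le_mul_of_nonneg_right h3 hE.le
    have h5 := mul_nonneg hL.le hE2.le
    linarith
  have hvle : ∀ x, v x ≤ 1 := fun x => by
    have a1 : Real.exp (-α * q x) ≤ 1 := by
      rw [Real.exp_le_one_iff, hqx]
      have : 0 ≤ α * ‖x - y‖ ^ 2 := by positivity
      linarith
    have a2 := Real.exp_pos (-α * R ^ 2)
    simp only [hv, hg]; linarith
  have hvneg : ∀ x, R ≤ ‖x - y‖ → v x ≤ 0 := fun x hx => by
    simp only [hv, hg, hqx, sub_nonpos, Real.exp_le_exp]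
    have := mul_le_mul_of_nonneg_left (pow_le_pow_left₀ hR0.le hx 2) (by linarith : 0 ≤ α)
    linarith
  have hwc : ContinuousOn w (Metric.closedBall x₁ r) := fun x hx =>
    (hw x hx).continuousAt.continuousWithinAt
  have hx₁m : x₁ ∈ Metric.closedBall x₁ r := Metric.mem_closedBall_self hr.le
  obtain ⟨ε, hε, hεw⟩ : ∃ ε > 0, ∀ x ∈ Metric.sphere x₁ r, ε * v x ≤ w x := by
    set K := Metric.sphere x₁ r ∩ Metric.closedBall y R with hK
    have hKc : IsCompact K := (isCompact_sphere _ _).inter_right Metric.isClosed_closedBall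
    have hKp : ∀ x ∈ K, 0 < w x := fun x hx => by
      refine hpos x (Metric.sphere_subset_closedBall hx.1) (mem_closedBall_iff_norm.1 hx.2) ?_
      rintro rfl
      have := hx.1
      rw [Metric.mem_sphere, dist_self] at this
      exact hr.ne this
    obtain ⟨c, hc, hcK⟩ : ∃ c > 0, ∀ x ∈ K, c ≤ w x := by
      rcases K.eq_empty_or_nonempty with he | hne
      · exact ⟨1, one_pos, by simp [he]⟩
      · obtain ⟨z, hz, hzm⟩ := hKc.exists_isMinOn hne
          (hwc.mono (Set.inter_subset_left.trans Metric.sphere_subset_closedBall))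
        exact ⟨w z, hKp z hz, fun x hx => hzm hx⟩
    refine ⟨c, hc, fun x hx => ?_⟩
    rcases le_total R ‖x - y‖ with h | h
    · have := mul_nonneg hc.le (neg_nonneg.2 (hvneg x h))
      linarith [hw0 x (Metric.sphere_subset_closedBall hx)]
    · have := hcK x ⟨hx, mem_closedBall_iff_norm.2 h⟩
      have := mul_le_mul_of_nonneg_left (hvle x) hc.le
      linarith
  set W : Eu n → ℝ := fun x => w x - ε * v x with hW
  have hεv : ∀ x, ContDiffAt ℝ 2 (fun x => ε * v x) x := fun x =>
    (contDiff_const.mul hvC).contDiffAt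
  have hWC : ∀ x ∈ Metric.closedBall x₁ r, ContDiffAt ℝ 2 W x := fun x hx =>
    (hw x hx).sub (hεv x)
  have hW0 : ∀ x ∈ Metric.closedBall x₁ r, 0 ≤ W x := by
    obtain ⟨z, hz, hzm⟩ := (isCompact_closedBall x₁ r).exists_isMinOn ⟨x₁, hx₁m⟩
      (fun x hx => (hWC x hx).continuousAt.continuousWithinAt : ContinuousOn W _)
    suffices 0 ≤ W z from fun x hx => this.trans (hzm hx)
    by_contra hneg
    push Not at hneg
    have hzs : z ∉ Metric.sphere x₁ r := fun h => by
      have := hεw z h; simp only [hW] at hneg; linarith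
    have hzb : z ∈ Metric.ball x₁ r := by
      rw [← Metric.ball_union_sphere] at hz
      exact hz.resolve_right hzs
    have hmin : IsLocalMin W z := by
      filter_upwards [Metric.isOpen_ball.mem_nhds hzb] with x hx
        using hzm (Metric.ball_subset_closedBall hx)
    have h2 := lapl_nonneg_of_isLocalMin (hWC z hz) hmin
    rw [hW, lapl_sub (hw z hz) (hεv z), lapl_const_mul ε hvC.contDiffAt] at h2
    have h3 := hLw z hz
    have h4 := mul_le_mul_of_nonneg_left (hvL z hz) hε.le
    have h5 : L * W z < 0 := mul_neg_of_pos_of_neg hL hneg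
    simp only [hW] at h5
    linarith
  have hv1 : v x₁ = 0 := by simp [hv, hg, hqx, ← hR]
  have hnb : Metric.closedBall x₁ r ∈ nhds x₁ := Metric.closedBall_mem_nhds _ hr
  have hm1 : IsLocalMin W x₁ := by
    filter_upwards [hnb] with x hx
    have : W x₁ = 0 := by simp [hW, h1, hv1]
    rw [this]; exact hW0 x hx
  have hm2 : IsLocalMin w x₁ := by
    filter_upwards [hnb] with x hx
    rw [h1]; exact hw0 x hx
  have hz : ∀ i, x₁ i - y i = 0 := by
    intro i
    have a1 : pd i W x₁ = 0 := by simp [pd, hm1.fderiv_eq_zero]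
    have a2 : pd i w x₁ = 0 := by simp [pd, hm2.fderiv_eq_zero]
    have dv : DifferentiableAt ℝ v x₁ := hvC.contDiffAt.differentiableAt (by norm_num)
    rw [hW, pd_sub i ((hw x₁ hx₁m).differentiableAt (by norm_num)) (dv.const_mul ε),
      pd_const_mul i ε dv, a2, hv,
      pd_comp i ((hgC.differentiable (by norm_num)) (q x₁)).hasDerivAt
        (hqC.contDiffAt.differentiableAt (by norm_num)), hg1, hpdq] at a1
    have := Real.exp_pos (-α * q x₁)
    have : ε * (α * Real.exp (-α * q x₁)) * (x₁ i - y i) = 0 := by linarith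
    rcases mul_eq_zero.1 this with h | h
    · exact absurd h (by positivity)
    · exact h
  have : ‖x₁ - y‖ ^ 2 = 0 := by rw [← sum_sq_eq_norm_sub_sq]; simp [hz]
  rw [← hR] at this
  exact hR0.ne' (pow_eq_zero_iff (by norm_num) |>.1 this)

/-- The strong maximum principle. -/
lemma eventually_eq_zero_of_lapl_le {L : ℝ} (hL : 0 ≤ L) {G : Set (Eu n)} (hG : IsOpen G)
    (hw : ∀ x ∈ G, ContDiffAt ℝ 2 w x) (hw0 : ∀ x ∈ G, 0 ≤ w x)
    (hLw : ∀ x ∈ G, lapl w x ≤ L * w x) {x₀ : Eu n} (hx₀ : x₀ ∈ G) (h0 : w x₀ = 0) :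
    ∀ᶠ x in nhds x₀, w x = 0 := by
  obtain ⟨δ, hδ, hδG⟩ := Metric.isOpen_iff.1 hG x₀ hx₀
  filter_upwards [Metric.ball_mem_nhds x₀ (by positivity : 0 < δ / 4)] with y hy
  by_contra hne
  have hsub : Metric.closedBall x₀ (δ / 2) ⊆ G :=
    (Metric.closedBall_subset_ball (by linarith)).trans hδG
  have hK : IsCompact (Metric.closedBall x₀ (δ / 2) ∩ w ⁻¹' {0}) := by
    refine (isCompact_closedBall x₀ (δ / 2)).of_isClosed_subset ?_ Set.inter_subset_left
    exact ContinuousOn.preimage_isClosed_of_isClosed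
      (fun x hx => (hw x (hsub hx)).continuousAt.continuousWithinAt)
      Metric.isClosed_closedBall isClosed_singleton
  obtain ⟨x₁, ⟨hx₁b, hx₁0⟩, hmin⟩ := hK.exists_isMinOn
    ⟨x₀, Metric.mem_closedBall_self (by positivity), h0⟩ (f := fun x => ‖x - y‖) (by fun_prop)
  have hx₁0 : w x₁ = 0 := hx₁0
  rw [mem_ball_iff_norm] at hy
  have hmin' : ∀ x ∈ Metric.closedBall x₀ (δ / 2), w x = 0 → ‖x₁ - y‖ ≤ ‖x - y‖ :=
    fun x hx hx0 => hmin ⟨hx, hx0⟩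
  have hR4 : ‖x₁ - y‖ < δ / 4 := by
    refine (hmin' x₀ (Metric.mem_closedBall_self (by positivity)) h0).trans_lt ?_
    rwa [norm_sub_rev]
  have hR0 : 0 < ‖x₁ - y‖ := norm_pos_iff.2 (sub_ne_zero.2 fun h => hne (h ▸ hx₁0))
  set b : Eu n := (1 / 2 : ℝ) • (x₁ - y) with hb
  have hbn : ‖b‖ = ‖x₁ - y‖ / 2 := by rw [hb, norm_smul]; norm_num; ring
  have hxy : x₁ - (y + b) = b := by rw [hb]; module
  have hG' : Metric.closedBall x₁ (‖x₁ - y‖ / 4) ⊆ G := fun x hx => by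
    refine hδG (mem_ball_iff_norm.2 ?_)
    have h1 := mem_closedBall_iff_norm.1 hx
    have h2 := mem_closedBall_iff_norm.1 hx₁b
    have h3 := norm_add_le (x - x₁) (x₁ - x₀)
    rw [sub_add_sub_cancel] at h3
    linarith
  refine false_of_touching_ball (L := L + 1) (by linarith) (x₁ := x₁) (y := y + b)
    (r := ‖x₁ - y‖ / 4) (by linarith) (by rw [hxy, hbn]; linarith) (fun x hx => hw x (hG' hx))
    (fun x hx => hw0 x (hG' hx))
    (fun x hx => (hLw x (hG' hx)).trans (by linarith [hw0 x (hG' hx)])) hx₁0 ?_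
  intro x hx hxy' hxne
  refine (hw0 x (hG' hx)).lt_of_ne' fun hx0 => hxne ?_
  rw [hxy, hbn] at hxy'
  have e1 : x - (y + b) + b = x - y := by abel
  have e2 : x - (y + b) - b = x - x₁ := by
    rw [← sub_eq_zero, hb]; module
  have h3 := norm_add_le (x - (y + b)) b
  rw [e1, hbn] at h3
  have h4 : x ∈ Metric.closedBall x₀ (δ / 2) := by
    rw [mem_closedBall_iff_norm]
    have := norm_add_le (x - y) (y - x₀)
    rw [sub_add_sub_cancel] at this
    linarith
  have h5 := hmin' x h4 hx0
  have h6 := parallelogram_law_with_norm ℝ (x - (y + b)) b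
  rw [e1, e2, hbn] at h6
  have h7 : ‖x - x₁‖ * ‖x - x₁‖ ≤ 0 := by
    have a1 := mul_self_le_mul_self hR0.le h5
    have a2 := mul_self_le_mul_self (norm_nonneg _) hxy'
    linarith
  have h8 : ‖x - x₁‖ = 0 := mul_self_eq_zero.1 (le_antisymm h7 (mul_self_nonneg _))
  exact sub_eq_zero.1 (norm_eq_zero.1 h8)

end

section

variable {n : ℕ}

/-- The method of moving hypersurfaces `{h = t}` with reflections `Φ t`. -/
lemma le_comp_of_moving {Ω : Set (Eu n)} (hΩ : IsOpen Ω) (hΩb : Bornology.IsBounded Ω)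
    {u h : Eu n → ℝ} {Φ : ℝ → Eu n → Eu n} {δ L : ℝ} (hL : 0 ≤ L) (hu : Continuous u)
    (hu0 : ∀ x ∈ frontier Ω, u x = 0) (hupos : ∀ x ∈ Ω, 0 < u x) (hh : Continuous h)
    (hhpos : ∀ x ∈ Ω, 0 < h x) (hhmin : ∀ x ∈ Ω, ¬ IsLocalMin h x)
    (hhnull : ∀ t, volume {x | x ∈ Ω ∧ h x = t} = 0)
    (hΦΩ : ∀ t ∈ Set.Ioc 0 δ, ∀ x ∈ closure Ω, h x < t → Φ t x ∈ Ω)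
    (hΦid : ∀ t ∈ Set.Ioc 0 δ, ∀ x ∈ closure Ω, h x = t → Φ t x = x)
    (hΦc : ContinuousOn (fun p : ℝ × Eu n => Φ p.1 p.2) (Set.Ioc 0 δ ×ˢ closure Ω))
    (hw : ∀ t ∈ Set.Ioc 0 δ, ∀ x ∈ Ω, h x < t → ContDiffAt ℝ 2 (fun y => u (Φ t y) - u y) x)
    (hLw : ∀ t ∈ Set.Ioc 0 δ, ∀ x ∈ Ω, h x < t →
      lapl (fun y => u (Φ t y) - u y) x ≤ L * |u (Φ t x) - u x|) :
    ∀ t ∈ Set.Ioc 0 δ, ∀ x ∈ Ω, h x < t → u x ≤ u (Φ t x) := by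
  set S : Set ℝ := {t | ∀ x ∈ Ω, h x < t → u x ≤ u (Φ t x)} with hS
  suffices hmain : Set.Icc 0 δ ⊆ S from fun t ht => hmain ⟨ht.1.le, ht.2⟩
  have hwc : ContinuousOn (fun p : ℝ × Eu n => u (Φ p.1 p.2) - u p.2)
      (Set.Ioc 0 δ ×ˢ closure Ω) := (hu.comp_continuousOn hΦc).sub
        (hu.comp continuous_snd).continuousOn
  have hwt : ∀ t ∈ Set.Ioc 0 δ, ContinuousOn (fun x => u (Φ t x) - u x) (closure Ω) :=
    fun t ht => hwc.comp (f := fun x : Eu n => (t, x)) (by fun_prop) fun x hx => ⟨ht, hx⟩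
  have hwx : ∀ x ∈ closure Ω, ContinuousOn (fun t => u (Φ t x) - u x) (Set.Ioc 0 δ) :=
    fun x hx => hwc.comp (f := fun t : ℝ => (t, x)) (by fun_prop) fun t ht => ⟨ht, hx⟩
  have hfr : ∀ t ∈ Set.Ioc 0 δ, ∀ x ∈ frontier Ω, h x < t → 0 < u (Φ t x) - u x := by
    intro t ht x hx hxt
    rw [hu0 x hx, sub_zero]
    exact hupos _ (hΦΩ t ht x (frontier_subset_closure hx) hxt)
  have hstrict : ∀ t ∈ Set.Ioc 0 δ, t ∈ S → ∀ x ∈ Ω, h x < t → 0 < u (Φ t x) - u x := by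
    intro t ht htS x hx hxt
    refine (sub_nonneg.2 (htS x hx hxt)).lt_of_ne' fun hx0 => ?_
    set G : Set (Eu n) := Ω ∩ {x | h x < t} with hG
    have hGo : IsOpen G := hΩ.inter (isOpen_lt hh continuous_const)
    have hsmp : ∀ z ∈ G, u (Φ t z) - u z = 0 → ∀ᶠ y in nhds z, u (Φ t y) - u y = 0 :=
      fun z hz hz0 => eventually_eq_zero_of_lapl_le hL hGo (fun x hx => hw t ht x hx.1 hx.2)
        (fun x hx => sub_nonneg.2 (htS x hx.1 hx.2))
        (fun x hx => (hLw t ht x hx.1 hx.2).trans_eq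
          (by rw [abs_of_nonneg (sub_nonneg.2 (htS x hx.1 hx.2))])) hz hz0
    have hK : IsCompact (closure (G ∩ {y | u (Φ t y) - u y = 0})) :=
      (hΩb.subset (Set.inter_subset_left.trans Set.inter_subset_left)).isCompact_closure
    obtain ⟨z, hz, hzm⟩ := hK.exists_isMinOn ⟨x, subset_closure ⟨⟨hx, hxt⟩, hx0⟩⟩ hh.continuousOn
    have hzΩ : z ∈ closure Ω :=
      closure_mono (Set.inter_subset_left.trans Set.inter_subset_left) hz
    have hzt : h z < t := (hzm (subset_closure ⟨⟨hx, hxt⟩, hx0⟩)).trans_lt hxt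
    have hz0 : u (Φ t z) - u z = 0 := by
      have hcl : IsClosed (closure Ω ∩ (fun y => u (Φ t y) - u y) ⁻¹' {0}) :=
        (hwt t ht).preimage_isClosed_of_isClosed isClosed_closure isClosed_singleton
      have hsub : G ∩ {y | u (Φ t y) - u y = 0} ⊆
          closure Ω ∩ (fun y => u (Φ t y) - u y) ⁻¹' {0} :=
        fun y hy => ⟨subset_closure hy.1.1, hy.2⟩
      exact (closure_minimal hsub hcl hz).2
    have hzin : z ∈ Ω := by
      by_contra hzn
      exact (hfr t ht z ⟨hzΩ, by rwa [hΩ.interior_eq]⟩ hzt).ne' hz0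
    refine hhmin z hzin ?_
    filter_upwards [hsmp z ⟨hzin, hzt⟩ hz0, hGo.mem_nhds ⟨hzin, hzt⟩] with y hy1 hy2
    exact hzm (subset_closure ⟨hy2, hy1⟩)
  refine IsClosed.Icc_subset_of_forall_exists_gt ?_ (fun x hx hx0 => absurd hx0 (hhpos x hx).not_gt)
    ?_
  · refine IsSeqClosed.isClosed fun s t hs hst => ?_
    have htI : t ∈ Set.Icc 0 δ := isClosed_Icc.mem_of_tendsto hst
      (Eventually.of_forall fun k => (hs k).2)
    refine ⟨fun x hx hxt => ?_, htI⟩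
    have ht : t ∈ Set.Ioc 0 δ := ⟨(hhpos x hx).trans hxt, htI.2⟩
    have hst' : Tendsto s atTop (nhdsWithin t (Set.Ioc 0 δ)) := by
      refine tendsto_nhdsWithin_iff.2 ⟨hst, ?_⟩
      filter_upwards [hst.eventually (lt_mem_nhds ht.1)] with k hk using ⟨hk, (hs k).2.2⟩
    have h1 := (hwx x (subset_closure hx) t ht).tendsto.comp hst'
    refine sub_nonneg.1 (ge_of_tendsto h1 ?_)
    filter_upwards [hst.eventually (lt_mem_nhds hxt)] with k hk
    exact sub_nonneg.2 ((hs k).1 x hx hk)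
  · rintro t ⟨htS, ht0, htδ⟩ b hb
    obtain ⟨τ, hτ, hmp⟩ := exists_max_principle_of_small_measure (n := n) hL
    set c := min b δ with hc
    have htc : t < c := lt_min hb htδ
    set s : ℕ → ℝ := fun k => t + (c - t) / (k + 1) with hs
    have hst : ∀ k, t < s k := fun k => by
      have : 0 < (c - t) / ((k : ℝ) + 1) := div_pos (sub_pos.2 htc) (by positivity)
      simp only [hs]; linarith
    have hsc : ∀ k, s k ≤ c := fun k => by
      have : (c - t) / ((k : ℝ) + 1) ≤ c - t :=
        div_le_self (sub_pos.2 htc).le (by linarith [k.cast_nonneg (α := ℝ)])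
      simp only [hs]; linarith
    have hsI : ∀ k, s k ∈ Set.Ioc 0 δ := fun k =>
      ⟨ht0.trans_lt (hst k), (hsc k).trans (min_le_right _ _)⟩
    have hlim : Tendsto s atTop (nhds t) := by
      have := ((tendsto_one_div_add_atTop_nhds_zero_nat (𝕜 := ℝ)).const_mul (c - t)).const_add t
      simpa [hs, div_eq_mul_inv] using this
    set B : ℕ → Set (Eu n) := fun k => {x | x ∈ Ω ∩ {x | h x < s k} ∧ u (Φ (s k) x) - u x < 0}
      with hB
    have hGo : ∀ k, IsOpen (Ω ∩ {x | h x < s k}) := fun k =>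
      hΩ.inter (isOpen_lt hh continuous_const)
    have hBo : ∀ k, MeasurableSet (B k) := fun k =>
      (((hwt _ (hsI k)).mono (Set.inter_subset_left.trans subset_closure)).isOpen_inter_preimage
        (hGo k) isOpen_Iio).measurableSet
    have hBlim : Tendsto (fun k => volume (B k)) atTop (nhds (volume (∅ : Set (Eu n)))) := by
      refine tendsto_measure_of_ae_tendsto_indicator atTop MeasurableSet.empty hBo
        hΩ.measurableSet hΩb.measure_lt_top.ne (Eventually.of_forall fun k x hx => hx.1.1) ?_
      have hae : ∀ᵐ x ∂(volume : Measure (Eu n)), ¬(x ∈ Ω ∧ h x = t) := by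
        rw [ae_iff]; simpa using hhnull t
      filter_upwards [hae] with x hx
      simp only [Set.mem_empty_iff_false, iff_false]
      by_cases hxΩ : x ∈ Ω
      · rcases lt_trichotomy (h x) t with hlt | heq | hgt
        · have ht : t ∈ Set.Ioc 0 δ := ⟨(hhpos x hxΩ).trans hlt, htδ.le⟩
          have hst' : Tendsto s atTop (nhdsWithin t (Set.Ioc 0 δ)) :=
            tendsto_nhdsWithin_iff.2 ⟨hlim, Eventually.of_forall hsI⟩
          have h1 := (hwx x (subset_closure hxΩ) t ht).tendsto.comp hst'
          filter_upwards [h1.eventually (lt_mem_nhds (hstrict t ht htS x hxΩ hlt))] with k hk hkB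
          exact lt_asymm hk hkB.2
        · exact absurd ⟨hxΩ, heq⟩ hx
        · filter_upwards [hlim.eventually (gt_mem_nhds hgt)] with k hk hkB
          exact lt_asymm hk hkB.1.2
      · exact Eventually.of_forall fun k hk => hxΩ hk.1.1
    rw [measure_empty] at hBlim
    obtain ⟨k, hk⟩ := (hBlim.eventually (gt_mem_nhds (ENNReal.ofReal_pos.2 hτ))).exists
    refine ⟨s k, fun x hx hxs => ?_, hst k, (hsc k).trans (min_le_left _ _)⟩
    have hcl : closure (Ω ∩ {x | h x < s k}) ⊆ closure Ω := closure_mono Set.inter_subset_left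
    refine sub_nonneg.1 (hmp (Ω ∩ {x | h x < s k}) (fun x => u (Φ (s k) x) - u x) (hGo k)
      (hΩb.subset Set.inter_subset_left) ((hwt _ (hsI k)).mono hcl)
      (fun x hx => hw _ (hsI k) x hx.1 hx.2) (fun x hx => hLw _ (hsI k) x hx.1 hx.2) ?_ hk.le x
      ⟨hx, hxs⟩)
    intro z hz
    have hzΩ := hcl (frontier_subset_closure hz)
    have hzle : h z ≤ s k := by
      have hsub : Ω ∩ {x | h x < s k} ⊆ {x | h x ≤ s k} := fun x hx => (show h x < s k from hx.2).le
      exact closure_minimal hsub (isClosed_le hh continuous_const) (frontier_subset_closure hz)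
    rcases hzle.lt_or_eq with hlt | heq
    · refine (hfr _ (hsI k) z ⟨hzΩ, ?_⟩ hlt).le
      rw [hΩ.interior_eq]
      intro hzin
      have := hz.2
      rw [(hGo k).interior_eq] at this
      exact this ⟨hzin, hlt⟩
    · simp only [hΦid _ (hsI k) z hzΩ heq, sub_self, le_refl]

end

section

variable {n : ℕ} {u : Eu n → ℝ} {x : Eu n} {Φ : Eu n → Eu n}

lemma pd_comp_map (i : Fin n) (hu : DifferentiableAt ℝ u (Φ x)) (hΦ : DifferentiableAt ℝ Φ x) :
    pd i (fun y => u (Φ y)) x = ∑ j, pd j u (Φ x) * pd i (fun y => Φ y j) x := by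
  have h1 := (hu.hasFDerivAt.comp x hΦ.hasFDerivAt).fderiv
  have h2 : ∀ j, pd i (fun y => Φ y j) x = fderiv ℝ Φ x (EuclideanSpace.single i 1) j := by
    intro j
    have := ((EuclideanSpace.proj j : Eu n →L[ℝ] ℝ).hasFDerivAt.comp x hΦ.hasFDerivAt).fderiv
    simp only [pd]
    rw [show (fun y => Φ y j) = (EuclideanSpace.proj j : Eu n →L[ℝ] ℝ) ∘ Φ from rfl, this]
    simp
  simp only [h2]
  simp only [pd]
  rw [show (fun y => u (Φ y)) = u ∘ Φ from rfl, h1, ContinuousLinearMap.comp_apply, fderiv_eq_sum]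
  exact Finset.sum_congr rfl fun j _ => mul_comm _ _

lemma contDiffAt_coord {m : WithTop ℕ∞} (j : Fin n) (hΦ : ContDiffAt ℝ m Φ x) :
    ContDiffAt ℝ m (fun y => Φ y j) x :=
  (EuclideanSpace.proj j : Eu n →L[ℝ] ℝ).contDiff.contDiffAt.comp x hΦ

/-- The Laplacian of a composition with a conformal map with harmonic components. -/
lemma lapl_comp_of_conformal (hu : ContDiff ℝ 2 u) (hΦ : ContDiffAt ℝ 2 Φ x) {J : ℝ}
    (hJ : ∀ j k, ∑ i, pd i (fun y => Φ y j) x * pd i (fun y => Φ y k) x = if j = k then J else 0)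
    (hh : ∀ j, lapl (fun y => Φ y j) x = 0) :
    lapl (fun y => u (Φ y)) x = J * lapl u (Φ x) := by
  have hc : ∀ᶠ y in nhds x, DifferentiableAt ℝ Φ y := by
    filter_upwards [hΦ.eventually (by simp)] with y hy using hy.differentiableAt (by norm_num)
  have hcx := hc.self_of_nhds
  have hd := hu.differentiable (by norm_num)
  have hd2 := fun j => (contDiff_one_pd j hu).differentiable (by norm_num)
  have key : ∀ i, pd i (pd i fun y => u (Φ y)) x
      = ∑ j, ((∑ k, pd k (pd j u) (Φ x) * pd i (fun y => Φ y k) x) * pd i (fun y => Φ y j) x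
        + pd j u (Φ x) * pd i (pd i fun y => Φ y j) x) := by
    intro i
    have h1 : (pd i fun y => u (Φ y)) =ᶠ[nhds x]
        fun y => ∑ j, pd j u (Φ y) * pd i (fun y => Φ y j) y := by
      filter_upwards [hc] with y hy using pd_comp_map i (hd _) hy
    have hp : ∀ j, DifferentiableAt ℝ (fun y => pd i (fun y => Φ y j) y) x := fun j =>
      differentiableAt_pd i (contDiffAt_coord j hΦ)
    have hq : ∀ j, DifferentiableAt ℝ (fun y => pd j u (Φ y)) x := fun j =>
      (hd2 j (Φ x)).comp x hcx
    rw [pd_congr i h1, pd_sum _ i fun j _ => (hq j).fun_mul (hp j)]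
    refine Finset.sum_congr rfl fun j _ => ?_
    rw [pd_mul i (hq j) (hp j), pd_comp_map i (hd2 j (Φ x)) hcx]
  rw [lapl_eq]
  simp only [key, Finset.sum_add_distrib]
  have e1 : ∑ i, ∑ j, pd j u (Φ x) * pd i (pd i fun y => Φ y j) x = 0 := by
    rw [Finset.sum_comm]
    refine Finset.sum_eq_zero fun j _ => ?_
    rw [← Finset.mul_sum, ← lapl_eq, hh, mul_zero]
  have e2 : ∑ i, ∑ j, (∑ k, pd k (pd j u) (Φ x) * pd i (fun y => Φ y k) x)
      * pd i (fun y => Φ y j) x = J * lapl u (Φ x) := by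
    rw [Finset.sum_comm, lapl_eq, Finset.mul_sum]
    refine Finset.sum_congr rfl fun j _ => ?_
    simp only [Finset.sum_mul]
    rw [Finset.sum_comm]
    simp only [mul_assoc, ← Finset.mul_sum, hJ]
    simp [mul_comm]
  rw [e1, e2, add_zero]

/-- Reflection across a hyperplane orthogonal to `e`. -/
def planeRefl (e : Eu n) (a : ℝ) (x : Eu n) : Eu n := x + (2 * (a - ∑ i, x i * e i)) • e

lemma continuous_planeRefl (e : Eu n) :
    Continuous fun p : ℝ × Eu n => planeRefl e p.1 p.2 := by
  unfold planeRefl; fun_prop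

lemma contDiff_planeRefl (e : Eu n) (a : ℝ) : ContDiff ℝ 2 (planeRefl e a) := by
  unfold planeRefl; fun_prop

lemma pd_planeRefl (e : Eu n) (a : ℝ) (i j : Fin n) :
    pd i (fun y => planeRefl e a y j) = fun _ => (if i = j then 1 else 0) - 2 * e i * e j := by
  funext x
  have e1 : (fun y => planeRefl e a y j) = fun y : Eu n => y j - (2 * e j) * (∑ i, y i * e i - a) := by
    funext y; simp [planeRefl]; ring
  have e2 : ∀ k, pd i (fun y : Eu n => y k * e k) x = if i = k then e k else 0 := by
    intro k
    rw [pd_mul i (by fun_prop) (by fun_prop), pd_coord, pd_const]; simp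
  rw [e1, pd_sub i (by fun_prop) (by fun_prop), pd_coord, pd_const_mul i _ (by fun_prop),
    pd_sub i (by fun_prop) (by fun_prop), pd_const, pd_sum _ i (by fun_prop)]
  simp [e2]; ring

lemma lapl_comp_planeRefl (hu : ContDiff ℝ 2 u) {e : Eu n} (he : ‖e‖ = 1) (a : ℝ) (x : Eu n) :
    lapl (fun y => u (planeRefl e a y)) x = lapl u (planeRefl e a x) := by
  rw [lapl_comp_of_conformal hu (contDiff_planeRefl e a).contDiffAt (J := 1), one_mul]
  · intro j k
    simp only [pd_planeRefl]
    have hs : ∑ i, e i ^ 2 = 1 := by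
      have := sum_sq_eq_norm_sub_sq 0 e; simpa [he] using this
    have : ∀ i, (((if i = j then 1 else 0) - 2 * e i * e j)
        * ((if i = k then 1 else 0) - 2 * e i * e k) : ℝ)
        = (if i = j then (if i = k then 1 else 0) else 0) - (if i = j then 2 * e i * e k else 0)
          - (if i = k then 2 * e i * e j else 0) + e i ^ 2 * (4 * e j * e k) := by
      intro i; split_ifs <;> ring
    simp only [this, Finset.sum_add_distrib, Finset.sum_sub_distrib, ← Finset.sum_mul, hs]
    simp; ring
  · intro j
    rw [lapl_eq]
    simp [pd_planeRefl, pd_const]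

/-- Inversion in a sphere with centre `p`. -/
def sphereRefl (p : Eu n) (s : ℝ) (x : Eu n) : Eu n := p + (s ^ 2 * (qreg 0 p x)⁻¹) • (x - p)

lemma qreg_zero (p x : Eu n) : qreg 0 p x = ‖x - p‖ ^ 2 := by
  rw [qreg, sum_sq_eq_norm_sub_sq]; ring

lemma contDiffAt_sphereRefl {p : Eu n} (s : ℝ) (hx : x ≠ p) :
    ContDiffAt ℝ 2 (sphereRefl p s) x := by
  have : qreg 0 p x ≠ 0 := by
    rw [qreg_zero]; exact pow_ne_zero _ (norm_ne_zero_iff.2 (sub_ne_zero.2 hx))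
  unfold sphereRefl
  exact contDiffAt_const.add ((contDiffAt_const.mul (contDiff_qreg.contDiffAt.inv this)).smul
    (contDiffAt_id.sub contDiffAt_const))

lemma pd_sphereRefl {p : Eu n} (s : ℝ) (i j : Fin n) (hx : x ≠ p) :
    pd i (fun y => sphereRefl p s y j) x = s ^ 2 * ((if i = j then (qreg 0 p x)⁻¹ else 0)
      - 2 * ((x i - p i) * (x j - p j)) * (qreg 0 p x)⁻¹ ^ 2) := by
  have hq : qreg 0 p x ≠ 0 := by
    rw [qreg_zero]; exact pow_ne_zero _ (norm_ne_zero_iff.2 (sub_ne_zero.2 hx))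
  have hqd : DifferentiableAt ℝ (qreg 0 p) x := contDiff_qreg.differentiable (by norm_num) x
  have hid : DifferentiableAt ℝ (fun y => (qreg 0 p y)⁻¹) x := hqd.inv hq
  have e1 : (fun y => sphereRefl p s y j)
      = fun y : Eu n => p j + s ^ 2 * ((qreg 0 p y)⁻¹ * (y j - p j)) := by
    funext y; simp [sphereRefl]; ring
  have hm : DifferentiableAt ℝ (fun y : Eu n => (qreg 0 p y)⁻¹ * (y j - p j)) x :=
    hid.mul (by fun_prop)
  rw [e1, pd_add i (by fun_prop) (hm.const_mul _), pd_const, pd_const_mul i _ hm,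
    pd_mul i hid (by fun_prop), pd_comp i (g := fun t => t⁻¹) (hasDerivAt_inv hq) hqd, pd_qreg,
    pd_sub_coord]
  split_ifs <;> field_simp <;> ring

lemma lapl_comp_sphereRefl {u : Eu 2 → ℝ} (hu : ContDiff ℝ 2 u) {p x : Eu 2} (s : ℝ)
    (hx : x ≠ p) :
    lapl (fun y => u (sphereRefl p s y)) x
      = (s ^ 2 * (qreg 0 p x)⁻¹) ^ 2 * lapl u (sphereRefl p s x) := by
  have hq : qreg 0 p x ≠ 0 := by
    rw [qreg_zero]; exact pow_ne_zero _ (norm_ne_zero_iff.2 (sub_ne_zero.2 hx))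
  have hqd : DifferentiableAt ℝ (qreg 0 p) x := contDiff_qreg.differentiable (by norm_num) x
  have hid : DifferentiableAt ℝ (fun y => (qreg 0 p y)⁻¹) x := hqd.inv hq
  have hqs : qreg 0 p x = (x 0 - p 0) ^ 2 + (x 1 - p 1) ^ 2 := by simp [qreg, Fin.sum_univ_two]
  rw [lapl_comp_of_conformal hu (contDiffAt_sphereRefl s hx)
    (J := (s ^ 2 * (qreg 0 p x)⁻¹) ^ 2)]
  · intro j k
    simp only [pd_sphereRefl s _ _ hx]
    rw [Fin.sum_univ_two]
    have hQ : (qreg 0 p x)⁻¹ ^ 2 * ((x 0 - p 0) ^ 2 + (x 1 - p 1) ^ 2) = (qreg 0 p x)⁻¹ := by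
      rw [← hqs]; field_simp
    set Q := (qreg 0 p x)⁻¹
    set a := x 0 - p 0
    set b := x 1 - p 1
    fin_cases j <;> fin_cases k <;> simp
    · linear_combination (4 * s ^ 4 * a ^ 2 * Q ^ 2) * hQ
    · linear_combination (4 * s ^ 4 * a * b * Q ^ 2) * hQ
    · linear_combination (4 * s ^ 4 * a * b * Q ^ 2) * hQ
    · linear_combination (4 * s ^ 4 * b ^ 2 * Q ^ 2) * hQ
  · intro j
    have hev : ∀ i, (pd i fun y => sphereRefl p s y j) =ᶠ[nhds x] fun y =>
        s ^ 2 * ((if i = j then (qreg 0 p y)⁻¹ else 0)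
          - 2 * ((y i - p i) * (y j - p j)) * ((qreg 0 p y)⁻¹ * (qreg 0 p y)⁻¹)) := by
      intro i
      filter_upwards [isOpen_ne.mem_nhds hx] with y hy
      rw [pd_sphereRefl s i j hy, pow_two (qreg 0 p y)⁻¹]
    have hsec : ∀ i, pd i (pd i fun y => sphereRefl p s y j) x = s ^ 2 *
        ((if i = j then -(2 * (x i - p i)) * (qreg 0 p x)⁻¹ ^ 2 else 0)
         - 2 * ((x j - p j) + (if i = j then (x i - p i) else 0)) * (qreg 0 p x)⁻¹ ^ 2
         + 8 * (x i - p i) ^ 2 * (x j - p j) * (qreg 0 p x)⁻¹ ^ 3) := by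
      intro i
      have hm : DifferentiableAt ℝ (fun y : Eu 2 => 2 * ((y i - p i) * (y j - p j))) x := by
        fun_prop
      have hif : DifferentiableAt ℝ (fun y => if i = j then (qreg 0 p y)⁻¹ else 0) x := by
        split_ifs
        · exact hid
        · fun_prop
      have hpi : pd i (fun y => (qreg 0 p y)⁻¹) x = -(2 * (x i - p i)) * (qreg 0 p x)⁻¹ ^ 2 := by
        rw [pd_comp i (g := fun t => t⁻¹) (hasDerivAt_inv hq) hqd, pd_qreg]; field_simp
      have hpif : pd i (fun y => if i = j then (qreg 0 p y)⁻¹ else 0) x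
          = if i = j then -(2 * (x i - p i)) * (qreg 0 p x)⁻¹ ^ 2 else 0 := by
        split_ifs
        · exact hpi
        · exact pd_const i 0
      rw [pd_congr i (hev i), pd_const_mul i _ (hif.fun_sub (hm.fun_mul (hid.fun_mul hid))),
        pd_sub i hif (hm.fun_mul (hid.fun_mul hid)), pd_mul i hm (hid.fun_mul hid), pd_mul i hid hid, hpi, hpif,
        pd_const_mul i _ (by fun_prop), pd_mul i (by fun_prop) (by fun_prop), pd_sub_coord,
        pd_sub_coord, if_pos (rfl : i = i)]
      by_cases h : i = j
      · subst h; simp only [if_true]; ring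
      · simp only [if_neg h]; ring
    rw [lapl_eq]
    simp only [hsec]
    rw [Fin.sum_univ_two]
    have hQ : (qreg 0 p x)⁻¹ ^ 3 * ((x 0 - p 0) ^ 2 + (x 1 - p 1) ^ 2) = (qreg 0 p x)⁻¹ ^ 2 := by
      rw [← hqs]; field_simp
    set Q := (qreg 0 p x)⁻¹
    set a := x 0 - p 0
    set b := x 1 - p 1
    fin_cases j <;> simp
    · linear_combination (8 * s ^ 2 * a) * hQ
    · linear_combination (8 * s ^ 2 * b) * hQ

end

section

variable {n : ℕ}

lemma exists_lipschitz_on_Icc {f : ℝ → ℝ} (hf : ContDiff ℝ 1 f) (M : ℝ) :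
    ∃ L : ℝ, 0 ≤ L ∧ ∀ a ∈ Set.Icc 0 M, ∀ b ∈ Set.Icc 0 M, |f b - f a| ≤ L * |b - a| := by
  obtain ⟨L, hL⟩ := (isCompact_Icc (a := (0 : ℝ)) (b := M)).exists_bound_of_continuousOn
    (hf.continuous_deriv le_rfl).continuousOn
  refine ⟨max L 0, le_max_right _ _, fun a ha b hb => ?_⟩
  exact (convex_Icc 0 M).norm_image_sub_le_of_norm_deriv_le
    (fun x _ => hf.differentiable (by norm_num) x)
    (fun x hx => (hL x hx).trans (le_max_left _ _)) ha hb

/-- The hypotheses on `u` in the moving methods. -/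
structure IsPosSol (Ω : Set (Eu n)) (f : ℝ → ℝ) (u : Eu n → ℝ) : Prop where
  contDiff : ContDiff ℝ 2 u
  hasCompactSupport : HasCompactSupport u
  eq_zero : ∀ x ∈ frontier Ω, u x = 0
  pos : ∀ x ∈ Ω, 0 < u x
  sol : ∀ x ∈ Ω, lapl u x + f (u x) = 0

variable {Ω : Set (Eu n)} {f : ℝ → ℝ} {u : Eu n → ℝ}

lemma IsPosSol.exists_lipschitz (hu : IsPosSol Ω f u) (hf : ContDiff ℝ 1 f) :
    ∃ L : ℝ, 0 ≤ L ∧ ∀ x ∈ Ω, ∀ y ∈ Ω, |f (u y) - f (u x)| ≤ L * |u y - u x| := by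
  obtain ⟨M, hM⟩ := hu.hasCompactSupport.exists_bound_of_continuous hu.contDiff.continuous
  obtain ⟨L, hL, h⟩ := exists_lipschitz_on_Icc hf M
  exact ⟨L, hL, fun x hx y hy => h _ ⟨(hu.pos x hx).le, (le_abs_self _).trans (hM x)⟩ _
    ⟨(hu.pos y hy).le, (le_abs_self _).trans (hM y)⟩⟩

lemma volume_hyperplane {e : Eu n} (he : ‖e‖ = 1) (a : ℝ) :
    volume {x : Eu n | ∑ i, x i * e i = a} = 0 := by
  have hs : ∑ i, e i * e i = 1 := by
    have := sum_sq_eq_norm_sub_sq 0 e; simpa [he, pow_two] using this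
  let ℓ : Eu n →ₗ[ℝ] ℝ := ∑ i, (e i) • (EuclideanSpace.proj i : Eu n →L[ℝ] ℝ).toLinearMap
  have hℓ : ∀ x, ℓ x = ∑ i, x i * e i := fun x => by simp [ℓ, mul_comm]
  have hk : ℓ.ker ≠ ⊤ := fun h => by
    have : e ∈ ℓ.ker := h ▸ Submodule.mem_top
    rw [LinearMap.mem_ker, hℓ, hs] at this
    exact one_ne_zero this
  have : {x : Eu n | ∑ i, x i * e i = a} = (fun x => x + -(a • e)) ⁻¹' (ℓ.ker : Set (Eu n)) := by
    ext x
    rw [Set.mem_ofPred_eq, Set.mem_preimage, SetLike.mem_coe, LinearMap.mem_ker, map_add, map_neg,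
      map_smul, hℓ, hℓ, hs]
    simp only [smul_eq_mul, mul_one]
    constructor <;> intro h <;> linarith
  rw [this, measure_preimage_add_right]
  exact Measure.addHaar_submodule volume _ hk

/-- Monotonicity by moving planes. -/
lemma IsPosSol.le_planeRefl (hu : IsPosSol Ω f u) (hΩ : IsOpen Ω) (hΩb : Bornology.IsBounded Ω)
    (hf : ContDiff ℝ 1 f) {e : Eu n} (he : ‖e‖ = 1) {c δ : ℝ}
    (hc : ∀ x ∈ Ω, ∑ i, x i * e i < c)
    (hcap : ∀ t ∈ Set.Ioc 0 δ, ∀ x ∈ closure Ω, c - ∑ i, x i * e i < t →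
      planeRefl e (c - t) x ∈ Ω) :
    ∀ t ∈ Set.Ioc 0 δ, ∀ x ∈ Ω, c - ∑ i, x i * e i < t → u x ≤ u (planeRefl e (c - t) x) := by
  obtain ⟨L, hL, hLf⟩ := hu.exists_lipschitz hf
  have hΦC : ∀ t, ContDiff ℝ 2 fun y => u (planeRefl e (c - t) y) := fun t =>
    hu.contDiff.comp (contDiff_planeRefl e (c - t))
  have hsp : ∀ x : Eu n, ∀ i, pd i (fun x : Eu n => c - ∑ i, x i * e i) x = -e i := by
    intro x i
    have : ∀ k, pd i (fun y : Eu n => y k * e k) x = if i = k then e k else 0 := by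
      intro k
      rw [pd_mul i (by fun_prop) (by fun_prop), pd_coord, pd_const]; simp
    rw [pd_sub i (by fun_prop) (by fun_prop), pd_const, pd_sum _ i (by fun_prop)]
    simp [this]
  refine le_comp_of_moving (h := fun x => c - ∑ i, x i * e i)
    (Φ := fun t x => planeRefl e (c - t) x) hΩ hΩb hL hu.contDiff.continuous hu.eq_zero hu.pos
    (by fun_prop) (fun x hx => sub_pos.2 (hc x hx)) ?_ ?_ hcap ?_ ?_ ?_ ?_
  · intro x _ hmin
    have h0 : ∀ i, e i = 0 := fun i => by
      have h1 := hsp x i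
      rw [pd, hmin.fderiv_eq_zero] at h1
      simpa using h1.symm
    have : e = 0 := by ext i; simp [h0]
    rw [this, norm_zero] at he
    exact zero_ne_one he
  · intro t
    refine measure_mono_null (fun x hx => ?_) (volume_hyperplane he (c - t))
    have := hx.2
    simp only [Set.mem_ofPred_eq] at this ⊢
    linarith
  · intro t _ x _ hx
    simp only [planeRefl]
    rw [show c - t - ∑ i, x i * e i = 0 by linarith]; simp
  · exact ((continuous_planeRefl e).comp (f := fun p : ℝ × Eu n => (c - p.1, p.2))
      (by fun_prop)).continuousOn
  · exact fun t _ x _ _ => ((hΦC t).sub hu.contDiff).contDiffAt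
  · intro t ht x hx hxt
    have hm := hcap t ht x (subset_closure hx) hxt
    rw [lapl_sub (hΦC t).contDiffAt hu.contDiff.contDiffAt, lapl_comp_planeRefl hu.contDiff he]
    have h1 := hu.sol x hx
    have h2 := hu.sol _ hm
    have h3 := neg_abs_le (f (u (planeRefl e (c - t) x)) - f (u x))
    have h4 := hLf x hx _ hm
    linarith

/-- Monotonicity by moving spheres, in the plane. -/
lemma IsPosSol.le_sphereRefl {Ω : Set (Eu 2)} {u : Eu 2 → ℝ} (hu : IsPosSol Ω f u) (hΩ : IsOpen Ω)
    (hΩb : Bornology.IsBounded Ω) (hf : ContDiff ℝ 1 f) (hf0 : ∀ s, 0 ≤ s → 0 ≤ f s) {p : Eu 2}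
    {R δ : ℝ} (hR : 0 < R) (hc : ∀ x ∈ Ω, R < ‖x - p‖)
    (hcap : ∀ t ∈ Set.Ioc 0 δ, ∀ x ∈ closure Ω, ‖x - p‖ - R < t → sphereRefl p (R + t) x ∈ Ω) :
    ∀ t ∈ Set.Ioc 0 δ, ∀ x ∈ Ω, ‖x - p‖ - R < t → u x ≤ u (sphereRefl p (R + t) x) := by
  obtain ⟨L, hL, hLf⟩ := hu.exists_lipschitz hf
  have hcl : IsClosed {y : Eu 2 | R ≤ ‖y - p‖} := isClosed_le continuous_const (by fun_prop)
  have hcc : ∀ x ∈ closure Ω, R ≤ ‖x - p‖ := fun x hx =>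
    closure_minimal (fun y hy => (hc y hy).le : Ω ⊆ {y | R ≤ ‖y - p‖}) hcl hx
  have hne : ∀ x ∈ closure Ω, x ≠ p := fun x hx h => by
    have := hcc x hx
    rw [h, sub_self, norm_zero] at this
    linarith
  have hΦC : ∀ t, ∀ x ∈ closure Ω, ContDiffAt ℝ 2 (fun y => u (sphereRefl p (R + t) y)) x :=
    fun t x hx => hu.contDiff.contDiffAt.comp x (contDiffAt_sphereRefl (R + t) (hne x hx))
  refine le_comp_of_moving (h := fun x => ‖x - p‖ - R)
    (Φ := fun t x => sphereRefl p (R + t) x) hΩ hΩb hL hu.contDiff.continuous hu.eq_zero hu.pos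
    (by fun_prop) (fun x hx => sub_pos.2 (hc x hx)) ?_ ?_ hcap ?_ ?_ ?_ ?_
  · intro x hx hmin
    have hmin2 : IsLocalMin (qreg 0 p) x := by
      filter_upwards [hmin] with y hy
      rw [qreg_zero, qreg_zero]
      exact pow_le_pow_left₀ (norm_nonneg _) (by linarith) 2
    refine hne x (subset_closure hx) ?_
    ext i
    have h1 := pd_qreg (e := 0) (y := p) i x
    rw [pd, hmin2.fderiv_eq_zero] at h1
    simp only [zero_apply] at h1
    linarith
  · intro t
    rcases eq_or_ne (R + t) 0 with h | h
    · have : {x | x ∈ Ω ∧ ‖x - p‖ - R = t} = ∅ := by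
        ext x
        simp only [Set.mem_ofPred_eq, Set.mem_empty_iff_false, iff_false, not_and]
        intro hx hxt
        have := hc x hx
        linarith
      rw [this, measure_empty]
    · refine measure_mono_null (fun x hx => ?_) (Measure.addHaar_sphere_of_ne_zero volume p h)
      rw [mem_sphere_iff_norm]
      linarith [hx.2]
  · intro t ht x hx hxt
    have h0 : ‖x - p‖ = R + t := by linarith
    have h1 : (R + t) ^ 2 ≠ 0 := pow_ne_zero _ (by linarith [ht.1])
    simp only [sphereRefl]
    rw [qreg_zero, h0, mul_inv_cancel₀ h1, one_smul, add_sub_cancel]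
  · have hA : ContinuousOn (fun q : ℝ × Eu 2 => (qreg 0 p q.2)⁻¹) {q | q.2 ≠ p} := by
      refine ContinuousOn.inv₀ (contDiff_qreg.continuous.comp continuous_snd).continuousOn ?_
      rintro ⟨t, x⟩ hx
      rw [qreg_zero]
      exact pow_ne_zero _ (norm_ne_zero_iff.2 (sub_ne_zero.2 hx))
    have hB : ContinuousOn (fun q : ℝ × Eu 2 =>
        p + ((R + q.1) ^ 2 * (qreg 0 p q.2)⁻¹) • (q.2 - p)) {q | q.2 ≠ p} :=
      continuousOn_const.add (ContinuousOn.smul (ContinuousOn.mul (by fun_prop) hA) (by fun_prop))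
    exact hB.mono fun q hq => hne q.2 hq.2
  · exact fun t _ x hx _ => (hΦC t x (subset_closure hx)).sub hu.contDiff.contDiffAt
  · intro t ht x hx hxt
    have hm := hcap t ht x (subset_closure hx) hxt
    rw [lapl_sub (hΦC t x (subset_closure hx)) hu.contDiff.contDiffAt,
      lapl_comp_sphereRefl hu.contDiff _ (hne x (subset_closure hx))]
    have h1 := hu.sol x hx
    have h2 := hu.sol _ hm
    have h3 := neg_abs_le (f (u (sphereRefl p (R + t) x)) - f (u x))
    have h4 := hLf x hx _ hm
    have hJ : 1 ≤ ((R + t) ^ 2 * (qreg 0 p x)⁻¹) ^ 2 := by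
      refine one_le_pow₀ ?_
      have hp : 0 < ‖x - p‖ := norm_pos_iff.2 (sub_ne_zero.2 (hne x (subset_closure hx)))
      rw [qreg_zero, ← div_eq_mul_inv, one_le_div (by positivity)]
      exact pow_le_pow_left₀ hp.le (by linarith) 2
    have h5 := mul_le_mul_of_nonneg_right hJ (hf0 _ (hu.pos _ hm).le)
    have h6 : lapl u (sphereRefl p (R + t) x) = -f (u (sphereRefl p (R + t) x)) := by linarith
    rw [h6]
    linarith

end

section

variable {n : ℕ} {Ω : Set (Eu n)} {ρ : Eu n → ℝ}

lemma nonpos_of_mem_closure (hρ : Continuous ρ) (hΩ : Ω = {x | ρ x < 0}) {x : Eu n}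
    (hx : x ∈ closure Ω) : ρ x ≤ 0 := by
  have hcl : IsClosed {y : Eu n | ρ y ≤ 0} := isClosed_le hρ continuous_const
  refine closure_minimal (fun y hy => ?_ : Ω ⊆ {y : Eu n | ρ y ≤ 0}) hcl hx
  rw [hΩ] at hy
  exact (show ρ y < 0 from hy).le

/-- Points of the closure move into the domain along directions close to an inward one. -/
lemma eventually_add_smul_mem (hρ : ContDiff ℝ 2 ρ) (hΩ : Ω = {x | ρ x < 0}) {x v : Eu n}
    (hv : fderiv ℝ ρ x v < 0) :
    ∀ᶠ a : Eu n × Eu n × ℝ in nhds (x, v, 0),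
      a.1 ∈ closure Ω → 0 < a.2.2 → a.1 + a.2.2 • a.2.1 ∈ Ω := by
  have hc : Continuous fun p : Eu n × Eu n => fderiv ℝ ρ p.1 p.2 :=
    hρ.continuous_fderiv_apply (by norm_num)
  have h1 : ∀ᶠ p : Eu n × Eu n in nhds (x, v), fderiv ℝ ρ p.1 p.2 < 0 :=
    hc.continuousAt.eventually_lt continuousAt_const hv
  obtain ⟨ε, hε, h2⟩ := Metric.eventually_nhds_iff_ball.1 h1
  have e1 : ∀ᶠ a : Eu n × Eu n × ℝ in nhds (x, v, 0), ‖a.1 - x‖ < ε / 2 :=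
    ContinuousAt.eventually_lt (by fun_prop) continuousAt_const (by simpa using half_pos hε)
  have e2 : ∀ᶠ a : Eu n × Eu n × ℝ in nhds (x, v, 0), ‖a.2.1 - v‖ < ε :=
    ContinuousAt.eventually_lt (by fun_prop) continuousAt_const (by simpa using hε)
  have e3 : ∀ᶠ a : Eu n × Eu n × ℝ in nhds (x, v, 0), a.2.2 * ‖a.2.1‖ < ε / 2 :=
    ContinuousAt.eventually_lt (by fun_prop) continuousAt_const (by simpa using half_pos hε)
  filter_upwards [e1, e2, e3]
  rintro ⟨y, w, l⟩ hy hw hl hyc hl0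
  simp only at hy hw hl hyc hl0 ⊢
  have hd : ∀ s : ℝ, HasDerivAt (fun s : ℝ => ρ (y + s • w)) (fderiv ℝ ρ (y + s • w) w) s := by
    intro s
    have h3 : HasDerivAt (fun s : ℝ => y + s • w) w s := by
      simpa using ((hasDerivAt_id s).smul_const w).const_add y
    exact ((hρ.differentiable (by norm_num) _).hasFDerivAt.comp_hasDerivAt s h3)
  obtain ⟨c, hc, hcs⟩ := exists_hasDerivAt_eq_slope (fun s : ℝ => ρ (y + s • w)) _ hl0
    (fun s _ => (hd s).continuousAt.continuousWithinAt) (fun s _ => hd s)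
  have h4 : fderiv ℝ ρ (y + c • w) w < 0 := by
    refine h2 (y + c • w, w) ?_
    rw [Metric.mem_ball, Prod.dist_eq, max_lt_iff, dist_eq_norm, dist_eq_norm]
    refine ⟨?_, hw⟩
    calc ‖y + c • w - x‖ = ‖(y - x) + c • w‖ := by congr 1; abel
      _ ≤ ‖y - x‖ + ‖c • w‖ := norm_add_le _ _
      _ = ‖y - x‖ + c * ‖w‖ := by rw [norm_smul, Real.norm_of_nonneg hc.1.le]
      _ < ε := by
        have := mul_le_mul_of_nonneg_right hc.2.le (norm_nonneg w)
        linarith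
  rw [hcs] at h4
  have h5 := nonpos_of_mem_closure hρ.continuous hΩ hyc
  rw [hΩ, Set.mem_ofPred_eq]
  rw [div_neg_iff] at h4
  simp only [zero_smul, add_zero, sub_zero] at h4
  rcases h4 with h4 | h4 <;> linarith

lemma fderiv_neg_of_quadratic_support (hρ : ContDiff ℝ 2 ρ) (hΩ : Ω = {x | ρ x < 0}) {x v : Eu n}
    (hx : x ∈ closure Ω) (hg : gradient ρ x ≠ 0) (hv : v ≠ 0) {C : ℝ}
    (h : ∀ y ∈ Ω, -C * ‖y - x‖ ^ 2 ≤ inner ℝ (y - x) v) : fderiv ℝ ρ x v < 0 := by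
  by_contra! hcon
  rw [← inner_gradient_left] at hcon
  set w := gradient ρ x with hw
  have hd : fderiv ℝ ρ x (-v - w) < 0 := by
    rw [← inner_gradient_left, ← hw, inner_sub_right, inner_neg_right, real_inner_self_eq_norm_sq]
    have := norm_pos_iff.2 hg
    nlinarith
  have hin : inner ℝ (-v - w) v < 0 := by
    rw [inner_sub_left, inner_neg_left, real_inner_self_eq_norm_sq]
    have := norm_pos_iff.2 hv
    nlinarith
  have ht : Tendsto (fun t : ℝ => (x, -v - w, t)) (nhdsWithin 0 (Set.Ioi 0))
      (nhds (x, -v - w, 0)) :=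
    (Continuous.tendsto (f := fun t : ℝ => (x, -v - w, t)) (by fun_prop) 0).mono_left
      nhdsWithin_le_nhds
  have e1 := ht.eventually (eventually_add_smul_mem hρ hΩ hd)
  have e2 : ∀ᶠ t : ℝ in nhdsWithin 0 (Set.Ioi 0),
      inner ℝ (-v - w) v < -C * (t * ‖-v - w‖ ^ 2) :=
    (ContinuousAt.eventually_lt (f := fun _ : ℝ => inner ℝ (-v - w) v)
      (g := fun t : ℝ => -C * (t * ‖-v - w‖ ^ 2)) (x₀ := 0) (by fun_prop) (by fun_prop)
      (by simpa using hin)).filter_mono nhdsWithin_le_nhds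
  obtain ⟨t, h1, h2, h3⟩ := (e1.and (e2.and self_mem_nhdsWithin)).exists
  have ht0 : 0 < t := h3
  have h4 := h _ (h1 hx ht0)
  simp only [add_sub_cancel_left] at h4
  rw [norm_smul, inner_smul_left, Real.norm_of_nonneg ht0.le] at h4
  simp only [conj_trivial] at h4
  have h5 := mul_lt_mul_of_pos_left h2 ht0
  linarith

/-- A sequential form of the inward motion of points close to a supporting direction. -/
lemma eventually_moved_mem (hρ : ContDiff ℝ 2 ρ) (hΩ : Ω = {x | ρ x < 0}) (hΩo : IsOpen Ω)
    (hg : ∀ x ∈ frontier Ω, gradient ρ x ≠ 0) {x v : Eu n} (hv : v ≠ 0)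
    (hx : x ∈ closure Ω) {C : ℝ} (h : ∀ y ∈ Ω, -C * ‖y - x‖ ^ 2 ≤ inner ℝ (y - x) v)
    {xs vs : ℕ → Eu n} {ls : ℕ → ℝ} (hxs : Tendsto xs atTop (nhds x))
    (hvs : Tendsto vs atTop (nhds v)) (hls : Tendsto ls atTop (nhds 0))
    (hxc : ∀ k, xs k ∈ closure Ω) (hl0 : ∀ k, 0 < ls k) :
    ∀ᶠ k in atTop, xs k + ls k • vs k ∈ Ω := by
  by_cases hxo : x ∈ Ω
  · have := hxs.add (hls.smul hvs)
    rw [zero_smul, add_zero] at this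
    exact this.eventually (hΩo.mem_nhds hxo)
  · have hxf : x ∈ frontier Ω := ⟨hx, by rwa [hΩo.interior_eq]⟩
    have := (hxs.prodMk_nhds (hvs.prodMk_nhds hls)).eventually
      (eventually_add_smul_mem hρ hΩ (fderiv_neg_of_quadratic_support hρ hΩ hx (hg x hxf) hv h))
    filter_upwards [this] with k hk using hk (hxc k) (hl0 k)

/-- Caps cut by planes close to supporting ones reflect into the domain. -/
lemma exists_planeRefl_mem (hρ : ContDiff ℝ 2 ρ) (hΩ : Ω = {x | ρ x < 0}) (hΩo : IsOpen Ω)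
    (hΩb : Bornology.IsBounded Ω) (hg : ∀ x ∈ frontier Ω, gradient ρ x ≠ 0) :
    ∃ δ > 0, ∀ e : Eu n, ‖e‖ = 1 → ∀ c : ℝ, (∀ y ∈ Ω, ∑ i, y i * e i < c) →
      ∀ t ∈ Set.Ioc 0 δ, ∀ x ∈ closure Ω, c - ∑ i, x i * e i < t → planeRefl e (c - t) x ∈ Ω := by
  have hin : ∀ y e : Eu n, ∑ i, y i * e i = inner ℝ y e := fun y e => by
    simp [PiLp.inner_apply, mul_comm]
  by_contra! hcon
  choose es he cs hcs ts hts xs hxs hxt hxn using fun k : ℕ =>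
    hcon (1 / ((k : ℝ) + 1)) (by positivity)
  have hcpt : IsCompact (Metric.sphere (0 : Eu n) 1 ×ˢ closure Ω) :=
    (isCompact_sphere _ _).prod hΩb.isCompact_closure
  obtain ⟨⟨e, x⟩, hex, φ, hφ, hlim⟩ := hcpt.tendsto_subseq (x := fun k => (es k, xs k))
    (fun k => ⟨by simp [he k], hxs k⟩)
  have hle : Tendsto (fun k => es (φ k)) atTop (nhds e) :=
    (Continuous.tendsto continuous_fst _).comp hlim
  have hlx : Tendsto (fun k => xs (φ k)) atTop (nhds x) :=
    (Continuous.tendsto continuous_snd _).comp hlim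
  have hinv : Tendsto (fun k => 1 / ((φ k : ℝ) + 1)) atTop (nhds 0) :=
    tendsto_one_div_add_atTop_nhds_zero_nat.comp hφ.tendsto_atTop
  have hcc : ∀ k, ∀ y ∈ closure Ω, inner ℝ y (es k) ≤ cs k := by
    intro k y hy
    have hcl : IsClosed {y : Eu n | inner ℝ y (es k) ≤ cs k} :=
      isClosed_le (by fun_prop) continuous_const
    refine closure_minimal (fun z hz => ?_ : Ω ⊆ {y : Eu n | inner ℝ y (es k) ≤ cs k}) hcl hy
    have := hcs k z hz
    rw [hin] at this
    exact this.le
  simp only [hin] at hxt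
  have hls : Tendsto (fun k => 2 * (ts (φ k) - (cs (φ k) - inner ℝ (xs (φ k)) (es (φ k)))))
      atTop (nhds 0) := by
    refine squeeze_zero (g := fun k => 2 * (1 / ((φ k : ℝ) + 1))) (fun k => ?_) (fun k => ?_)
      (by simpa using hinv.const_mul 2)
    · linarith [hxt (φ k)]
    · linarith [(hts (φ k)).2, hcc (φ k) _ (hxs (φ k))]
  have hsup : ∀ y ∈ Ω, inner ℝ y e ≤ inner ℝ x e := by
    intro y hy
    have h1 : Tendsto (fun k => inner ℝ y (es (φ k)) - 1 / ((φ k : ℝ) + 1)) atTop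
        (nhds (inner ℝ y e - 0)) := (tendsto_const_nhds.inner hle).sub hinv
    have h2 : Tendsto (fun k => inner ℝ (xs (φ k)) (es (φ k))) atTop (nhds (inner ℝ x e)) :=
      hlx.inner hle
    have := le_of_tendsto_of_tendsto' h1 h2 (fun k => by
      linarith [hcc (φ k) y (subset_closure hy), hxt (φ k), (hts (φ k)).2])
    linarith
  have he0 : ‖e‖ = 1 := by simpa using hex.1
  obtain ⟨k, hk⟩ := (eventually_moved_mem hρ hΩ hΩo hg (v := -e) (C := 0)
    (neg_ne_zero.2 (norm_ne_zero_iff.1 (by rw [he0]; exact one_ne_zero))) hex.2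
    (fun y hy => by
      rw [inner_neg_right, inner_sub_left]
      linarith [hsup y hy]) hlx hle.neg hls (fun k => hxs _)
    (fun k => by linarith [hxt (φ k)])).exists
  refine hxn (φ k) ?_
  convert hk using 1
  simp only [planeRefl, hin]
  rw [smul_neg, ← neg_smul]
  congr 2
  ring

/-- Caps cut by spheres close to exterior touching ones reflect into the domain. -/
lemma exists_sphereRefl_mem (hρ : ContDiff ℝ 2 ρ) (hΩ : Ω = {x | ρ x < 0}) (hΩo : IsOpen Ω)
    (hΩb : Bornology.IsBounded Ω) (hg : ∀ x ∈ frontier Ω, gradient ρ x ≠ 0) {r : ℝ} (hr : 0 < r)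
    (B : ℝ) :
    ∃ δ > 0, ∀ p : Eu n, ‖p‖ ≤ B → ∀ R, r ≤ R → (∀ y ∈ Ω, R < ‖y - p‖) →
      ∀ t ∈ Set.Ioc 0 δ, ∀ x ∈ closure Ω, ‖x - p‖ - R < t → sphereRefl p (R + t) x ∈ Ω := by
  by_contra! hcon
  choose ps hp Rs hR hRs ts hts xs hxs hxt hxn using fun k : ℕ =>
    hcon (1 / ((k : ℝ) + 1)) (by positivity)
  have hcpt : IsCompact (Metric.closedBall (0 : Eu n) B ×ˢ closure Ω) :=
    (isCompact_closedBall _ _).prod hΩb.isCompact_closure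
  obtain ⟨⟨p, x⟩, hpx, φ, hφ, hlim⟩ := hcpt.tendsto_subseq (x := fun k => (ps k, xs k))
    (fun k => ⟨by simpa using hp k, hxs k⟩)
  have hlp : Tendsto (fun k => ps (φ k)) atTop (nhds p) :=
    (Continuous.tendsto continuous_fst _).comp hlim
  have hlx : Tendsto (fun k => xs (φ k)) atTop (nhds x) :=
    (Continuous.tendsto continuous_snd _).comp hlim
  have hinv : Tendsto (fun k => 1 / ((φ k : ℝ) + 1)) atTop (nhds 0) :=
    tendsto_one_div_add_atTop_nhds_zero_nat.comp hφ.tendsto_atTop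
  have hcc : ∀ k, ∀ y ∈ closure Ω, Rs k ≤ ‖y - ps k‖ := by
    intro k y hy
    have hcl : IsClosed {y : Eu n | Rs k ≤ ‖y - ps k‖} :=
      isClosed_le continuous_const (by fun_prop)
    exact closure_minimal (fun z hz => (hRs k z hz).le : Ω ⊆ {y : Eu n | Rs k ≤ ‖y - ps k‖}) hcl hy
  have hpos : ∀ k, 0 < ‖xs k - ps k‖ := fun k => by linarith [hcc k _ (hxs k), hR k]
  have hl2 : ∀ k, ‖xs k - ps k‖ < Rs k + ts k := fun k => by linarith [hxt k]
  have hlpos : ∀ k, 0 < (Rs k + ts k) ^ 2 * (‖xs k - ps k‖ ^ 2)⁻¹ - 1 := fun k => by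
    rw [← div_eq_mul_inv, sub_pos, one_lt_div (pow_pos (hpos k) 2)]
    exact pow_lt_pow_left₀ (hl2 k) (hpos k).le (by norm_num)
  have hls : Tendsto (fun k => (Rs (φ k) + ts (φ k)) ^ 2 * (‖xs (φ k) - ps (φ k)‖ ^ 2)⁻¹ - 1)
      atTop (nhds 0) := by
    refine squeeze_zero (g := fun k => (1 + 1 / ((φ k : ℝ) + 1) * r⁻¹) ^ 2 - 1)
      (fun k => (hlpos _).le) (fun k => ?_) ?_
    · rw [← inv_pow, ← mul_pow]
      gcongr
      · exact mul_nonneg (by linarith [hpos (φ k), hl2 (φ k)]) (by positivity)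
      · rw [← div_eq_mul_inv, div_le_iff₀ (hpos _)]
        have h1 := (hts (φ k)).2
        have h2 := hcc (φ k) _ (hxs (φ k))
        have h3 : r ≤ ‖xs (φ k) - ps (φ k)‖ := (hR _).trans h2
        have h4 : (1 : ℝ) ≤ r⁻¹ * ‖xs (φ k) - ps (φ k)‖ := by
          rw [← div_eq_inv_mul, one_le_div hr]; exact h3
        have h5 : (0 : ℝ) < 1 / ((φ k : ℝ) + 1) := by positivity
        nlinarith
    · have := (((hinv.mul_const r⁻¹).const_add 1).pow 2).sub_const 1
      simpa using this
  have hsup : ∀ y ∈ Ω, ‖x - p‖ ≤ ‖y - p‖ := by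
    intro y hy
    have h1 : Tendsto (fun k => ‖xs (φ k) - ps (φ k)‖ - 1 / ((φ k : ℝ) + 1)) atTop
        (nhds (‖x - p‖ - 0)) := (hlx.sub hlp).norm.sub hinv
    have h2 : Tendsto (fun k => ‖y - ps (φ k)‖) atTop (nhds ‖y - p‖) :=
      (hlp.const_sub y).norm
    have := le_of_tendsto_of_tendsto' h1 h2 (fun k => by
      linarith [hRs (φ k) y hy, hxt (φ k), (hts (φ k)).2])
    linarith
  have hxp : r ≤ ‖x - p‖ :=
    ge_of_tendsto' (hlx.sub hlp).norm (fun k => (hR _).trans (hcc _ _ (hxs _)))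
  obtain ⟨k, hk⟩ := (eventually_moved_mem hρ hΩ hΩo hg (v := x - p) (C := 1 / 2)
    (norm_ne_zero_iff.1 (by linarith)) hpx.2
    (fun y hy => by
      have h1 := norm_add_sq_real (y - x) (x - p)
      rw [sub_add_sub_cancel] at h1
      have h2 := pow_le_pow_left₀ (norm_nonneg _) (hsup y hy) 2
      linarith) hlx (hlx.sub hlp) hls (fun k => hxs _) (fun k => hlpos _)).exists
  refine hxn (φ k) ?_
  convert hk using 1
  simp only [sphereRefl, qreg_zero]
  rw [sub_smul, one_smul]
  abel

end

section

variable {n : ℕ} {Ω : Set (Eu n)} {ρ : Eu n → ℝ}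

lemma exists_exterior_ball (hρ : ContDiff ℝ 2 ρ) (hΩ : Ω = {x | ρ x < 0})
    (hΩb : Bornology.IsBounded Ω) (hfr : frontier Ω = {x | ρ x = 0})
    (hg : ∀ x ∈ frontier Ω, gradient ρ x ≠ 0) :
    ∃ r > 0, ∀ q ∈ frontier Ω, ∃ p : Eu n, ‖q - p‖ = 2 * r ∧ ∀ y ∈ Ω, 2 * r ≤ ‖y - p‖ := by
  have hng : ∀ x, ‖gradient ρ x‖ = ‖fderiv ℝ ρ x‖ := fun x => by simp [gradient]
  have hcf : IsCompact (frontier Ω) :=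
    hΩb.isCompact_closure.of_isClosed_subset isClosed_frontier frontier_subset_closure
  obtain ⟨m, hm, hmg⟩ := hcf.exists_forall_le' (f := fun x => ‖gradient ρ x‖) (a := 0)
    (by simp only [hng]; exact (hρ.continuous_fderiv (by norm_num)).norm.continuousOn)
    (fun x hx => norm_pos_iff.2 (hg x hx))
  obtain ⟨B, hB⟩ := hΩb.closure.subset_closedBall 0
  obtain ⟨K, hK⟩ := (hρ.fderiv_right (m := 1) (by norm_num)).contDiffOn.exists_lipschitzOnWith
    (by norm_num) (convex_closedBall (0 : Eu n) B) (isCompact_closedBall _ _)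
  refine ⟨m / (4 * (K + 1)), by positivity, fun q hq => ?_⟩
  set r := m / (4 * ((K : ℝ) + 1)) with hr
  have hr0 : 0 < r := by positivity
  set w := gradient ρ q with hw
  have hw0 : 0 < ‖w‖ := norm_pos_iff.2 (hg q hq)
  refine ⟨q + (2 * r * ‖w‖⁻¹) • w, ?_, fun y hy => ?_⟩
  · rw [sub_add_cancel_left, norm_neg, norm_smul, Real.norm_of_nonneg (by positivity)]
    field_simp
  · by_contra! hcon
    have hqB : q ∈ Metric.closedBall (0 : Eu n) B := hB (frontier_subset_closure hq)
    have hyB : y ∈ Metric.closedBall (0 : Eu n) B := hB (subset_closure hy)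
    have h1 := (((convex_closedBall q ‖y - q‖).inter
      (convex_closedBall (0 : Eu n) B)).norm_image_sub_le_of_norm_hasFDerivWithin_le'
      (f := ρ) (f' := fderiv ℝ ρ) (φ := fderiv ℝ ρ q) (C := K * ‖y - q‖) (x := q) (y := y)
      (fun z _ => (hρ.differentiable (by norm_num) z).hasFDerivAt.hasFDerivWithinAt)
      (fun z hz => (hK.norm_sub_le hz.2 hqB).trans
        (mul_le_mul_of_nonneg_left (mem_closedBall_iff_norm.1 hz.1) K.2))
      ⟨by simp, hqB⟩ ⟨by simp [dist_eq_norm], hyB⟩)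
    have hρq : ρ q = 0 := by rw [hfr] at hq; exact hq
    have hρy : ρ y < 0 := by rw [hΩ] at hy; exact hy
    rw [hρq, ← inner_gradient_left, ← hw, Real.norm_eq_abs] at h1
    have h2 := (abs_le.1 h1).1
    have h3 : ‖y - (q + (2 * r * ‖w‖⁻¹) • w)‖ ^ 2
        = ‖y - q‖ ^ 2 - 2 * (2 * r * ‖w‖⁻¹ * inner ℝ w (y - q)) + (2 * r) ^ 2 := by
      rw [← sub_sub, norm_sub_sq_real, inner_smul_right, real_inner_comm, norm_smul,
        Real.norm_of_nonneg (by positivity), inv_mul_cancel_right₀ hw0.ne']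
    have h4 := pow_lt_pow_left₀ hcon (norm_nonneg _) (two_ne_zero)
    rw [h3] at h4
    have h5 : ‖y - q‖ ^ 2 * ‖w‖ < 4 * r * inner ℝ w (y - q) := by
      have h6 : ‖y - q‖ ^ 2 < 4 * r * inner ℝ w (y - q) * ‖w‖⁻¹ := by linarith
      rwa [← div_eq_mul_inv, lt_div_iff₀ hw0] at h6
    have h7 : 4 * r * inner ℝ w (y - q) ≤ 4 * r * (K * ‖y - q‖ * ‖y - q‖) :=
      mul_le_mul_of_nonneg_left (by linarith) (by positivity)
    have h8 : 4 * r * ((K : ℝ) + 1) = m := by rw [hr]; field_simp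
    have h9 := mul_le_mul_of_nonneg_left (hmg q hq) (sq_nonneg ‖y - q‖)
    have h10 : 0 ≤ 4 * r * ‖y - q‖ ^ 2 := by positivity
    have h11 : ‖y - q‖ ^ 2 * m = 4 * r * (K * ‖y - q‖ * ‖y - q‖) + 4 * r * ‖y - q‖ ^ 2 := by
      rw [← h8]; ring
    linarith

lemma exists_supporting_direction (hΩ : IsOpen Ω) (hconv : Convex ℝ Ω) {x q : Eu n} (hx : x ∈ Ω)
    (hq : q ∉ Ω) : ∃ e : Eu n, ‖e‖ = 1 ∧ ∀ y ∈ Ω, inner ℝ (y - q) e < 0 := by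
  obtain ⟨g, hg⟩ := geometric_hahn_banach_open_point hconv hΩ hq
  set w := (InnerProductSpace.toDual ℝ (Eu n)).symm g with hw
  have hgw : ∀ y, inner ℝ y w = g y := fun y => by
    rw [real_inner_comm, hw, InnerProductSpace.toDual_symm_apply]
  have hw0 : w ≠ 0 := fun h => by
    have := hg x hx
    rw [← hgw, ← hgw, h] at this
    simp at this
  have hw1 := norm_pos_iff.2 hw0
  refine ⟨‖w‖⁻¹ • w, by rw [norm_smul, norm_inv, norm_norm, inv_mul_cancel₀ hw1.ne'],
    fun y hy => ?_⟩
  rw [inner_smul_right, hgw, map_sub]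
  exact mul_neg_of_pos_of_neg (inv_pos.2 hw1) (sub_neg.2 (hg y hy))

lemma exists_ball_le_of_convex (hρ : ContDiff ℝ 2 ρ) (hΩ : Ω = {x | ρ x < 0}) (hΩo : IsOpen Ω)
    (hΩb : Bornology.IsBounded Ω) (hg : ∀ x ∈ frontier Ω, gradient ρ x ≠ 0)
    (hne : (frontier Ω).Nonempty) (hconv : Convex ℝ Ω) :
    ∃ η > 0, ∃ γ > 0, ∀ f : ℝ → ℝ, ContDiff ℝ 1 f → ∀ u, IsPosSol Ω f u → ∀ x ∈ Ω,
      Metric.infDist x (frontier Ω) < η →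
      ∃ z, ∀ y ∈ Metric.ball z γ, y ∈ Ω ∧ u x ≤ u y := by
  have hin : ∀ y e : Eu n, ∑ i, y i * e i = inner ℝ y e := fun y e => by
    simp [PiLp.inner_apply, mul_comm]
  obtain ⟨δ, hδ, hcap⟩ := exists_planeRefl_mem hρ hΩ hΩo hΩb hg
  obtain ⟨B, hB0, hB⟩ := hΩb.closure.subset_closedBall_lt 0 0
  set D := 2 * B with hD
  have hD0 : 0 < D := by positivity
  set ε := δ / (4 * D) with hε
  have hε0 : 0 < ε := by positivity
  have hDε : D * ε = δ / 4 := by rw [hε]; field_simp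
  set γ := min (ε * δ / 8) (δ / 4) with hγ
  have hγ0 : 0 < γ := by positivity
  refine ⟨δ / 4, by positivity, γ, hγ0, fun f hf u hu x hx hxd => ?_⟩
  obtain ⟨q, hq, hqd⟩ := isClosed_frontier.exists_infDist_eq_dist hne x
  rw [hqd, dist_eq_norm] at hxd
  have hqΩ : q ∉ Ω := fun h => by
    rw [frontier, hΩo.interior_eq] at hq; exact hq.2 h
  obtain ⟨e₀, he₀, hsup⟩ := exists_supporting_direction hΩo hconv hx hqΩ
  refine ⟨x - (δ / 2) • e₀, fun y hy => ?_⟩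
  rw [mem_ball_iff_norm] at hy
  set a := x - y with ha
  have h1 : ‖a - (δ / 2) • e₀‖ < γ := by
    have h0 : y - (x - (δ / 2) • e₀) = -(a - (δ / 2) • e₀) := by rw [ha]; abel
    rwa [h0, norm_neg] at hy
  have hh : ‖(δ / 2) • e₀‖ = δ / 2 := by
    rw [norm_smul, he₀, mul_one, Real.norm_of_nonneg (by positivity)]
  have h2 : |‖a‖ - δ / 2| < γ := by
    rw [← hh]; exact (abs_norm_sub_norm_le _ _).trans_lt h1
  have hγ1 : γ ≤ δ / 4 := min_le_right _ _
  have hγ2 : γ ≤ ε * δ / 8 := min_le_left _ _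
  have h3 := abs_lt.1 h2
  have ha0 : 0 < ‖a‖ := by linarith
  set e := ‖a‖⁻¹ • a with he
  have he1 : ‖e‖ = 1 := by rw [he, norm_smul, norm_inv, norm_norm, inv_mul_cancel₀ ha0.ne']
  have hae : ‖a‖ • e = a := by rw [he, smul_smul, mul_inv_cancel₀ ha0.ne', one_smul]
  have hee : ‖e - e₀‖ ≤ ε := by
    have h4 : ‖a‖ * ‖e - e₀‖ ≤ 2 * γ := by
      calc ‖a‖ * ‖e - e₀‖ = ‖‖a‖ • (e - e₀)‖ := by rw [norm_smul, norm_norm]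
        _ = ‖(a - (δ / 2) • e₀) - (‖a‖ - δ / 2) • e₀‖ := by
          rw [smul_sub, hae, sub_smul]; congr 1; abel
        _ ≤ ‖a - (δ / 2) • e₀‖ + ‖(‖a‖ - δ / 2) • e₀‖ := norm_sub_le _ _
        _ ≤ γ + γ := by
          rw [norm_smul (‖a‖ - δ / 2), he₀, mul_one]
          exact add_le_add h1.le h2.le
        _ = 2 * γ := by ring
    have h5 : δ / 4 * ‖e - e₀‖ ≤ ‖a‖ * ‖e - e₀‖ :=
      mul_le_mul_of_nonneg_right (by linarith) (norm_nonneg _)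
    nlinarith
  have hdiam : ∀ y ∈ Ω, ‖y - q‖ ≤ D := fun y hy => by
    have h6 := mem_closedBall_zero_iff.1 (hB (subset_closure hy))
    have h7 := mem_closedBall_zero_iff.1 (hB (frontier_subset_closure hq))
    linarith [norm_sub_le y q]
  set c := inner ℝ q e + δ / 4 with hc
  have hcy : ∀ y ∈ Ω, ∑ i, y i * e i < c := by
    intro y hy
    rw [hin, hc]
    have h8 := hsup y hy
    have h9 : inner ℝ (y - q) (e - e₀) ≤ δ / 4 := by
      rw [← hDε]
      exact (real_inner_le_norm _ _).trans
        (mul_le_mul (hdiam y hy) hee (norm_nonneg _) (by positivity))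
    rw [inner_sub_right] at h9
    have h10 : inner ℝ (y - q) e = inner ℝ y e - inner ℝ q e := inner_sub_left _ _ _
    linarith
  have hcx : c - inner ℝ x e ≤ δ / 2 := by
    have h11 : inner ℝ (q - x) e ≤ δ / 4 := by
      refine (real_inner_le_norm _ _).trans ?_
      rw [he1, mul_one, norm_sub_rev]
      exact hxd.le
    rw [inner_sub_left] at h11
    linarith
  have hcx0 : 0 < c - inner ℝ x e := by
    have := hcy x hx
    rw [hin] at this
    linarith
  set t := ‖a‖ / 2 + (c - inner ℝ x e) with ht
  have ht1 : t ∈ Set.Ioc 0 δ := ⟨by linarith, by linarith⟩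
  have hxt : c - ∑ i, x i * e i < t := by rw [hin]; linarith
  have hy2 : planeRefl e (c - t) x = y := by
    simp only [planeRefl, hin]
    have : 2 * (c - t - inner ℝ x e) = -‖a‖ := by rw [ht]; ring
    rw [this, neg_smul, hae, ha]
    abel
  rw [← hy2]
  exact ⟨hcap e he1 c hcy t ht1 x (subset_closure hx) hxt,
    hu.le_planeRefl hΩo hΩb hf he1 hcy (hcap e he1 c hcy) t ht1 x hx hxt⟩

lemma exists_ball_le_of_plane {Ω : Set (Eu 2)} {ρ : Eu 2 → ℝ} (hρ : ContDiff ℝ 2 ρ)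
    (hΩ : Ω = {x | ρ x < 0}) (hΩo : IsOpen Ω)
    (hΩb : Bornology.IsBounded Ω) (hfr : frontier Ω = {x | ρ x = 0})
    (hg : ∀ x ∈ frontier Ω, gradient ρ x ≠ 0) (hne : (frontier Ω).Nonempty) :
    ∃ η > 0, ∃ γ > 0, ∀ f : ℝ → ℝ, ContDiff ℝ 1 f → (∀ s, 0 ≤ s → 0 ≤ f s) →
      ∀ u, IsPosSol Ω f u → ∀ x ∈ Ω, Metric.infDist x (frontier Ω) < η →
      ∃ z, ∀ y ∈ Metric.ball z γ, y ∈ Ω ∧ u x ≤ u y := by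
  obtain ⟨r, hr, hext⟩ := exists_exterior_ball hρ hΩ hΩb hfr hg
  obtain ⟨B, hB0, hB⟩ := hΩb.closure.subset_closedBall_lt 0 0
  obtain ⟨δ, hδ, hcap⟩ := exists_sphereRefl_mem hρ hΩ hΩo hΩb hg hr (B + 3 * r)
  set ε := min (r / 2) (δ / 12) with hε
  have hε0 : 0 < ε := by positivity
  have hε1 : ε ≤ r / 2 := min_le_left _ _
  have hε2 : ε ≤ δ / 12 := min_le_right _ _
  set σ := δ / (4 * r + δ) with hσ
  have hσ0 : 0 < σ := by positivity
  have hσ1 : σ * (2 * r + δ / 2) = δ / 2 := by rw [hσ]; field_simp; ring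
  set κ := (1 + σ) ^ 2 - 1 with hκ
  have hκ0 : 0 < κ := by rw [hκ]; nlinarith
  refine ⟨δ / 4, by positivity, κ * ε, by positivity, fun f hf hf0 u hu x hx hxd => ?_⟩
  obtain ⟨q, hq, hqd⟩ := isClosed_frontier.exists_infDist_eq_dist hne x
  rw [hqd, dist_eq_norm] at hxd
  obtain ⟨p₀, hqp, hp₀⟩ := hext q hq
  refine ⟨x + κ • (x - p₀), fun y hy => ?_⟩
  rw [mem_ball_iff_norm] at hy
  set p := x - κ⁻¹ • (y - x) with hp
  have hpp : ‖p - p₀‖ < ε := by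
    have h1 : κ • (p - p₀) = -(y - (x + κ • (x - p₀))) := by
      rw [hp, smul_sub, smul_sub, smul_inv_smul₀ hκ0.ne', smul_sub]
      abel
    rw [← norm_neg, ← h1, norm_smul, Real.norm_of_nonneg hκ0.le] at hy
    exact lt_of_mul_lt_mul_left hy hκ0.le
  have hpB : ‖p‖ ≤ B + 3 * r := by
    have h2 := mem_closedBall_zero_iff.1 (hB (frontier_subset_closure hq))
    have h3 : ‖p‖ ≤ ‖p - p₀‖ + ‖q - p₀‖ + ‖q‖ := by
      calc ‖p‖ = ‖(p - p₀) - (q - p₀) + q‖ := by congr 1; abel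
        _ ≤ ‖p - p₀‖ + ‖q - p₀‖ + ‖q‖ :=
          (norm_add_le _ _).trans (by gcongr; exact norm_sub_le _ _)
    linarith
  set R := 2 * r - 2 * ε with hR
  have hrR : r ≤ R := by linarith
  have hRy : ∀ y ∈ Ω, R < ‖y - p‖ := by
    intro y hy
    have h4 := hp₀ y hy
    have h5 : ‖y - p₀‖ ≤ ‖y - p‖ + ‖p - p₀‖ := norm_sub_le_norm_sub_add_norm_sub _ _ _
    linarith
  have hxp : ‖x - p‖ ≤ δ / 4 + 2 * r + ε := by
    have h6 : ‖x - p‖ ≤ ‖x - q‖ + ‖q - p‖ := norm_sub_le_norm_sub_add_norm_sub _ _ _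
    have h7 : ‖q - p‖ ≤ ‖q - p₀‖ + ‖p₀ - p‖ := norm_sub_le_norm_sub_add_norm_sub _ _ _
    rw [norm_sub_rev p₀ p] at h7
    linarith
  have hxp0 : 0 < ‖x - p‖ := by linarith [hRy x hx]
  set t := ‖x - p‖ * (1 + σ) - R with ht
  have hxt : ‖x - p‖ - R < t := by
    have : 0 < ‖x - p‖ * σ := by positivity
    rw [ht]; linarith
  have ht1 : t ∈ Set.Ioc 0 δ := by
    refine ⟨by linarith [hRy x hx], ?_⟩
    have : σ * ‖x - p‖ ≤ σ * (2 * r + δ / 2) := by gcongr; linarith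
    rw [ht]; linarith
  have hy2 : sphereRefl p (R + t) x = y := by
    have h8 : R + t = ‖x - p‖ * (1 + σ) := by rw [ht]; ring
    have h9 : (‖x - p‖ * (1 + σ)) ^ 2 * (‖x - p‖ ^ 2)⁻¹ = 1 + κ := by
      rw [hκ]; field_simp; ring
    have h10 : x - p = κ⁻¹ • (y - x) := by rw [hp]; abel
    simp only [sphereRefl, qreg_zero]
    rw [h8, h9, add_smul, one_smul, ← add_assoc, add_sub_cancel, h10, smul_smul,
      mul_inv_cancel₀ hκ0.ne', one_smul, add_sub_cancel]
  rw [← hy2]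
  exact ⟨hcap p hpB R hrR hRy t ht1 x (subset_closure hx) hxt,
    hu.le_sphereRefl hΩo hΩb hf hf0 (hr.trans_le hrR) hRy (hcap p hpB R hrR hRy) t ht1 x hx hxt⟩

end

section

variable {n : ℕ} {Ω : Set (Eu n)} {f : ℝ → ℝ} {u : Eu n → ℝ}

lemma exists_smooth_cutoff {s U : Set (Eu n)} (hs : IsCompact s) (hU : IsOpen U) (hsU : s ⊆ U) :
    ∃ ζ : Eu n → ℝ, ContDiff ℝ 2 ζ ∧ HasCompactSupport ζ ∧ tsupport ζ ⊆ U ∧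
      (∀ᶠ x in nhdsSet s, ζ x = 1) ∧ ∀ x, ζ x ∈ Set.Icc (0 : ℝ) 1 := by
  obtain ⟨K, hK, hsK, hKU⟩ := exists_compact_between hs hU hsU
  obtain ⟨ζ, h1, h0, h01⟩ := exists_contMDiffMap_one_nhds_of_subset_interior
    (modelWithCornersSelf ℝ (Eu n)) (n := 2) hs.isClosed hsK
  have ht : tsupport ζ ⊆ K := closure_minimal
    (fun x hx => by_contra fun h => hx (h0 x h)) hK.isClosed
  exact ⟨ζ, ζ.contMDiff.contDiff, hK.of_isClosed_subset (isClosed_tsupport _) ht,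
    ht.trans hKU, h1, h01⟩

/-- A classical positive solution agrees on the closure with a global compactly supported one. -/
lemma IsClassicalSol.exists_isPosSol (hΩb : Bornology.IsBounded Ω)
    (hu : IsClassicalSol Ω f u) (hpos : ∀ x ∈ Ω, 0 < u x) :
    ∃ v, IsPosSol Ω f v ∧ ∀ x ∈ closure Ω, v x = u x := by
  obtain ⟨⟨U, hU, hΩU, hC⟩, hsol, h0⟩ := hu
  obtain ⟨ζ, hζ, hζc, hζU, hζ1, _⟩ := exists_smooth_cutoff hΩb.isCompact_closure hU hΩU
  have heq : ∀ x ∈ closure Ω, (fun y => ζ y * u y) =ᶠ[nhds x] u := fun x hx => by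
    filter_upwards [(eventually_nhdsSet_iff_forall.1 hζ1) x hx] with y hy
    rw [hy, one_mul]
  refine ⟨fun x => ζ x * u x, ⟨?_, hζc.mul_right, ?_, ?_, ?_⟩, fun x hx => (heq x hx).self_of_nhds⟩
  · rw [contDiff_iff_contDiffAt]
    intro x
    by_cases hx : x ∈ tsupport ζ
    · exact hζ.contDiffAt.mul (hC.contDiffAt (hU.mem_nhds (hζU hx)))
    · refine (contDiffAt_const (c := (0 : ℝ))).congr_of_eventuallyEq ?_
      filter_upwards [notMem_tsupport_iff_eventuallyEq.1 hx] with y hy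
      rw [hy, Pi.zero_apply, zero_mul]
  · exact fun x hx => (heq x (frontier_subset_closure hx)).self_of_nhds.trans (h0 x hx)
  · exact fun x hx => by
      have := (heq x (subset_closure hx)).self_of_nhds
      simp only at this
      rw [this]; exact hpos x hx
  · intro x hx
    rw [lapl_congr (heq x (subset_closure hx))]
    have := (heq x (subset_closure hx)).self_of_nhds
    simp only at this
    rw [this]; exact hsol x hx

/-- Semi-stability and a bound near the boundary imply a bound. -/
lemma exists_bound_of_bound_near_frontier (hn : n ∈ ({2, 3, 4} : Set ℕ)) (hΩo : IsOpen Ω)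
    (hΩb : Bornology.IsBounded Ω) (hf : ContDiff ℝ 1 f) {d M : ℝ} (hd : 0 < d) (hM : 0 ≤ M) :
    ∃ C, ∀ u, IsPosSol Ω f u → IsSemiStable Ω f u →
      (∀ x ∈ Ω, Metric.infDist x (frontier Ω) < d → u x ≤ M) → ∀ x ∈ Ω, u x ≤ C := by
  set D : Eu n → ℝ := fun x => Metric.infDist x (frontier Ω) with hD
  have hDc : Continuous D := Metric.continuous_infDist_pt _
  have hDΩ : ∀ x ∈ closure Ω, 0 < D x → x ∈ Ω := fun x hx hx0 => by
    by_contra h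
    have : x ∈ frontier Ω := ⟨hx, by rwa [hΩo.interior_eq]⟩
    rw [hD] at hx0
    simp only [Metric.infDist_zero_of_mem this, lt_self_iff_false] at hx0
  have hcpt : ∀ a b : ℝ, IsCompact (closure Ω ∩ {x | a ≤ D x ∧ D x ≤ b}) := fun a b => by
    have hcl : IsClosed {x | a ≤ D x ∧ D x ≤ b} :=
      (isClosed_le continuous_const hDc).inter (isClosed_le hDc continuous_const)
    exact hΩb.isCompact_closure.inter_right hcl
  have hcpt2 : IsCompact (closure Ω ∩ {x | d / 2 ≤ D x}) :=
    hΩb.isCompact_closure.inter_right (isClosed_le continuous_const hDc)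
  have hop : IsOpen (Ω ∩ {x | d / 4 < D x}) := hΩo.inter (isOpen_lt continuous_const hDc)
  have hop2 : IsOpen (Ω ∩ {x | D x < d}) := hΩo.inter (isOpen_lt hDc continuous_const)
  obtain ⟨ζ, hζ, hζc, hζU, hζ1, hζ01⟩ := exists_smooth_cutoff hcpt2 hop (fun x hx =>
    ⟨hDΩ x hx.1 (by linarith [show d / 2 ≤ D x from hx.2]),
      show d / 4 < D x by linarith [show d / 2 ≤ D x from hx.2]⟩)
  obtain ⟨χ, hχ, hχc, hχU, hχ1, _⟩ := exists_smooth_cutoff (hcpt (d / 4) (d / 2)) hop2 (fun x hx =>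
    ⟨hDΩ x hx.1 (by linarith [(show d / 4 ≤ D x ∧ D x ≤ d / 2 from hx.2).1]),
      show D x < d by linarith [(show d / 4 ≤ D x ∧ D x ≤ d / 2 from hx.2).2]⟩)
  have hζ' : ContDiff ℝ 1 ζ := hζ.of_le (by norm_num)
  have hχ' : ContDiff ℝ 1 χ := hχ.of_le (by norm_num)
  obtain ⟨Z, hZ⟩ := (hasCompactSupport_gsq hζc).exists_bound_of_continuous (continuous_gsq hζ')
  obtain ⟨F, hF⟩ := (isCompact_Icc (a := (0 : ℝ)) (b := M)).exists_bound_of_continuousOn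
    hf.continuous.continuousOn
  obtain ⟨B, hB0, hB⟩ := hΩb.subset_closedBall_lt 0 0
  set G := 2 * M * F * (∫ x, χ x ^ 2) + 4 * M ^ 2 * ∫ x, gsq χ x with hG
  have hF0 : 0 ≤ F := (norm_nonneg _).trans (hF 0 ⟨le_rfl, hM⟩)
  have hG0 : 0 ≤ G := by
    have h1 : 0 ≤ ∫ x, χ x ^ 2 := integral_nonneg fun x => sq_nonneg _
    have h2 : 0 ≤ ∫ x, gsq χ x := integral_nonneg fun x => gsq_nonneg _ _
    positivity
  obtain ⟨C, hC⟩ := exists_interior_bound hn (M := M) (half_pos hd)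
    (show (0 : ℝ) < 2 * B + 1 by positivity) ((norm_nonneg _).trans (hZ 0)) hG0
  have hgr : ∀ x, gsq ζ x ≠ 0 → x ∈ Ω ∧ d / 4 < D x ∧ D x < d / 2 := by
    intro x hx
    have hxt : x ∈ tsupport ζ := by
      by_contra h
      exact hx (by simp [gsq, pd_eq_zero_of_notMem_tsupport _ h])
    refine ⟨(hζU hxt).1, (hζU hxt).2, ?_⟩
    by_contra! h
    have h1 : ζ =ᶠ[nhds x] fun _ => 1 :=
      eventually_nhdsSet_iff_forall.1 hζ1 x ⟨subset_closure (hζU hxt).1, h⟩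
    exact hx (by simp [gsq, pd_congr _ h1, pd_const])
  refine ⟨max M C, fun u hu hst hnear y hy => ?_⟩
  by_cases hyd : D y < d
  · exact (hnear y hy hyd).trans (le_max_left _ _)
  push Not at hyd
  refine le_max_of_le_right ?_
  have hχM : ∀ x ∈ tsupport χ, u x ∈ Set.Icc 0 M := fun x hx =>
    ⟨(hu.pos x (hχU hx).1).le, hnear x (hχU hx).1 (hχU hx).2⟩
  refine hC Ω f u ζ χ y hΩo hu.contDiff hu.hasCompactSupport hf hu.sol hst
    (fun x hx => (hu.pos x hx).le) hζ' hζc (fun x hx => (hζU hx).1) (fun x => (hζ01 x).1)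
    (fun x => (hζ01 x).2)
    (hζ1.self_of_nhdsSet y ⟨subset_closure hy, show d / 2 ≤ D y by linarith⟩)
    (fun x hx => ?_) (fun x => (le_abs_self _).trans (hZ x)) hχ'.continuous hχc
    (fun x hx => ?_) (fun x hx => ?_) (fun x hx => ?_) ?_
  · have h1 := mem_closedBall_zero_iff.1 (hB (hζU hx).1)
    have h2 := mem_closedBall_zero_iff.1 (hB hy)
    rw [mem_ball_iff_norm]
    linarith [norm_sub_le x y]
  · have := hgr x hx
    exact hχ1.self_of_nhdsSet x ⟨subset_closure this.1, this.2.1.le, this.2.2.le⟩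
  · have h1 := (hgr x hx).2.2
    have h2 : D y ≤ D x + dist y x := Metric.infDist_le_infDist_add_dist
    rw [dist_comm, dist_eq_norm] at h2
    linarith
  · exact hnear x (hgr x hx).1 ((hgr x hx).2.2.trans (by linarith))
  · exact integral_sq_mul_gsq_le hu.contDiff hu.sol hχ' hχc (fun x hx => (hχU hx).1)
      (fun x hx => by rw [abs_of_nonneg (hχM x hx).1]; exact (hχM x hx).2)
      (fun x hx => hF _ (hχM x hx))

lemma nonempty_frontier_of_isBounded (hn : 2 ≤ n) (hne : Ω.Nonempty)
    (hΩb : Bornology.IsBounded Ω) : (frontier Ω).Nonempty := by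
  have : Nontrivial (Eu n) := by
    have : Nonempty (Fin n) := ⟨⟨0, by omega⟩⟩
    infer_instance
  rw [nonempty_frontier_iff]
  refine ⟨hne, fun h => ?_⟩
  rw [h] at hΩb
  exact NormedSpace.unbounded_univ ℝ (Eu n) hΩb

lemma exists_ball_le (hn : n ∈ ({2, 3, 4} : Set ℕ)) (hΩ : IsSmoothBoundedDomain Ω)
    (hconv : n ∈ ({3, 4} : Set ℕ) → Convex ℝ Ω) :
    ∃ η > 0, ∃ γ > 0, ∀ f : ℝ → ℝ, ContDiff ℝ 1 f → (∀ s, 0 ≤ s → 0 ≤ f s) →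
      ∀ u, IsPosSol Ω f u → ∀ x ∈ Ω, Metric.infDist x (frontier Ω) < η →
      ∃ z, ∀ y ∈ Metric.ball z γ, y ∈ Ω ∧ u x ≤ u y := by
  obtain ⟨hΩo, hΩb, hΩne, ρ, hρ, hΩρ, hfr, hg⟩ := hΩ
  have hρ2 : ContDiff ℝ 2 ρ := contDiff_infty.1 hρ 2
  by_cases h : n ∈ ({3, 4} : Set ℕ)
  · have hn2 : 2 ≤ n := by rcases h with rfl | rfl <;> norm_num
    obtain ⟨η, hη, γ, hγ, H⟩ := exists_ball_le_of_convex hρ2 hΩρ hΩo hΩb hg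
      (nonempty_frontier_of_isBounded hn2 hΩne hΩb) (hconv h)
    exact ⟨η, hη, γ, hγ, fun f hf _ => H f hf⟩
  · obtain rfl : n = 2 := hn.resolve_right h
    exact exists_ball_le_of_plane hρ2 hΩρ hΩo hΩb hfr hg
      (nonempty_frontier_of_isBounded le_rfl hΩne hΩb)

/-- Stable positive solutions are bounded in terms of their integral. -/
lemma exists_bound_of_integral_le (hn : n ∈ ({2, 3, 4} : Set ℕ)) (hΩ : IsSmoothBoundedDomain Ω)
    (hconv : n ∈ ({3, 4} : Set ℕ) → Convex ℝ Ω) (hf : ContDiff ℝ 1 f)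
    (hf0 : ∀ s, 0 ≤ s → 0 ≤ f s) {A : ℝ} (hA : 0 ≤ A) :
    ∃ C, ∀ u, IsPosSol Ω f u → IsSemiStable Ω f u → ∫ x in Ω, u x ≤ A → ∀ x ∈ Ω, u x ≤ C := by
  obtain ⟨η, hη, γ, hγ, H⟩ := exists_ball_le hn hΩ hconv
  have hv : 0 < volume.real (Metric.ball (0 : Eu n) γ) :=
    ENNReal.toReal_pos (Metric.measure_ball_pos _ _ hγ).ne' measure_ball_lt_top.ne
  obtain ⟨C, hC⟩ := exists_bound_of_bound_near_frontier hn hΩ.1 hΩ.2.1 hf hη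
    (M := A / volume.real (Metric.ball (0 : Eu n) γ)) (by positivity)
  refine ⟨C, fun u hu hst hInt => hC u hu hst fun x hx hxd => ?_⟩
  obtain ⟨z, hz⟩ := H f hf hf0 u hu x hx hxd
  have hi : Integrable u := hu.contDiff.continuous.integrable_of_hasCompactSupport
    hu.hasCompactSupport
  rw [le_div_iff₀ hv]
  calc u x * volume.real (Metric.ball (0 : Eu n) γ)
      = ∫ _ in Metric.ball z γ, u x := by
        rw [setIntegral_const, smul_eq_mul, mul_comm, measureReal_def, measureReal_def,
          Measure.addHaar_ball_center volume z]
    _ ≤ ∫ y in Metric.ball z γ, u y :=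
        setIntegral_mono_on (integrableOn_const measure_ball_lt_top.ne) hi.integrableOn
          Metric.isOpen_ball.measurableSet (fun y hy => (hz y hy).2)
    _ ≤ ∫ y in Ω, u y :=
        setIntegral_mono_set hi.integrableOn
          ((ae_restrict_iff' hΩ.1.measurableSet).2 (ae_of_all _ fun y hy => (hu.pos y hy).le))
          (Eventually.of_forall fun y hy => (hz y hy).1)
    _ ≤ A := hInt

end

/-- (Theorem 3(i)) If `f ≥ 0` on `[0,∞)`, any positive weak
solution which is the `L¹(Ω)` limit of classical positive semi-stable solutions
is bounded, for `2 ≤ n ≤ 4` (`Ω` convex when `n ∈ {3,4}`). -/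
theorem weak_limit_bounded_of_nonneg
    (n : ℕ) (hn : n ∈ ({2, 3, 4} : Set ℕ))
    (Ω : Set (EuclideanSpace ℝ (Fin n))) (hΩ : IsSmoothBoundedDomain Ω)
    (hconv : n ∈ ({3, 4} : Set ℕ) → Convex ℝ Ω)
    (f : ℝ → ℝ) (hf : ContDiff ℝ (⊤ : ℕ∞) f) (hfnonneg : ∀ s : ℝ, 0 ≤ s → 0 ≤ f s)
    (u : EuclideanSpace ℝ (Fin n) → ℝ)
    (hweak : IsWeakSol Ω f u)
    (hupos : ∀ᵐ x ∂(volume.restrict Ω), 0 < u x)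
    (uk : ℕ → EuclideanSpace ℝ (Fin n) → ℝ)
    (hsol : ∀ k, IsClassicalSol Ω f (uk k))
    (hstab : ∀ k, IsSemiStable Ω f (uk k))
    (hpos : ∀ k, ∀ x ∈ Ω, 0 < uk k x)
    (hL1 : Tendsto (fun k => ∫ x in Ω, |uk k x - u x|) atTop (nhds 0)) :
    ∃ M : ℝ, ∀ᵐ x ∂(volume.restrict Ω), |u x| ≤ M := by
  have hΩm : MeasurableSet Ω := hΩ.1.measurableSet
  have hui : IntegrableOn u Ω volume := hweak.1
  choose v hv hvu using fun k => (hsol k).exists_isPosSol hΩ.2.1 (hpos k)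
  have hvu' : ∀ k, ∀ x ∈ Ω, v k x = uk k x := fun k x hx => hvu k x (subset_closure hx)
  have hvst : ∀ k, IsSemiStable Ω f (v k) := fun k ξ hξ hξ0 => by
    refine (hstab k ξ hξ hξ0).trans_eq (setIntegral_congr_fun hΩm fun x hx => ?_)
    simp only [hvu' k x hx]
  have hvi : ∀ k, IntegrableOn (v k) Ω volume := fun k =>
    ((hv k).contDiff.continuous.integrable_of_hasCompactSupport
      (hv k).hasCompactSupport).integrableOn
  have hL : Tendsto (fun k => ∫ x in Ω, |v k x - u x|) atTop (nhds 0) := by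
    refine hL1.congr fun k => setIntegral_congr_fun hΩm fun x hx => ?_
    simp only [hvu' k x hx]
  have hA : 0 ≤ (∫ x in Ω, |u x|) + 1 :=
    add_nonneg (integral_nonneg fun x => abs_nonneg _) zero_le_one
  obtain ⟨C, hC⟩ := exists_bound_of_integral_le hn hΩ hconv
    (contDiff_infty.1 hf 1) hfnonneg hA
  have hbd : ∀ᶠ k in atTop, ∀ x ∈ Ω, v k x ≤ C := by
    filter_upwards [hL.eventually_lt_const one_pos] with k hk
    refine hC (v k) (hv k) (hvst k) ?_
    calc ∫ x in Ω, v k x ≤ ∫ x in Ω, (|u x| + |v k x - u x|) := by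
          refine integral_mono (hvi k) (hui.abs.add ((hvi k).sub hui).abs) fun x => ?_
          have h1 := le_abs_self (u x)
          have h2 := le_abs_self (v k x - u x)
          simp only
          linarith
      _ = (∫ x in Ω, |u x|) + ∫ x in Ω, |v k x - u x| :=
          integral_add hui.abs ((hvi k).sub hui).abs
      _ ≤ _ := by linarith
  have hCi : IntegrableOn (fun _ : Eu n => C) Ω volume :=
    integrableOn_const hΩ.2.1.measure_lt_top.ne
  have hmi : IntegrableOn (fun x => max (u x - C) 0) Ω volume :=
    (hui.sub hCi).pos_part
  have hle : ∫ x in Ω, max (u x - C) 0 ≤ 0 := by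
    refine ge_of_tendsto hL ?_
    filter_upwards [hbd] with k hk
    refine setIntegral_mono_on hmi ((hvi k).sub hui).abs hΩm fun x hx => ?_
    refine max_le ?_ (abs_nonneg _)
    have h1 := neg_abs_le (v k x - u x)
    linarith [hk x hx]
  have h0 := (integral_eq_zero_iff_of_nonneg (fun x => le_max_right _ _) hmi).1
    (hle.antisymm (integral_nonneg fun x => le_max_right _ _))
  refine ⟨C, ?_⟩
  filter_upwards [h0, hupos] with x hx hx0
  rw [abs_of_pos hx0]
  have : u x - C ≤ 0 := (le_max_left _ _).trans hx.le
  linarith
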